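/- (Yoccoz's theorem) Let θ ∈ (0,1) be irrational and P_θ(z) = z² + e^{2πiθ}z. Suppose P_θ is linearizable at its fixed point 0, i.e., there exist r > 0 and an injective holomorphic map ψ on the open disk B(0,r) with ψ(0) = 0, ψ'(0) = 1, and P_θ(ψ(z)) = ψ(e^{2πiθ}·z) for all z ∈ B(0,r). Then B(θ) = Σ_n log(q_{n+1})/q_n < ∞, where p_n/q_n are the continued fraction convergents of θ. -/

import Mathlib

open scoped Real ENNReal
open Filter

/-- The Gauss-map iterates: `alphaIter θ k` is `α_{k+1}(θ)`, i.e. `alphaIter θ 0 = α_1(θ) = θ`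
and `α_{i+1}(θ)` is the fractional part of `1/α_i(θ)`. -/
noncomputable def alphaIter (θ : ℝ) : ℕ → ℝ
  | 0 => θ
  | k + 1 => Int.fract (1 / alphaIter θ k)

/-- `HasCF θ a` : `θ` is an irrational number in `(0,1)` whose continued fraction digits
are given by `a` (0-indexed: `a k` is the digit `a_{k+1}` in 1-indexed notation). -/
def HasCF (θ : ℝ) (a : ℕ → ℕ) : Prop :=
  θ ∈ Set.Ioo (0 : ℝ) 1 ∧ Irrational θ ∧ ∀ k, ⌊1 / alphaIter θ k⌋ = (a k : ℤ)

/-- Yoccoz's Brjuno function `Φ(θ) = Σ_{n≥1} α_1(θ)⋯α_{n-1}(θ)·log(1/α_n(θ))`,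
as a real-valued sum. -/
noncomputable def brjunoPhi (θ : ℝ) : ℝ :=
  ∑' k : ℕ, (∏ j ∈ Finset.range k, alphaIter θ j) * Real.log (1 / alphaIter θ k)

/-- Yoccoz's Brjuno function with values in `ℝ≥0∞` (all terms are nonnegative). -/
noncomputable def brjunoPhiE (θ : ℝ) : ℝ≥0∞ :=
  ∑' k : ℕ, ENNReal.ofReal ((∏ j ∈ Finset.range k, alphaIter θ j) * Real.log (1 / alphaIter θ k))

/-- Digits of the noble number `ω = [a_1,…,a_n,1,1,1,…]`. -/
def nobleDigits (n : ℕ) (a : ℕ → ℕ) : ℕ → ℕ := fun k => if k < n then a k else 1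

/-- Digits of `β^N = [a_1,…,a_n,1,…,1,N,1,1,…]`, with `N` in (1-indexed) position `n+m`. -/
def betaDigits (n m N : ℕ) (a : ℕ → ℕ) : ℕ → ℕ :=
  fun k => if k + 1 = n + m then N else if k < n then a k else 1

/-- Digits of `β^I = [a_1,…,a_n,1,…,1,b_{n+m},b_{n+m+1},…]`: the digits of the noble number
with the whole tail from (1-indexed) position `n+m` on replaced by the tail `b`. -/
def tailDigits (n m : ℕ) (a b : ℕ → ℕ) : ℕ → ℕ :=
  fun k => if k + 1 < n + m then (if k < n then a k else 1) else b k

/-- The continued fraction denominators `q_n` built from the digit sequence `a`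
(0-indexed digits: `a 0 = a_1`): `q_0 = 1`, `q_1 = a_1`, `q_{n+1} = a_{n+1}·q_n + q_{n-1}`. -/
def qden (a : ℕ → ℕ) : ℕ → ℕ
  | 0 => 1
  | 1 => a 0
  | (k + 2) => a (k + 1) * qden a (k + 1) + qden a k

section Arithmetic

theorem alphaIter_mem_Ioo {θ : ℝ} {a : ℕ → ℕ} (hθ : HasCF θ a) (k : ℕ) :
    alphaIter θ k ∈ Set.Ioo (0 : ℝ) 1 ∧ Irrational (alphaIter θ k) := by
  induction k with
  | zero => exact ⟨hθ.1, hθ.2.1⟩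
  | succ k ih =>
    have hirr : Irrational (Int.fract (1 / alphaIter θ k)) := by
      unfold Int.fract
      rw [one_div]
      exact ih.2.inv.sub_intCast _
    refine ⟨⟨?_, Int.fract_lt_one _⟩, hirr⟩
    exact lt_of_le_of_ne (Int.fract_nonneg _) (Ne.symm hirr.ne_zero)

theorem alphaIter_inv {θ : ℝ} {a : ℕ → ℕ} (hθ : HasCF θ a) (k : ℕ) :
    1 / alphaIter θ k = a k + alphaIter θ (k + 1) := by
  have h := Int.floor_add_fract (1 / alphaIter θ k)
  rw [hθ.2.2 k] at h
  rw [← h]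
  simp [alphaIter]

theorem one_le_digit {θ : ℝ} {a : ℕ → ℕ} (hθ : HasCF θ a) (k : ℕ) : 1 ≤ a k := by
  have h := alphaIter_inv hθ k
  obtain ⟨⟨h0, h1⟩, -⟩ := alphaIter_mem_Ioo hθ k
  obtain ⟨⟨h2, h3⟩, -⟩ := alphaIter_mem_Ioo hθ (k + 1)
  have h4 : 1 < 1 / alphaIter θ k := by rw [lt_div_iff₀ h0]; linarith
  have : (0 : ℝ) < a k := by linarith
  exact_mod_cast this

/-- The product `α_1 ⋯ α_k`. -/
noncomputable def alphaProd (θ : ℝ) (k : ℕ) : ℝ := ∏ j ∈ Finset.range k, alphaIter θ j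

theorem alphaProd_succ (θ : ℝ) (k : ℕ) :
    alphaProd θ (k + 1) = alphaProd θ k * alphaIter θ k := Finset.prod_range_succ _ _

theorem alphaProd_pos {θ : ℝ} {a : ℕ → ℕ} (hθ : HasCF θ a) (k : ℕ) : 0 < alphaProd θ k :=
  Finset.prod_pos fun j _ => (alphaIter_mem_Ioo hθ j).1.1

theorem qden_pos {θ : ℝ} {a : ℕ → ℕ} (hθ : HasCF θ a) (k : ℕ) :
    1 ≤ qden a k ∧ qden a k ≤ qden a (k + 1) := by
  induction k with
  | zero => exact ⟨le_rfl, one_le_digit hθ 0⟩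
  | succ k ih =>
    refine ⟨ih.1.trans ih.2, ?_⟩
    have := one_le_digit hθ (k + 1)
    change _ ≤ a (k + 1) * qden a (k + 1) + qden a k
    nlinarith [Nat.mul_le_mul_right (qden a (k + 1)) this]

theorem qden_mul_alphaProd {θ : ℝ} {a : ℕ → ℕ} (hθ : HasCF θ a) (k : ℕ) :
    qden a (k + 1) * alphaProd θ (k + 1) + qden a k * alphaProd θ (k + 2) = 1 := by
  induction k with
  | zero =>
    have h := alphaIter_inv hθ 0
    have h0 := (alphaIter_mem_Ioo hθ 0).1.1
    rw [div_eq_iff h0.ne'] at h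
    simp only [alphaProd_succ, qden]
    simp [alphaProd]
    linarith
  | succ k ih =>
    have h := alphaIter_inv hθ (k + 1)
    have h0 := (alphaIter_mem_Ioo hθ (k + 1)).1.1
    rw [div_eq_iff h0.ne'] at h
    rw [alphaProd_succ θ (k + 2)]
    rw [alphaProd_succ θ (k + 1)] at ih ⊢
    simp only [qden]
    push_cast
    rw [show k + 1 + 1 = k + 2 from rfl] at h
    linear_combination ih - qden a (k + 1) * alphaProd θ (k + 1) * h

theorem inv_qden_le {θ : ℝ} {a : ℕ → ℕ} (hθ : HasCF θ a) (k : ℕ) :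
    1 / (qden a k : ℝ) ≤ 2 * alphaProd θ k := by
  have hq : (1 : ℝ) ≤ qden a k := by exact_mod_cast (qden_pos hθ k).1
  rw [div_le_iff₀ (by linarith)]
  cases k with
  | zero => simp [qden, alphaProd]
  | succ k =>
    have h1 := qden_mul_alphaProd hθ k
    have h2 : (qden a k : ℝ) ≤ qden a (k + 1) := by exact_mod_cast (qden_pos hθ k).2
    have h3 : alphaProd θ (k + 2) ≤ alphaProd θ (k + 1) := by
      rw [alphaProd_succ]
      exact mul_le_of_le_one_right (alphaProd_pos hθ _).le (alphaIter_mem_Ioo hθ _).1.2.le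
    have := alphaProd_pos hθ (k + 2)
    nlinarith [mul_le_mul h2 h3 this.le (by linarith)]

theorem qden_succ_le {θ : ℝ} {a : ℕ → ℕ} (hθ : HasCF θ a) (k : ℕ) :
    (qden a (k + 1) : ℝ) ≤ 2 * qden a k * (1 / alphaIter θ k) := by
  have h := alphaIter_inv hθ k
  have h2 : 0 < alphaIter θ (k + 1) := (alphaIter_mem_Ioo hθ (k + 1)).1.1
  have h1 : (1 : ℝ) ≤ a k := by exact_mod_cast one_le_digit hθ k
  have key : (qden a (k + 1) : ℝ) ≤ 2 * qden a k * a k := by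
    cases k with
    | zero => simp only [qden]; push_cast; linarith
    | succ k =>
      have hq := (qden_pos hθ k).2
      have hq' : (qden a k : ℝ) ≤ qden a (k + 1) := by exact_mod_cast hq
      have : (0 : ℝ) ≤ qden a k := by positivity
      change ((a (k + 1) * qden a (k + 1) + qden a k : ℕ) : ℝ) ≤ _
      push_cast
      nlinarith
  have hq0 : (1 : ℝ) ≤ qden a k := by exact_mod_cast (qden_pos hθ k).1
  rw [h]
  nlinarith

theorem qden_growth {θ : ℝ} {a : ℕ → ℕ} (hθ : HasCF θ a) (k : ℕ) :
    (36 / 25 : ℝ) ^ k ≤ 2 * qden a k := by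
  suffices h : (36 / 25 : ℝ) ^ k ≤ 2 * qden a k ∧ (36 / 25 : ℝ) ^ (k + 1) ≤ 2 * qden a (k + 1) from
    h.1
  induction k with
  | zero =>
    have h1 : (1 : ℝ) ≤ a 0 := by exact_mod_cast one_le_digit hθ 0
    refine ⟨by norm_num [qden], ?_⟩
    simp only [qden]
    norm_num
    linarith
  | succ k ih =>
    refine ⟨ih.2, ?_⟩
    have h1 : (1 : ℝ) ≤ a (k + 1) := by exact_mod_cast one_le_digit hθ (k + 1)
    change _ ≤ 2 * ((a (k + 1) * qden a (k + 1) + qden a k : ℕ) : ℝ)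
    push_cast
    have e : (36 / 25 : ℝ) ^ (k + 1 + 1) ≤ (36 / 25 : ℝ) ^ (k + 1) + (36 / 25 : ℝ) ^ k := by
      have : (0 : ℝ) ≤ (36 / 25 : ℝ) ^ k := by positivity
      rw [pow_succ, pow_succ]; nlinarith
    have : (0 : ℝ) ≤ qden a (k + 1) := by positivity
    nlinarith [ih.1, ih.2]

theorem log_div_self_le {x t : ℝ} (ht : 0 < t) (h : t ^ 2 ≤ x) : Real.log x / x ≤ 2 / t := by
  have hx : 0 < x := lt_of_lt_of_le (by positivity) h
  have hs : t ≤ √x := Real.le_sqrt_of_sq_le h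
  have hs0 : 0 < √x := ht.trans_le hs
  have h1 : Real.log x = 2 * Real.log (√x) := by
    rw [Real.log_sqrt hx.le]; ring
  have h2 := Real.log_le_self hs0.le
  have h3 : Real.log x / x ≤ 2 / √x := by
    rw [div_le_div_iff₀ hx hs0, h1]
    nlinarith [Real.mul_self_sqrt hx.le]
  exact h3.trans (by gcongr)

theorem tsum_log_qden_lt_top {θ : ℝ} {a : ℕ → ℕ} (hθ : HasCF θ a) {B : ℝ}
    (hB : ∀ N, ∑ k ∈ Finset.range N, alphaProd θ k * Real.log (1 / alphaIter θ k) ≤ B) :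
    (∑' k : ℕ, ENNReal.ofReal (Real.log (qden a (k + 1)) / qden a k)) < ⊤ := by
  have hnn : ∀ k, 0 ≤ Real.log (1 / alphaIter θ k) := fun k => by
    have := (alphaIter_mem_Ioo hθ k).1
    apply Real.log_nonneg
    rw [le_div_iff₀ this.1]; linarith [this.2]
  have hsum1 : Summable fun k => alphaProd θ k * Real.log (1 / alphaIter θ k) :=
    summable_of_sum_range_le (fun k => mul_nonneg (alphaProd_pos hθ k).le (hnn k)) hB
  have hsum2 : Summable fun k : ℕ => 4 * (5 / 6 : ℝ) ^ k :=
    (summable_geometric_of_lt_one (by norm_num) (by norm_num)).mul_left _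
  have hsum : Summable fun k : ℕ => 4 * (5 / 6 : ℝ) ^ k +
      2 * (alphaProd θ k * Real.log (1 / alphaIter θ k)) := hsum2.add (hsum1.mul_left 2)
  refine lt_of_le_of_lt (ENNReal.tsum_le_tsum fun k => ENNReal.ofReal_le_ofReal (?_ :
    _ ≤ 4 * (5 / 6 : ℝ) ^ k + 2 * (alphaProd θ k * Real.log (1 / alphaIter θ k)))) ?_
  · have hq : (1 : ℝ) ≤ qden a k := by exact_mod_cast (qden_pos hθ k).1
    have hq1 : (1 : ℝ) ≤ qden a (k + 1) := by exact_mod_cast (qden_pos hθ (k + 1)).1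
    have hα := (alphaIter_mem_Ioo hθ k).1.1
    have h1 : Real.log (qden a (k + 1)) ≤
        Real.log (2 * qden a k) + Real.log (1 / alphaIter θ k) := by
      rw [← Real.log_mul (by positivity) (by positivity)]
      exact Real.log_le_log (by linarith) (qden_succ_le hθ k)
    have h2 : Real.log (2 * qden a k) / (2 * qden a k) ≤ 2 / (6 / 5 : ℝ) ^ k := by
      apply log_div_self_le (by positivity)
      rw [← pow_mul, mul_comm, pow_mul]
      convert qden_growth hθ k using 2
      norm_num
    have h3 : Real.log (2 * qden a k) / qden a k ≤ 4 * (5 / 6 : ℝ) ^ k := by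
      have e1 : Real.log (2 * qden a k) / qden a k =
        2 * (Real.log (2 * qden a k) / (2 * qden a k)) := by field_simp
      have e2 : (2 : ℝ) / (6 / 5 : ℝ) ^ k = 2 * (5 / 6 : ℝ) ^ k := by
        rw [div_eq_mul_inv, ← inv_pow]; norm_num
      rw [e1]; rw [e2] at h2; linarith
    have h4 : Real.log (1 / alphaIter θ k) / qden a k ≤
        2 * (alphaProd θ k * Real.log (1 / alphaIter θ k)) := by
      have := mul_le_mul_of_nonneg_left (inv_qden_le hθ k) (hnn k)
      rw [div_eq_mul_one_div]; linarith
    calc _ ≤ (Real.log (2 * qden a k) + Real.log (1 / alphaIter θ k)) / qden a k := by gcongr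
      _ ≤ _ := by rw [add_div]; exact add_le_add h3 h4
  · rw [← ENNReal.ofReal_tsum_of_nonneg _ hsum]
    · exact ENNReal.ofReal_lt_top
    · intro k
      have := mul_nonneg (alphaProd_pos hθ k).le (hnn k)
      positivity

end Arithmetic

section Renormalization

/-- Germs `f(z) = λ z + O(z²)` on the unit disc, with a normalised bound on the nonlinearity. -/
def InG (lam : ℂ) (f : ℂ → ℂ) : Prop :=
  DifferentiableOn ℂ f (Metric.ball 0 1) ∧ ∀ z ∈ Metric.ball (0 : ℂ) 1, ‖f z - lam * z‖ ≤ ‖z‖ ^ 2 / 2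

/-- Some normalised germ with multiplier `lam` has an orbit, contained in the unit disc, which goes
from distance at most `exp (-Y)` of the origin to distance at least `s`. -/
def EscP (s : ℝ) (lam : ℂ) (Y : ℝ) : Prop :=
  ∃ f : ℂ → ℂ, InG lam f ∧ ∃ z : ℂ, ‖z‖ ≤ Real.exp (-Y) ∧
    ∃ n : ℕ, (∀ i ≤ n, ‖f^[i] z‖ < 1) ∧ s ≤ ‖f^[n] z‖

/-- `eTwoPi x = exp (2πi x)`. -/
noncomputable def eTwoPi (x : ℂ) : ℂ := Complex.exp (2 * π * Complex.I * x)

theorem eTwoPi_add (x y : ℂ) : eTwoPi (x + y) = eTwoPi x * eTwoPi y := by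
  simp only [eTwoPi, ← Complex.exp_add]; ring_nf

theorem eTwoPi_int (n : ℤ) : eTwoPi n = 1 := by
  rw [eTwoPi, Complex.exp_eq_one_iff]; exact ⟨n, by ring⟩

theorem eTwoPi_add_int (x : ℂ) (n : ℤ) : eTwoPi (x + n) = eTwoPi x := by
  rw [eTwoPi_add, eTwoPi_int, mul_one]

theorem eTwoPi_add_one (x : ℂ) : eTwoPi (x + 1) = eTwoPi x := by
  simpa using eTwoPi_add_int x 1

theorem eTwoPi_neg_eq_conj (x : ℝ) : eTwoPi (-x) = (starRingEnd ℂ) (eTwoPi x) := by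
  rw [eTwoPi, eTwoPi, ← Complex.exp_conj]
  congr 1
  have h2 : (starRingEnd ℂ) 2 = 2 := map_ofNat _ 2
  simp [Complex.conj_ofReal, h2]

theorem norm_eTwoPi (x : ℂ) : ‖eTwoPi x‖ = Real.exp (-(2 * π * x.im)) := by
  rw [eTwoPi, Complex.norm_exp]; simp

theorem EscP.mono {s : ℝ} {lam : ℂ} {Y Y' : ℝ} (h : EscP s lam Y) (hY : Y' ≤ Y) :
    EscP s lam Y' := by
  obtain ⟨f, hf, z, hz, r⟩ := h
  exact ⟨f, hf, z, hz.trans (Real.exp_le_exp.2 (by linarith)), r⟩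

theorem EscP.of_nonpos {s : ℝ} (hs0 : 0 ≤ s) (hs : s < 1) {lam : ℂ} {Y : ℝ} (hY : Y ≤ 0) :
    EscP s lam Y := by
  refine ⟨fun z => lam * z, ⟨by fun_prop, fun z _ => by simp; positivity⟩, s, ?_, 0, ?_, ?_⟩
  · simp only [Complex.norm_real, Real.norm_eq_abs, abs_of_nonneg hs0]
    exact hs.le.trans (Real.one_le_exp (by linarith))
  · intro i hi
    obtain rfl : i = 0 := by omega
    simpa [abs_of_nonneg hs0] using hs
  · simp [abs_of_nonneg hs0]

theorem EscP.conj {s : ℝ} {lam : ℂ} {Y : ℝ} (h : EscP s lam Y) :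
    EscP s ((starRingEnd ℂ) lam) Y := by
  obtain ⟨f, ⟨hf, hf'⟩, z, hz, n, hn, hs⟩ := h
  set c := starRingEnd ℂ
  have it : ∀ i w, (c ∘ f ∘ c)^[i] (c w) = c (f^[i] w) := by
    intro i w
    induction i with
    | zero => rfl
    | succ i ih => simp only [Function.iterate_succ_apply', ih]; simp [c]
  refine ⟨c ∘ f ∘ c, ⟨?_, ?_⟩, c z, by simpa [c] using hz, n, fun i hi => ?_, ?_⟩
  · intro w hw
    have hw' : c w ∈ Metric.ball (0 : ℂ) 1 := by simpa [c] using hw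
    have h1 := hf.differentiableAt (Metric.isOpen_ball.mem_nhds hw')
    have := (differentiableAt_conj_conj_iff (f := f) (x := w)).2 h1
    exact this.differentiableWithinAt
  · intro w hw
    have hw' : c w ∈ Metric.ball (0 : ℂ) 1 := by simpa [c] using hw
    have h1 := hf' _ hw'
    have e : (c ∘ f ∘ c) w - c lam * w = c (f (c w) - lam * c w) := by simp [c]
    rw [e, RCLike.norm_conj]
    simpa only [c, RCLike.norm_conj] using h1
  · rw [it]; simpa [c] using hn i hi
  · rw [it]; simpa [c] using hs

/-- Partial sums of Yoccoz's form of the Brjuno series, by recursion along the Gauss map. -/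
noncomputable def brjunoPartial : ℕ → ℝ → ℝ
  | 0, _ => 0
  | N + 1, x => Real.log (1 / x) + x * brjunoPartial N (Int.fract (1 / x))

theorem alphaProd_mul_brjunoPartial (θ : ℝ) (N k : ℕ) :
    alphaProd θ k * brjunoPartial N (alphaIter θ k) =
      ∑ j ∈ Finset.range N, alphaProd θ (k + j) * Real.log (1 / alphaIter θ (k + j)) := by
  induction N generalizing k with
  | zero => simp [brjunoPartial]
  | succ N ih =>
    rw [Finset.sum_range_succ', brjunoPartial]
    have h := ih (k + 1)
    simp only [alphaProd_succ, alphaIter] at h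
    rw [mul_add, ← mul_assoc, h, add_zero, add_comm]
    congr 1
    refine Finset.sum_congr rfl fun j _ => ?_
    rw [show k + 1 + j = k + (j + 1) by ring]

theorem fract_inv_mem {x : ℝ} (hx : x ∈ Set.Ioo (0 : ℝ) 1) (hirr : Irrational x) :
    Int.fract (1 / x) ∈ Set.Ioo (0 : ℝ) 1 ∧ Irrational (Int.fract (1 / x)) :=
  alphaIter_mem_Ioo (θ := x) (a := fun k => (⌊1 / alphaIter x k⌋).toNat)
    ⟨hx, hirr, fun k => by
      refine (Int.toNat_of_nonneg (Int.floor_nonneg.2 ?_)).symm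
      cases k with
      | zero => exact one_div_nonneg.2 hx.1.le
      | succ k => exact one_div_nonneg.2 (Int.fract_nonneg _)⟩ 1

theorem eTwoPi_neg_inv (x : ℝ) :
    eTwoPi (-(1 / x : ℝ)) = (starRingEnd ℂ) (eTwoPi (Int.fract (1 / x) : ℝ)) := by
  rw [eTwoPi_neg_eq_conj]
  congr 1
  conv_lhs => rw [← Int.fract_add_floor (1 / x)]
  push_cast
  rw [eTwoPi_add_int]

theorem escP_brjunoPartial {s C : ℝ} (hs0 : 0 ≤ s) (hs : s < 1) (hC : Real.log 2 ≤ C)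
    (step : ∀ α : ℝ, 0 < α → α ≤ 1 / 2 → ∀ Y : ℝ, 0 ≤ Y → EscP s (eTwoPi (-(1 / α : ℝ))) Y →
      EscP s (eTwoPi α) (α * Y + Real.log (1 / α) - C))
    (N : ℕ) : ∀ x : ℝ, x ∈ Set.Ioo (0 : ℝ) 1 → Irrational x →
      EscP s (eTwoPi x) (brjunoPartial N x - 2 * C) := by
  have hC0 : 0 ≤ C := (Real.log_nonneg (by norm_num)).trans hC
  have step' : ∀ α : ℝ, 0 < α → α ≤ 1 / 2 → ∀ Y : ℝ, EscP s (eTwoPi (-(1 / α : ℝ))) Y →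
      EscP s (eTwoPi α) (α * Y + Real.log (1 / α) - C) := by
    intro α h0 h1 Y hY
    rcases le_total 0 Y with h | h
    · exact step α h0 h1 Y h hY
    · refine (step α h0 h1 0 le_rfl (EscP.of_nonpos hs0 hs le_rfl)).mono ?_
      nlinarith
  have hlog : ∀ x : ℝ, x ∈ Set.Ioo (0 : ℝ) 1 → 0 ≤ Real.log (1 / x) := fun x hx => by
    apply Real.log_nonneg
    rw [le_div_iff₀ hx.1]; linarith [hx.2]
  induction N using Nat.strong_induction_on with
  | _ N ih =>
  intro x hx hirr
  obtain ⟨hf, hfirr⟩ := fract_inv_mem hx hirr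
  rcases le_or_gt x (1 / 2) with hx2 | hx2
  · rcases N with _ | N
    · exact EscP.of_nonpos hs0 hs (by simp [brjunoPartial]; linarith)
    have h1 := (ih N (by omega) _ hf hfirr).conj
    rw [← eTwoPi_neg_inv] at h1
    refine (step' x hx.1 hx2 _ h1).mono ?_
    rw [brjunoPartial]
    nlinarith [hx.1]
  · have hlx : Real.log (1 / x) ≤ Real.log 2 := by
      apply Real.log_le_log (one_div_pos.2 hx.1)
      rw [div_le_iff₀ hx.1]; linarith
    rcases N with _ | _ | N
    · exact EscP.of_nonpos hs0 hs (by simp [brjunoPartial]; linarith)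
    · exact EscP.of_nonpos hs0 hs (by simp only [brjunoPartial]; linarith)
    set y := Int.fract (1 / x) with hy
    obtain ⟨hf2, hfirr2⟩ := fract_inv_mem hf hfirr
    have hxy : 1 / x = 1 + y := by
      have h1 : ⌊1 / x⌋ = 1 := by
        rw [Int.floor_eq_iff]
        constructor
        · rw [le_div_iff₀ hx.1]; norm_num; exact hx.2.le
        · rw [div_lt_iff₀ hx.1]; norm_num; linarith
      have := Int.fract_add_floor (1 / x)
      rw [h1] at this; push_cast at this; linarith
    have hxy' : 1 - x = x * y := by
      rw [div_eq_iff hx.1.ne'] at hxy; linarith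
    have hx'0 : 0 < 1 - x := by linarith [hx.2]
    have hinv : 1 / (1 - x) = 1 / y + 1 := by
      rw [hxy', div_eq_iff (mul_pos hx.1 hf.1).ne', add_mul, one_div_mul_eq_div,
        mul_div_assoc, div_self hf.1.ne']
      linarith
    have h1 := (ih N (by omega) _ hf2 hfirr2).conj
    rw [← eTwoPi_neg_inv] at h1
    have e1 : eTwoPi (-(1 / y : ℝ)) = eTwoPi (-(1 / (1 - x) : ℝ)) := by
      rw [hinv, ← eTwoPi_add_one (-((1 / y + 1 : ℝ) : ℂ))]
      congr 1; push_cast; ring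
    rw [e1] at h1
    have h2 := (step' (1 - x) hx'0 (by linarith) _ h1).conj
    have e2 : (starRingEnd ℂ) (eTwoPi ((1 - x : ℝ) : ℂ)) = eTwoPi x := by
      rw [← eTwoPi_neg_eq_conj, ← eTwoPi_add_one]
      congr 1; push_cast; ring
    rw [e2] at h2
    refine h2.mono ?_
    have e3 : Real.log (1 / (1 - x)) = Real.log (1 / x) + Real.log (1 / y) := by
      rw [hxy', ← Real.log_mul (one_div_pos.2 hx.1).ne' (one_div_pos.2 hf.1).ne']
      congr 1; rw [div_mul_div_comm, one_mul]
    simp only [brjunoPartial, ← hy]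
    rw [e3]
    set P := brjunoPartial N (Int.fract (1 / y))
    have e4 : (1 - x) * P = x * (y * P) := by rw [hxy', mul_assoc]
    nlinarith [mul_nonneg hx'0.le (hlog y hf)]

theorem brjuno_of_step {s C Y₀ : ℝ} (hs0 : 0 ≤ s) (hs : s < 1)
    (step : ∀ α : ℝ, 0 < α → α ≤ 1 / 2 → ∀ Y : ℝ, 0 ≤ Y → EscP s (eTwoPi (-(1 / α : ℝ))) Y →
      EscP s (eTwoPi α) (α * Y + Real.log (1 / α) - C))
    {θ : ℝ} {a : ℕ → ℕ} (hθ : HasCF θ a) (hno : ¬ EscP s (eTwoPi θ) Y₀) :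
    (∑' k : ℕ, ENNReal.ofReal (Real.log (qden a (k + 1)) / qden a k)) < ⊤ := by
  set C' := max C (Real.log 2)
  refine tsum_log_qden_lt_top hθ (B := Y₀ + 2 * C') fun N => ?_
  by_contra! hlt
  apply hno
  have h := escP_brjunoPartial (C := C') hs0 hs (le_max_right _ _)
    (fun α h0 h1 Y hY hE => (step α h0 h1 Y hY hE).mono (by linarith [le_max_left C (Real.log 2)]))
    N θ hθ.1 hθ.2.1
  refine h.mono ?_
  have := alphaProd_mul_brjunoPartial θ N 0
  simp only [alphaProd, Finset.range_zero, Finset.prod_empty, one_mul, alphaIter, zero_add] at this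
  rw [this]
  simp only [alphaProd] at hlt
  linarith

end Renormalization

section HolomorphicTools

open Metric Set Topology

theorem norm_deriv_le_of_ball {f : ℂ → ℂ} {c : ℂ} {R C : ℝ} (hR : 0 < R)
    (hf : DifferentiableOn ℂ f (ball c R)) (hC : ∀ z ∈ ball c R, ‖f z‖ ≤ C) :
    ‖deriv f c‖ ≤ C / R := by
  have hC0 : 0 ≤ C := (norm_nonneg _).trans (hC c (mem_ball_self hR))
  have key : ∀ r ∈ Ioo 0 R, ‖deriv f c‖ * r ≤ C := fun r hr => by
    rw [← le_div_iff₀ hr.1]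
    have hsub : closedBall c r ⊆ ball c R := closedBall_subset_ball hr.2
    refine Complex.norm_deriv_le_of_forall_mem_sphere_norm_le hr.1 ?_ fun z hz =>
      hC z (hsub (sphere_subset_closedBall hz))
    exact (hf.mono hsub).diffContOnCl_ball le_rfl
  rw [le_div_iff₀ hR]
  have hlim : Tendsto (fun r : ℝ => ‖deriv f c‖ * r) (𝓝[<] R) (𝓝 (‖deriv f c‖ * R)) :=
    ((continuous_const.mul continuous_id).tendsto R).mono_left nhdsWithin_le_nhds
  refine le_of_tendsto hlim ?_
  filter_upwards [Ioo_mem_nhdsLT hR] with r hr using key r hr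

theorem norm_deriv_le_of_ball_subset {f : ℂ → ℂ} {U : Set ℂ} {c : ℂ} {R C : ℝ} (hR : 0 < R)
    (hf : DifferentiableOn ℂ f U) (hC : ∀ z ∈ U, ‖f z‖ ≤ C) (hs : ball c R ⊆ U) :
    ‖deriv f c‖ ≤ C / R :=
  norm_deriv_le_of_ball hR (hf.mono hs) fun z hz => hC z (hs hz)

theorem lipschitz_of_deriv_le {f : ℂ → ℂ} {U : Set ℂ} {K : ℝ} (hU : IsOpen U) (hc : Convex ℝ U)
    (hf : DifferentiableOn ℂ f U) (hK : ∀ z ∈ U, ‖deriv f z‖ ≤ K) {x y : ℂ} (hx : x ∈ U)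
    (hy : y ∈ U) : ‖f x - f y‖ ≤ K * ‖x - y‖ :=
  hc.norm_image_sub_le_of_norm_deriv_le (fun _ hz => hf.differentiableAt (hU.mem_nhds hz)) hK hy hx

theorem quad_bound {f : ℂ → ℂ} {r M : ℝ} (hf : DifferentiableOn ℂ f (ball 0 r))
    (hM : ∀ z ∈ ball (0 : ℂ) r, ‖f z‖ ≤ M) (h0 : f 0 = 0) (h1 : deriv f 0 = 0) {z : ℂ}
    (hz : z ∈ ball (0 : ℂ) r) : ‖f z‖ ≤ M / r ^ 2 * ‖z‖ ^ 2 := by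
  have hr : 0 < r := nonempty_ball.1 ⟨z, hz⟩
  have hd : HasDerivAt f 0 0 := by
    have := (hf.differentiableAt (ball_mem_nhds _ hr)).hasDerivAt
    rwa [h1] at this
  have ho : (f · - f 0) =o[𝓝 0] (fun w : ℂ => ‖w - 0‖ ^ 1) := by
    have := hd.isLittleO
    simp only [smul_zero, sub_zero] at this
    simpa using this.norm_right
  have := Complex.dist_le_mul_div_pow_of_mapsTo_ball_of_isLittleO (R₂ := M) hf
    (fun w hw => by simpa [h0] using hM w hw) ho hz
  simp only [h0, dist_zero_right] at this
  calc _ ≤ _ := this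
    _ = _ := by rw [div_pow]; norm_num; ring

theorem deriv_le_of_quad {f : ℂ → ℂ} {r A : ℝ} (hf : DifferentiableOn ℂ f (ball 0 r))
    (hA : ∀ z ∈ ball (0 : ℂ) r, ‖f z‖ ≤ A * ‖z‖ ^ 2) {z : ℂ} (hz : ‖z‖ < r / 2) :
    ‖deriv f z‖ ≤ 4 * A * ‖z‖ := by
  have hr : 0 < r := by linarith [norm_nonneg z]
  rcases eq_or_ne z 0 with rfl | hz0
  · have h0 : f 0 = 0 := by simpa using hA 0 (mem_ball_self hr)
    have hd := (hf.differentiableAt (ball_mem_nhds _ hr)).hasDerivAt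
    have hz' : HasDerivAt f 0 0 := by
      rw [hasDerivAt_iff_isLittleO]
      simp only [h0, sub_zero, smul_zero]
      have h2 : f =O[𝓝 0] fun z : ℂ => z ^ 2 := by
        refine Asymptotics.IsBigO.of_bound A ?_
        filter_upwards [ball_mem_nhds (0 : ℂ) hr] with w hw
        simpa using hA w hw
      refine h2.trans_isLittleO ?_
      simpa using Asymptotics.isLittleO_pow_id (𝕜 := ℂ) (n := 2) (by norm_num)
    simp [hz'.deriv]
  · have hzp : 0 < ‖z‖ := norm_pos_iff.2 hz0
    have hw : ∀ w ∈ ball z ‖z‖, ‖w‖ < 2 * ‖z‖ := fun w hw => by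
      have h1 : ‖w - z‖ < ‖z‖ := by simpa [dist_eq_norm] using hw
      have h2 := norm_add_le (w - z) z
      rw [sub_add_cancel] at h2
      linarith
    have hs : ball z ‖z‖ ⊆ ball 0 r := fun w h => by
      have := hw w h
      simp only [mem_ball, dist_zero_right]; linarith
    have hA0 : 0 ≤ A := by
      have := (norm_nonneg _).trans (hA z (hs (mem_ball_self hzp)))
      exact nonneg_of_mul_nonneg_left this (by positivity)
    have := norm_deriv_le_of_ball (C := A * (2 * ‖z‖) ^ 2) hzp (hf.mono hs) fun w h =>
      (hA w (hs h)).trans (by gcongr; exact (hw w h).le)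
    calc _ ≤ _ := this
      _ = _ := by field_simp; ring

theorem lipschitz_of_quad {f : ℂ → ℂ} {r A δ : ℝ} (hA0 : 0 ≤ A)
    (hf : DifferentiableOn ℂ f (ball 0 r))
    (hA : ∀ z ∈ ball (0 : ℂ) r, ‖f z‖ ≤ A * ‖z‖ ^ 2) (hδ : δ ≤ r / 2) {x y : ℂ}
    (hx : x ∈ ball (0 : ℂ) δ) (hy : y ∈ ball (0 : ℂ) δ) :
    ‖f x - f y‖ ≤ 4 * A * δ * ‖x - y‖ := by
  have hδ0 : 0 < δ := nonempty_ball.1 ⟨x, hx⟩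
  refine lipschitz_of_deriv_le isOpen_ball (convex_ball 0 δ)
    (hf.mono (ball_subset_ball (by linarith))) (fun z hz => ?_) hx hy
  have hz' : ‖z‖ < δ := by simpa using hz
  exact (deriv_le_of_quad hf hA (by linarith)).trans (by gcongr)

theorem exists_inverse_near_id {h : ℂ → ℂ} {c : ℂ} {a b ε : ℝ} (hε0 : 0 ≤ ε)
    (hd : DifferentiableOn ℂ h (ball c b))
    (hlip : ∀ x ∈ ball c b, ∀ y ∈ ball c b, ‖h x - h y‖ ≤ 1 / 2 * ‖x - y‖)
    (hε : ∀ x ∈ ball c b, ‖h x‖ ≤ ε) (hab : a + ε ≤ b) :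
    ∃ u : ℂ → ℂ, DifferentiableOn ℂ u (ball c a) ∧
      ∀ y ∈ ball c a, u y ∈ ball c b ∧ u y + h (u y) = y := by
  have hex : ∀ y, ∃ x, y ∈ ball c a → x ∈ ball c b ∧ x + h x = y := by
    intro y
    by_cases hy : y ∈ ball c a
    swap
    · exact ⟨0, fun h => absurd h hy⟩
    have hy' : ‖y - c‖ < a := by simpa [dist_eq_norm] using hy
    have hsub : closedBall c (‖y - c‖ + ε) ⊆ ball c b :=
      closedBall_subset_ball (by linarith)
    set T : ℂ → ℂ := fun x => y - h x
    have hmaps : MapsTo T (closedBall c (‖y - c‖ + ε)) (closedBall c (‖y - c‖ + ε)) := by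
      intro x hx
      have h1 := hε x (hsub hx)
      rw [mem_closedBall, dist_eq_norm]
      calc ‖y - h x - c‖ = ‖(y - c) - h x‖ := by ring_nf
        _ ≤ _ := (norm_sub_le _ _).trans (by linarith)
    have hT : ContractingWith (1 / 2) (hmaps.restrict T _ _) := by
      refine ⟨by rw [← NNReal.coe_lt_coe]; norm_num, ?_⟩
      refine LipschitzWith.of_dist_le_mul fun x z => ?_
      have := hlip z (hsub z.2) x (hsub x.2)
      rw [Subtype.dist_eq, Subtype.dist_eq, dist_eq_norm, dist_eq_norm]
      simp only [MapsTo.val_restrict_apply, T, sub_sub_sub_cancel_left]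
      rw [norm_sub_rev (x : ℂ)]
      simpa using this
    obtain ⟨x, hx, hfix, -⟩ := hT.exists_fixedPoint' isClosed_closedBall.isComplete hmaps
      (x := c) (by simp; positivity) (edist_ne_top _ _)
    refine ⟨x, fun _ => ⟨hsub hx, ?_⟩⟩
    have : y - h x = x := hfix
    linear_combination -this
  choose u hu using hex
  refine ⟨u, fun y hy => ?_, hu⟩
  have hlipu : ∀ y ∈ ball c a, ∀ z ∈ ball c a, ‖u y - u z‖ ≤ 2 * ‖y - z‖ := by
    intro y hy z hz
    obtain ⟨h1, h2⟩ := hu y hy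
    obtain ⟨h3, h4⟩ := hu z hz
    have h5 := hlip _ h1 _ h3
    have h6 : u y - u z = (y - z) - (h (u y) - h (u z)) := by
      linear_combination h2 - h4
    have h7 := norm_sub_le (y - z) (h (u y) - h (u z))
    rw [← h6] at h7
    linarith
  obtain ⟨h1, h2⟩ := hu y hy
  have hnb : ball c a ∈ 𝓝 y := isOpen_ball.mem_nhds hy
  have hcont : ContinuousAt u y := by
    rw [Metric.continuousAt_iff]
    intro e he
    obtain ⟨d, hd, hds⟩ := Metric.mem_nhds_iff.1 hnb
    refine ⟨min d (e / 2), by positivity, fun {x} hx => ?_⟩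
    have := hlipu x (hds (lt_of_lt_of_le hx (min_le_left _ _))) y hy
    rw [dist_eq_norm] at hx ⊢
    linarith [lt_of_lt_of_le hx (min_le_right _ _)]
  have hdh : DifferentiableAt ℂ h (u y) := hd.differentiableAt (isOpen_ball.mem_nhds h1)
  have hder : ‖deriv h (u y)‖ ≤ 1 / 2 := by
    have hb : ball c b ∈ 𝓝 (u y) := isOpen_ball.mem_nhds h1
    have := norm_deriv_le_of_lip' (f := h) (x₀ := u y) (C := 1 / 2) (by norm_num) (by
      filter_upwards [hb] with x hx using hlip x hx _ h1)
    exact this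
  have hne : (1 : ℂ) + deriv h (u y) ≠ 0 := by
    intro h0
    have : deriv h (u y) = -1 := by linear_combination h0
    rw [this] at hder; norm_num at hder
  exact (HasDerivAt.of_local_left_inverse (f := fun x => x + h x) hcont
    ((hasDerivAt_id _).add hdh.hasDerivAt) hne (by
      filter_upwards [hnb] with z hz using (hu z hz).2)).differentiableAt.differentiableWithinAt

theorem exists_log_on_ball {g : ℂ → ℂ} {c : ℂ} {r : ℝ} (hr : 0 < r)
    (hg : DifferentiableOn ℂ g (ball c r)) (h0 : ∀ z ∈ ball c r, g z ≠ 0) :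
    ∃ l : ℂ → ℂ, DifferentiableOn ℂ l (ball c r) ∧ ∀ z ∈ ball c r, Complex.exp (l z) = g z := by
  have hdg : DifferentiableOn ℂ (fun z => deriv g z / g z) (ball c r) :=
    (hg.deriv isOpen_ball).div hg h0
  obtain ⟨l, hl⟩ := hdg.isExactOn_ball
  have hl' : DifferentiableOn ℂ l (ball c r) := fun z hz =>
    (hl z hz).differentiableAt.differentiableWithinAt
  have hc : c ∈ ball c r := mem_ball_self hr
  set k := Complex.log (g c) - l c
  refine ⟨fun z => l z + k, by fun_prop, fun z hz => ?_⟩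
  have hder : ∀ w ∈ ball c r, HasDerivAt (fun z => g z * Complex.exp (-(l z + k))) 0 w := by
    intro w hw
    have h1 := (hg.differentiableAt (isOpen_ball.mem_nhds hw)).hasDerivAt
    have h2 := (((hl w hw).add_const k).neg).cexp
    refine (h1.mul h2).congr_deriv ?_
    have := h0 w hw
    field_simp
    ring
  have hconst := (convex_ball c r).is_const_of_fderivWithin_eq_zero (𝕜 := ℂ)
    (f := fun z => g z * Complex.exp (-(l z + k)))
    (fun w hw => (hder w hw).differentiableAt.differentiableWithinAt)
    (fun w hw => by
      rw [fderivWithin_of_isOpen isOpen_ball hw]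
      have := (hder w hw).hasFDerivAt.fderiv
      rw [this]; ext; simp) hz hc
  have e1 : g c * Complex.exp (-(l c + k)) = 1 := by
    simp only [k, add_sub_cancel, Complex.exp_neg, Complex.exp_log (h0 c hc)]
    exact mul_inv_cancel₀ (h0 c hc)
  simp only [e1] at hconst
  rw [Complex.exp_neg] at hconst
  field_simp at hconst
  exact hconst.symm

theorem cube_le_of_nonvanishing {g : ℂ → ℂ} (hg : DifferentiableOn ℂ g (ball 0 2))
    (h0 : ∀ z ∈ ball (0 : ℂ) 2, g z ≠ 0) (h1 : ∀ z ∈ ball (0 : ℂ) 2, ‖g z‖ ≤ 1) :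
    ‖g 0‖ ^ 3 ≤ ‖g 1‖ := by
  obtain ⟨l, hl, hlg⟩ := exists_log_on_ball (by norm_num) hg h0
  have hre : ∀ z ∈ ball (0 : ℂ) 2, (l z).re ≤ 0 := fun z hz => by
    have := h1 z hz
    rw [← hlg z hz, Complex.norm_exp] at this
    exact Real.exp_le_one_iff.1 this
  have m0 : (0 : ℂ) ∈ ball (0 : ℂ) 2 := by simp
  have m1 : (1 : ℂ) ∈ ball (0 : ℂ) 2 := by simp
  have key : ‖l 1 - l 0‖ ≤ 2 * (-(l 0).re) := by
    refine le_of_forall_pos_le_add fun e he => ?_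
    have := Complex.borelCaratheodory_zero (f := fun z => l z - l 0) (M := -(l 0).re + e / 2)
      (R := 2) (z := 1) (by linarith [hre 0 m0]) (hl.sub_const _)
      (fun z hz => by simp; linarith [hre z hz]) (by norm_num) m1 (by simp)
    norm_num at this
    linarith
  rw [← hlg 0 m0, ← hlg 1 m1, Complex.norm_exp, Complex.norm_exp, ← Real.exp_nat_mul]
  apply Real.exp_le_exp.2
  have := (Complex.abs_re_le_norm (l 1 - l 0)).trans key
  rw [abs_le] at this
  simp at this
  push_cast
  linarith [this.1]

theorem differentiableOn_integral_param {α : Type*} [MeasurableSpace α]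
    {μ : MeasureTheory.Measure α} {F : ℂ → α → ℂ} {U : Set ℂ} (hU : IsOpen U)
    (hmeas : ∀ x ∈ U, MeasureTheory.AEStronglyMeasurable (F x) μ)
    (hdiff : ∀ᵐ a ∂μ, DifferentiableOn ℂ (fun x => F x a) U) {bound : α → ℝ}
    (hbound : MeasureTheory.Integrable bound μ) (hb : ∀ᵐ a ∂μ, ∀ x ∈ U, ‖F x a‖ ≤ bound a) :
    DifferentiableOn ℂ (fun x => ∫ a, F x a ∂μ) U := by
  intro x₀ hx₀
  obtain ⟨R, hR, hRU⟩ := Metric.isOpen_iff.1 hU x₀ hx₀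
  have hball : ∀ x ∈ ball x₀ (R / 2), ball x (R / 2) ⊆ U := fun x hx => by
    refine (ball_subset_ball' ?_).trans hRU
    have : dist x x₀ < R / 2 := hx
    linarith
  have key := hasDerivAt_integral_of_dominated_loc_of_lip (μ := μ) (F := F) (x₀ := x₀)
    (s := ball x₀ (R / 2)) (F' := fun a => deriv (fun x => F x a) x₀)
    (bound := fun a => bound a / (R / 2)) (ball_mem_nhds _ (by positivity))
    (by filter_upwards [hU.mem_nhds hx₀] with x hx using hmeas x hx)
    ((hbound.mono' (hmeas x₀ hx₀) (by filter_upwards [hb] with a ha using ha x₀ hx₀)))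
    ?_ ?_ (hbound.div_const _) ?_
  · exact key.2.differentiableAt.differentiableWithinAt
  · have hseq : Tendsto (fun n : ℕ => x₀ + ((R / 2 : ℝ) : ℂ) * (1 / ((n : ℂ) + 2))) atTop (𝓝 x₀) := by
      have h1 : Tendsto (fun n : ℕ => (1 / ((n : ℂ) + 2))) atTop (𝓝 0) := by
        have := (tendsto_one_div_add_atTop_nhds_zero_nat (𝕜 := ℂ)).comp (tendsto_add_atTop_nat 1)
        refine this.congr fun n => ?_
        simp only [Function.comp_apply]; push_cast; ring_nf
      simpa using (h1.const_mul ((R / 2 : ℝ) : ℂ)).const_add x₀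
    set t : ℕ → ℂ := fun n => ((R / 2 : ℝ) : ℂ) * (1 / ((n : ℂ) + 2))
    have ht : ∀ n, t n ≠ 0 := fun n => by
      have : ((n : ℂ) + 2) ≠ 0 := by exact_mod_cast (by omega : n + 2 ≠ 0)
      simp only [t]
      refine mul_ne_zero ?_ (one_div_ne_zero this)
      exact_mod_cast (by positivity : R / 2 ≠ 0)
    have hmem : ∀ n, x₀ + t n ∈ U := fun n => by
      apply hRU
      rw [mem_ball, dist_eq_norm, add_sub_cancel_left, norm_mul, Complex.norm_real,
        Real.norm_of_nonneg (by positivity)]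
      have : ‖1 / ((n : ℂ) + 2)‖ ≤ 1 := by
        rw [norm_div, norm_one]
        have : ‖(n : ℂ) + 2‖ = n + 2 := by
          have := Complex.norm_natCast (n + 2); push_cast at this; exact this
        rw [this, div_le_one (by positivity)]
        linarith [Nat.cast_nonneg (α := ℝ) n]
      nlinarith
    refine aestronglyMeasurable_of_tendsto_ae (u := atTop)
      (f := fun n a => (t n)⁻¹ * (F (x₀ + t n) a - F x₀ a)) (fun n =>
        ((hmeas _ (hmem n)).sub (hmeas _ hx₀)).const_mul _) ?_
    filter_upwards [hdiff] with a ha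
    have hd := (ha.differentiableAt (hU.mem_nhds hx₀)).hasDerivAt
    have hs := hasDerivAt_iff_tendsto_slope_zero.1 hd
    have ht0 : Tendsto t atTop (𝓝[≠] 0) := by
      refine tendsto_nhdsWithin_iff.2 ⟨?_, Eventually.of_forall fun n => ht n⟩
      have := hseq.sub_const x₀
      simp only [add_sub_cancel_left, sub_self] at this
      exact this
    exact hs.comp ht0
  · filter_upwards [hdiff, hb] with a ha hba
    have hnn : 0 ≤ bound a := (norm_nonneg _).trans (hba _ hx₀)
    refine LipschitzOnWith.of_dist_le_mul fun x hx y hy => ?_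
    rw [dist_eq_norm, dist_eq_norm, Real.coe_nnabs, abs_of_nonneg (by positivity)]
    exact lipschitz_of_deriv_le isOpen_ball (convex_ball x₀ (R / 2))
      (ha.mono ((ball_subset_ball (by linarith)).trans hRU))
      (fun z hz => norm_deriv_le_of_ball_subset (by positivity) ha hba (hball z hz)) hx hy
  · filter_upwards [hdiff] with a ha using (ha.differentiableAt (hU.mem_nhds hx₀)).hasDerivAt

end HolomorphicTools

section Koenigs

open Metric Set Topology

/-- The Koenigs function `lim λ⁻ⁿ Fⁿ(z)` of an attracting germ. -/
noncomputable def koenigs (lam : ℂ) (F : ℂ → ℂ) (z : ℂ) : ℂ :=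
  limUnder atTop fun n : ℕ => (lam ^ n)⁻¹ * F^[n] z

theorem exists_koenigs_bound {s K : ℝ} (hs0 : 0 < s) (hs1 : s < 1) (hK : 0 ≤ K) :
    ∃ r > 0, ∃ C ≥ 0, ∃ q < 1, 0 ≤ q ∧ ∀ (lam : ℂ) (F : ℂ → ℂ), ‖lam‖ = s →
      (∀ z ∈ ball (0 : ℂ) r, ‖F z - lam * z‖ ≤ K * ‖z‖ ^ 2) → ∀ z ∈ ball (0 : ℂ) r,
      (∀ n, ‖F^[n] z‖ ≤ ‖z‖) ∧
        ∀ n, ‖(lam ^ n)⁻¹ * F^[n] z - koenigs lam F z‖ ≤ C * q ^ n * ‖z‖ ^ 2 := by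
  obtain ⟨m, hm1, hm2, hms⟩ : ∃ m : ℝ, s < m ∧ m < 1 ∧ m ^ 2 < s := by
    have hs : s < √s := by
      rw [Real.lt_sqrt hs0.le]; nlinarith
    obtain ⟨m, h1, h2⟩ := exists_between hs
    refine ⟨m, h1, h2.trans_le (Real.sqrt_le_one.2 hs1.le), ?_⟩
    rwa [Real.lt_sqrt (hs0.trans h1).le] at h2
  have hm0 : 0 < m := hs0.trans hm1
  set q := m ^ 2 / s with hq
  have hq1 : q < 1 := (div_lt_one hs0).2 hms
  have hq0 : 0 ≤ q := by positivity
  refine ⟨(m - s) / (K + 1), div_pos (by linarith) (by linarith), K / s / (1 - q),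
    div_nonneg (by positivity) (by linarith), q, hq1, hq0, fun lam F hlam hF z hz => ?_⟩
  have hstep : ∀ x ∈ ball (0 : ℂ) ((m - s) / (K + 1)), ‖F x‖ ≤ m * ‖x‖ := fun x hx => by
    have h1 := hF x hx
    have h2 : ‖x‖ < (m - s) / (K + 1) := by simpa using hx
    rw [lt_div_iff₀ (by linarith)] at h2
    have h3 := norm_sub_norm_le (F x) (lam * x)
    rw [norm_mul, hlam] at h3
    nlinarith [norm_nonneg x]
  have horb : ∀ n, ‖F^[n] z‖ ≤ m ^ n * ‖z‖ ∧ F^[n] z ∈ ball (0 : ℂ) ((m - s) / (K + 1)) := by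
    intro n
    have hz' : ‖z‖ < (m - s) / (K + 1) := by simpa using hz
    have hmem : ∀ n, ‖F^[n] z‖ ≤ m ^ n * ‖z‖ → F^[n] z ∈ ball (0 : ℂ) ((m - s) / (K + 1)) :=
      fun n h => by
        have : m ^ n ≤ 1 := pow_le_one₀ hm0.le hm2.le
        simp only [mem_ball, dist_zero_right]
        nlinarith [norm_nonneg z]
    suffices h : ‖F^[n] z‖ ≤ m ^ n * ‖z‖ from ⟨h, hmem n h⟩
    induction n with
    | zero => simp
    | succ n ih =>
      rw [Function.iterate_succ_apply', pow_succ']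
      have := hstep _ (hmem n ih)
      nlinarith
  have hlam0 : lam ≠ 0 := by rw [← norm_pos_iff, hlam]; exact hs0
  have hd : ∀ n, dist ((lam ^ n)⁻¹ * F^[n] z) ((lam ^ (n + 1))⁻¹ * F^[n + 1] z) ≤
      (K / s * ‖z‖ ^ 2) * q ^ n := by
    intro n
    have e : (lam ^ (n + 1))⁻¹ * F^[n + 1] z - (lam ^ n)⁻¹ * F^[n] z =
        (lam ^ (n + 1))⁻¹ * (F (F^[n] z) - lam * F^[n] z) := by
      rw [Function.iterate_succ_apply', pow_succ]
      field_simp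
    rw [dist_comm, dist_eq_norm, e, norm_mul, norm_inv, norm_pow, hlam]
    have h1 := hF _ (horb n).2
    have h2 : ‖F^[n] z‖ ^ 2 ≤ (m ^ n * ‖z‖) ^ 2 := by gcongr; exact (horb n).1
    calc (s ^ (n + 1))⁻¹ * ‖F (F^[n] z) - lam * F^[n] z‖
        ≤ (s ^ (n + 1))⁻¹ * (K * (m ^ n * ‖z‖) ^ 2) := by gcongr; exact h1.trans (by gcongr)
      _ = _ := by
        rw [hq, div_pow, pow_succ]
        field_simp
        ring
  obtain ⟨w, hw⟩ := cauchySeq_tendsto_of_complete (cauchySeq_of_le_geometric q _ hq1 hd)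
  have hk : koenigs lam F z = w := hw.limUnder_eq
  refine ⟨fun n => (horb n).1.trans ?_, fun n => ?_⟩
  · exact mul_le_of_le_one_left (norm_nonneg _) (pow_le_one₀ hm0.le hm2.le)
  · have := dist_le_of_le_geometric_of_tendsto q _ hq1 hd hw n
    rw [hk, ← dist_eq_norm]
    refine this.trans (le_of_eq ?_)
    ring

theorem differentiableOn_koenigs {lam : ℂ} {F : ℂ → ℂ → ℂ} {x : ℂ → ℂ} {V : Set ℂ} (hV : IsOpen V)
    {r C q : ℝ} (hq : q < 1) (hq0 : 0 ≤ q) (hC : 0 ≤ C)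
    (hx : DifferentiableOn ℂ x V) (hxr : MapsTo x V (ball 0 r))
    (hcomp : ∀ y : ℂ → ℂ, DifferentiableOn ℂ y V → MapsTo y V (ball 0 r) →
      DifferentiableOn ℂ (fun t => F t (y t)) V)
    (hF : ∀ t ∈ V, ∀ z ∈ ball (0 : ℂ) r, (∀ n, ‖(F t)^[n] z‖ ≤ ‖z‖) ∧
        ∀ n, ‖(lam ^ n)⁻¹ * (F t)^[n] z - koenigs lam (F t) z‖ ≤ C * q ^ n * ‖z‖ ^ 2) :
    DifferentiableOn ℂ (fun t => koenigs lam (F t) (x t)) V := by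
  have hit : ∀ n, DifferentiableOn ℂ (fun t => (F t)^[n] (x t)) V := by
    intro n
    induction n with
    | zero => simpa using hx
    | succ n ih =>
      simp only [Function.iterate_succ_apply']
      refine hcomp _ ih fun t ht => ?_
      have h1 := (hF t ht _ (hxr ht)).1 n
      have h2 := hxr ht
      simp only [mem_ball, dist_zero_right] at h2 ⊢
      exact h1.trans_lt h2
  have hlim : TendstoUniformlyOn (fun n t => (lam ^ n)⁻¹ * (F t)^[n] (x t))
      (fun t => koenigs lam (F t) (x t)) atTop V := by
    rw [Metric.tendstoUniformlyOn_iff]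
    intro e he
    have h0 : Tendsto (fun n : ℕ => C * q ^ n * r ^ 2) atTop (𝓝 0) := by
      simpa using ((tendsto_pow_atTop_nhds_zero_of_lt_one hq0 hq).const_mul C).mul_const (r ^ 2)
    filter_upwards [h0.eventually (gt_mem_nhds he)] with n hn t ht
    rw [dist_comm, dist_eq_norm]
    have h2 : ‖x t‖ < r := by simpa using hxr ht
    refine ((hF t ht _ (hxr ht)).2 n).trans_lt (lt_of_le_of_lt ?_ hn)
    gcongr
  exact hlim.tendstoLocallyUniformlyOn.differentiableOn
    (Eventually.of_forall fun n => (hit n).const_mul _) hV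

/-- `ψ` linearises `F` on the disc of radius `r`, with values in the disc of radius `b`. -/
structure Linearizes (F : ℂ → ℂ) (lam : ℂ) (r b : ℝ) (ψ : ℂ → ℂ) : Prop where
  pos : 0 < r
  diff : DifferentiableOn ℂ ψ (ball 0 r)
  zero : ψ 0 = 0
  deriv_zero : deriv ψ 0 = 1
  mem : ∀ w ∈ ball (0 : ℂ) r, ψ w ∈ ball (0 : ℂ) b
  eq : ∀ w ∈ ball (0 : ℂ) r, F (ψ w) = ψ (lam * w)

theorem mul_mem_ball {lam w : ℂ} {r : ℝ} (h : ‖lam‖ ≤ 1) (hw : w ∈ ball (0 : ℂ) r) :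
    lam * w ∈ ball (0 : ℂ) r := by
  simp only [mem_ball, dist_zero_right, norm_mul] at hw ⊢
  exact (mul_le_of_le_one_left (norm_nonneg _) h).trans_lt hw

namespace Linearizes

variable {F : ℂ → ℂ} {lam : ℂ} {r b : ℝ} {ψ : ℂ → ℂ}

theorem iterate (h : Linearizes F lam r b ψ) (hl : ‖lam‖ ≤ 1) (n : ℕ) :
    ∀ w ∈ ball (0 : ℂ) r, F^[n] (ψ w) = ψ (lam ^ n * w) := by
  induction n with
  | zero => simp
  | succ n ih =>
    intro w hw
    rw [Function.iterate_succ_apply', ih w hw, h.eq _ (mul_mem_ball (by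
      rw [norm_pow]; exact pow_le_one₀ (norm_nonneg _) hl) hw), pow_succ', mul_assoc]

theorem tendsto (h : Linearizes F lam r b ψ) (hl0 : lam ≠ 0) (hl : ‖lam‖ < 1) {w : ℂ}
    (hw : w ∈ ball (0 : ℂ) r) :
    Tendsto (fun n : ℕ => (lam ^ n)⁻¹ * F^[n] (ψ w)) atTop (𝓝 w) := by
  simp only [h.iterate hl.le _ w hw]
  rcases eq_or_ne w 0 with rfl | hw0
  · simp [h.zero]
  have hd : HasDerivAt ψ 1 0 := by
    have := (h.diff.differentiableAt (ball_mem_nhds _ h.pos)).hasDerivAt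
    rwa [h.deriv_zero] at this
  have h1 := hasDerivAt_iff_tendsto_slope_zero.1 hd
  have h2 : Tendsto (fun n : ℕ => lam ^ n * w) atTop (𝓝[≠] 0) := by
    refine tendsto_nhdsWithin_iff.2 ⟨?_, Eventually.of_forall fun n => ?_⟩
    · simpa using (tendsto_pow_atTop_nhds_zero_of_norm_lt_one hl).mul_const w
    · exact mul_ne_zero (pow_ne_zero _ hl0) hw0
  have h3 := (h1.comp h2).const_mul w
  simp only [Function.comp_def, zero_add, h.zero, sub_zero, smul_eq_mul, mul_one] at h3
  refine h3.congr fun n => ?_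
  have := pow_ne_zero n hl0
  field_simp

theorem inj (h : Linearizes F lam r b ψ) (hl0 : lam ≠ 0) (hl : ‖lam‖ < 1) :
    InjOn ψ (ball 0 r) := fun w hw x hx hwx => by
  have h1 := h.tendsto hl0 hl hw
  rw [hwx] at h1
  exact tendsto_nhds_unique h1 (h.tendsto hl0 hl hx)

theorem iterate_ne_zero (h : Linearizes F lam r b ψ) (hl0 : lam ≠ 0) (hl : ‖lam‖ < 1) {w : ℂ}
    (hw : w ∈ ball (0 : ℂ) r) (hw0 : ψ w ≠ 0) (n : ℕ) : F^[n] (ψ w) ≠ 0 := by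
  rw [h.iterate hl.le n w hw, ← h.zero]
  intro h0
  have := h.inj hl0 hl (mul_mem_ball (by
      rw [norm_pow]; exact pow_le_one₀ (norm_nonneg _) hl.le) hw) (mem_ball_self h.pos) h0
  rcases mul_eq_zero.1 this with h1 | h1
  · exact pow_ne_zero n hl0 h1
  · exact hw0 (by rw [h1, h.zero])

theorem norm_le (h : Linearizes F lam r b ψ) {w : ℂ} (hw : w ∈ ball (0 : ℂ) r) :
    ‖ψ w‖ ≤ b / r * ‖w‖ := by
  have := Complex.dist_le_div_mul_dist_of_mapsTo_ball (R₂ := b) h.diff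
    (fun w hw => by rw [h.zero]; exact ball_subset_closedBall (h.mem w hw)) hw
  simpa [h.zero] using this

theorem radius_le (h : Linearizes F lam r b ψ) : r ≤ b := by
  have := Complex.norm_deriv_le_div_of_mapsTo_ball (R₂ := b) h.diff
    (fun w hw => by rw [h.zero]; exact ball_subset_closedBall (h.mem w hw)) h.pos
  rw [h.deriv_zero, norm_one, le_div_iff₀ h.pos] at this
  linarith

theorem norm_iterate_le (h : Linearizes F lam r b ψ) (hl0 : lam ≠ 0) (hl : ‖lam‖ ≤ 1) {w : ℂ}
    (hw : w ∈ ball (0 : ℂ) r) (n : ℕ) : ‖(lam ^ n)⁻¹ * F^[n] (ψ w)‖ ≤ b := by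
  have hm := mul_mem_ball (lam := lam ^ n) (by
      rw [norm_pow]; exact pow_le_one₀ (norm_nonneg _) hl) hw
  rw [h.iterate hl n w hw, norm_mul, norm_inv]
  have h1 := h.norm_le hm
  rw [norm_mul] at h1
  have hp : 0 < ‖lam ^ n‖ := norm_pos_iff.2 (pow_ne_zero n hl0)
  have hw' : ‖w‖ < r := by simpa using hw
  have hb : 0 ≤ b := h.pos.le.trans h.radius_le
  have hr := h.pos
  calc ‖lam ^ n‖⁻¹ * ‖ψ (lam ^ n * w)‖ ≤ ‖lam ^ n‖⁻¹ * (b / r * (‖lam ^ n‖ * ‖w‖)) := by gcongr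
    _ = b * (‖w‖ / r) := by field_simp
    _ ≤ b * 1 := by gcongr; rw [div_le_one hr]; exact hw'.le
    _ = b := mul_one b

end Linearizes

theorem exists_linearizes {F : ℂ → ℂ} {lam : ℂ} {b K : ℝ} (hb : 0 < b) (hK : 0 ≤ K) (hl0 : lam ≠ 0)
    (hl : ‖lam‖ < 1) (hF : DifferentiableOn ℂ F (ball 0 b))
    (hFK : ∀ z ∈ ball (0 : ℂ) b, ‖F z - lam * z‖ ≤ K * ‖z‖ ^ 2) :
    ∃ r ψ, Linearizes F lam r b ψ := by
  classical
  obtain ⟨r₀, hr₀, C, hC, q, hq1, hq0, H⟩ := exists_koenigs_bound (norm_pos_iff.2 hl0) hl hK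
  set r₁ := min r₀ b with hr₁
  have hr₁0 : 0 < r₁ := lt_min hr₀ hb
  set F' : ℂ → ℂ := fun z => if z ∈ ball (0 : ℂ) b then F z else lam * z with hF'
  have hF'K : ∀ z, ‖F' z - lam * z‖ ≤ K * ‖z‖ ^ 2 := fun z => by
    by_cases hz : z ∈ ball (0 : ℂ) b
    · simp only [hF', hz, if_true]; exact hFK z hz
    · simp only [hF', hz, if_false, sub_self, norm_zero]; positivity
  have H' := H lam F' rfl (fun z _ => hF'K z)
  have hsub0 : ball (0 : ℂ) r₁ ⊆ ball 0 r₀ := ball_subset_ball (min_le_left _ _)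
  have hsubb : ball (0 : ℂ) r₁ ⊆ ball 0 b := ball_subset_ball (min_le_right _ _)
  set φ := koenigs lam F' with hφ
  have hφd : DifferentiableOn ℂ φ (ball 0 r₁) := by
    refine differentiableOn_koenigs (F := fun _ => F') (x := id) (r := r₁) isOpen_ball hq1 hq0 hC
      differentiableOn_id (fun _ h => h) (fun y hy hyr => ?_) fun t _ z hz => H' z (hsub0 hz)
    refine (hF.comp hy fun t ht => hsubb (hyr ht)).congr fun t ht => ?_
    simp only [hF', hsubb (hyr ht), if_true, Function.comp_apply]
  have hφ2 : ∀ z ∈ ball (0 : ℂ) r₁, ‖φ z - z‖ ≤ C * ‖z‖ ^ 2 := fun z hz => by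
    have := (H' z (hsub0 hz)).2 0
    rw [norm_sub_rev] at this
    simpa using this
  have hφlim : ∀ z ∈ ball (0 : ℂ) r₁,
      Tendsto (fun n : ℕ => (lam ^ n)⁻¹ * F'^[n] z) atTop (𝓝 (φ z)) := fun z hz => by
    rw [tendsto_iff_norm_sub_tendsto_zero]
    refine squeeze_zero (fun _ => norm_nonneg _) (fun n => (H' z (hsub0 hz)).2 n) ?_
    simpa using ((tendsto_pow_atTop_nhds_zero_of_lt_one hq0 hq1).const_mul C).mul_const (‖z‖ ^ 2)
  have hnorm : ∀ z ∈ ball (0 : ℂ) r₁, ‖F' z‖ ≤ ‖z‖ := fun z hz => by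
    simpa using (H' z (hsub0 hz)).1 1
  have hφF : ∀ z ∈ ball (0 : ℂ) r₁, φ (F' z) = lam * φ z := fun z hz => by
    have hm : F' z ∈ ball (0 : ℂ) r₁ := by
      have h1 := hnorm z hz
      simp only [mem_ball, dist_zero_right] at hz ⊢; linarith
    have h1 := ((hφlim z hz).comp (tendsto_add_atTop_nat 1)).const_mul lam
    refine tendsto_nhds_unique (hφlim _ hm) (h1.congr fun n => ?_)
    simp only [Function.comp_apply, Function.iterate_succ_apply, pow_succ]
    field_simp
  set δ := min (r₁ / 2) (1 / (8 * (C + 1))) with hδ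
  have hδ0 : 0 < δ := lt_min (by positivity) (by positivity)
  have hδC : 4 * C * δ ≤ 1 / 2 := by
    have : δ ≤ 1 / (8 * (C + 1)) := min_le_right _ _
    rw [le_div_iff₀ (by positivity)] at this
    nlinarith
  have hδr : δ ≤ r₁ / 2 := min_le_left _ _
  have hsubδ : ball (0 : ℂ) δ ⊆ ball 0 r₁ := ball_subset_ball (by linarith)
  have hhd : DifferentiableOn ℂ (fun z => φ z - z) (ball 0 r₁) := hφd.sub differentiableOn_id
  have hlip : ∀ x ∈ ball (0 : ℂ) δ, ∀ y ∈ ball (0 : ℂ) δ,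
      ‖(φ x - x) - (φ y - y)‖ ≤ 1 / 2 * ‖x - y‖ := fun x hx y hy =>
    (lipschitz_of_quad hC hhd hφ2 hδr hx hy).trans (by gcongr)
  obtain ⟨u, hud, hu⟩ := exists_inverse_near_id (h := fun z => φ z - z) (c := 0) (a := δ / 2)
    (b := δ) (ε := δ / 2) (by positivity) (hhd.mono hsubδ) hlip (fun x hx => by
      refine (hφ2 x (hsubδ hx)).trans ?_
      have : ‖x‖ < δ := by simpa using hx
      have : ‖x‖ ^ 2 ≤ δ ^ 2 := by gcongr
      nlinarith) (by linarith)
  have hinj : ∀ x ∈ ball (0 : ℂ) δ, ∀ y ∈ ball (0 : ℂ) δ, φ x = φ y → x = y := by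
    intro x hx y hy hxy
    have := hlip x hx y hy
    rw [hxy, sub_sub_sub_cancel_left, norm_sub_rev] at this
    have h0 : ‖x - y‖ ≤ 0 := by linarith
    exact sub_eq_zero.1 (norm_le_zero_iff.1 h0)
  have hφu : ∀ y ∈ ball (0 : ℂ) (δ / 2), φ (u y) = y := fun y hy => by
    linear_combination (hu y hy).2
  have m0 : (0 : ℂ) ∈ ball (0 : ℂ) (δ / 2) := mem_ball_self (by positivity)
  have hφ0 : φ 0 = 0 := by simpa using hφ2 0 (mem_ball_self hr₁0)
  have hu0 : u 0 = 0 := hinj _ (hu 0 m0).1 _ (mem_ball_self hδ0) (by rw [hφu 0 m0, hφ0])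
  refine ⟨δ / 2, u, by positivity, hud, hu0, ?_, fun w hw => ?_, fun w hw => ?_⟩
  · have hd0 : deriv (fun z => φ z - z) 0 = 0 := by
      simpa using deriv_le_of_quad hhd hφ2 (z := 0) (by simpa using hr₁0)
    have hφ' : HasDerivAt φ 1 0 := by
      have h1 := ((hhd.differentiableAt (ball_mem_nhds _ hr₁0)).hasDerivAt).add (hasDerivAt_id 0)
      rw [hd0, zero_add] at h1
      refine h1.congr_of_eventuallyEq (Eventually.of_forall fun z => by simp)
    have hu' := (hud.differentiableAt (ball_mem_nhds _ (by positivity : 0 < δ / 2))).hasDerivAt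
    have h2 : HasDerivAt (φ ∘ u) (1 * deriv u 0) 0 :=
      HasDerivAt.comp (h₂ := φ) 0 (by rw [hu0]; exact hφ') hu'
    have h3 : HasDerivAt (φ ∘ u) 1 0 :=
      (hasDerivAt_id 0).congr_of_eventuallyEq (by
        filter_upwards [ball_mem_nhds (0 : ℂ) (by positivity : 0 < δ / 2)] with y hy using hφu y hy)
    have := h2.unique h3
    simpa using this
  · exact hsubb (hsubδ (hu w hw).1)
  · have h1 := (hu w hw).1
    have e : F (u w) = F' (u w) := by simp only [hF', hsubb (hsubδ h1), if_true]
    have hlw := mul_mem_ball hl.le hw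
    rw [e]
    refine hinj _ ?_ _ (hu _ hlw).1 ?_
    · have h2 := hnorm _ (hsubδ h1)
      simp only [mem_ball, dist_zero_right] at h1 ⊢; linarith
    · rw [hφF _ (hsubδ h1), hφu w hw, hφu _ hlw]

end Koenigs

section Critical

open Metric Set Topology

/-- A small perturbation `O(z²)` on the disc of radius six. -/
structure UnitPert (k : ℂ → ℂ) : Prop where
  diff : DifferentiableOn ℂ k (ball 0 6)
  quad : ∀ z ∈ ball (0 : ℂ) 6, ‖k z‖ ≤ 1 / 24 * ‖z‖ ^ 2

/-- The map `s (Y + Y²)` with `Y(z) = λ₀ z + k(z)`. -/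
noncomputable def quadMap (s : ℝ) (lam₀ : ℂ) (k : ℂ → ℂ) (z : ℂ) : ℂ :=
  s * ((lam₀ * z + k z) + (lam₀ * z + k z) ^ 2)

namespace UnitPert

variable {k : ℂ → ℂ} {lam₀ : ℂ} {s : ℝ}

theorem lip (hk : UnitPert k) {x y : ℂ} (hx : x ∈ ball (0 : ℂ) 3) (hy : y ∈ ball (0 : ℂ) 3) :
    ‖k x - k y‖ ≤ 1 / 2 * ‖x - y‖ := by
  refine (lipschitz_of_quad (by norm_num) hk.diff hk.quad (by norm_num) hx hy).trans (le_of_eq ?_)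
  norm_num

theorem le_half (hk : UnitPert k) {x : ℂ} (hx : x ∈ ball (0 : ℂ) 3) : ‖k x‖ ≤ 1 / 2 := by
  have h := hk.quad x (ball_subset_ball (by norm_num) hx)
  have h3 : ‖x‖ < 3 := by simpa using hx
  nlinarith [norm_nonneg x]

theorem zero (hk : UnitPert k) : k 0 = 0 := by
  simpa using hk.quad 0 (by simp)

theorem diff_quadMap (hk : UnitPert k) : DifferentiableOn ℂ (quadMap s lam₀ k) (ball 0 6) := by
  have h : DifferentiableOn ℂ (fun z => lam₀ * z + k z) (ball 0 6) :=
    (differentiableOn_id.const_mul lam₀).add hk.diff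
  exact (h.add (h.pow 2)).const_mul _

theorem quadMap_sub_le (hk : UnitPert k) (h0 : ‖lam₀‖ = 1) (hs0 : 0 ≤ s) (hs1 : s ≤ 1)
    {z : ℂ} (hz : z ∈ ball (0 : ℂ) 3) :
    ‖quadMap s lam₀ k z - s * lam₀ * z‖ ≤ 4 * ‖z‖ ^ 2 := by
  have h := hk.quad z (ball_subset_ball (by norm_num) hz)
  have h3 : ‖z‖ < 3 := by simpa using hz
  have e : quadMap s lam₀ k z - s * lam₀ * z = s * (k z + (lam₀ * z + k z) ^ 2) := by
    rw [quadMap]; ring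
  have h1 : ‖lam₀ * z + k z‖ ≤ 3 / 2 * ‖z‖ := by
    refine (norm_add_le _ _).trans ?_
    rw [norm_mul, h0]
    nlinarith [norm_nonneg z]
  have h2 : ‖lam₀ * z + k z‖ ^ 2 ≤ (3 / 2 * ‖z‖) ^ 2 := by gcongr
  have h4 := norm_add_le (k z) ((lam₀ * z + k z) ^ 2)
  rw [norm_pow] at h4
  rw [e, norm_mul, Complex.norm_real, Real.norm_eq_abs, abs_of_nonneg hs0]
  have h5 : ‖k z + (lam₀ * z + k z) ^ 2‖ ≤ 4 * ‖z‖ ^ 2 := by nlinarith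
  exact (mul_le_of_le_one_left (norm_nonneg _) hs1).trans h5

theorem exists_sqrt_branch {D : ℂ → ℂ} {r : ℝ} (hr : 0 < r) (hD : DifferentiableOn ℂ D (ball 0 r))
    (h0 : ∀ z ∈ ball (0 : ℂ) r, D z ≠ 0) (c : ℂ) (hc : D 0 = c ^ 2) :
    ∃ S : ℂ → ℂ, DifferentiableOn ℂ S (ball 0 r) ∧ (∀ z ∈ ball (0 : ℂ) r, S z ^ 2 = D z) ∧
      S 0 = c := by
  obtain ⟨l, hl, hlD⟩ := exists_log_on_ball hr hD h0
  have hsq : ∀ z ∈ ball (0 : ℂ) r, Complex.exp (l z / 2) ^ 2 = D z := fun z hz => by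
    rw [← hlD z hz, ← Complex.exp_nat_mul]; congr 1; push_cast; ring
  have hd : DifferentiableOn ℂ (fun z => Complex.exp (l z / 2)) (ball 0 r) :=
    (hl.div_const 2).cexp
  have hm := hsq 0 (mem_ball_self hr)
  rw [hc] at hm
  rcases sq_eq_sq_iff_eq_or_eq_neg.1 hm with h | h
  · exact ⟨_, hd, hsq, h⟩
  · refine ⟨_, hd.neg, fun z hz => ?_, ?_⟩
    · rw [Pi.neg_apply, neg_sq, hsq z hz]
    · rw [Pi.neg_apply, h, neg_neg]

theorem extend (hk : UnitPert k) (h0 : ‖lam₀‖ = 1) (hs : 9 / 10 ≤ s) (hs1 : s < 1) {r : ℝ}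
    {ψ : ℂ → ℂ} (h : Linearizes (quadMap s lam₀ k) (s * lam₀) r 3 ψ)
    (hv : ∀ w ∈ ball (0 : ℂ) r, ψ w ≠ -s / 4) :
    ∃ ψ', Linearizes (quadMap s lam₀ k) (s * lam₀) (r / s) 3 ψ' := by
  have hs0 : 0 < s := by linarith
  have hr := h.pos
  have hsc : (s : ℂ) ≠ 0 := by exact_mod_cast hs0.ne'
  have hl0 : lam₀ ≠ 0 := by rw [← norm_pos_iff, h0]; norm_num
  have hnl : ‖(s : ℂ) * lam₀‖ = s := by simp [h0, abs_of_pos hs0]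
  have hmul : ∀ w ∈ ball (0 : ℂ) (r / s), s * lam₀ * w ∈ ball (0 : ℂ) r := fun w hw => by
    simp only [mem_ball, dist_zero_right] at hw ⊢
    rw [norm_mul, hnl]
    rw [lt_div_iff₀ hs0] at hw
    linarith
  have hsub : ball (0 : ℂ) r ⊆ ball 0 (r / s) := ball_subset_ball (by
    rw [le_div_iff₀ hs0]; nlinarith)
  set D : ℂ → ℂ := fun w => ψ (s * lam₀ * w) / s + 1 / 4 with hDdef
  have hD : DifferentiableOn ℂ D (ball 0 (r / s)) :=
    ((h.diff.comp (differentiableOn_id.const_mul _) hmul).div_const _).add_const _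
  have hDne : ∀ w ∈ ball (0 : ℂ) (r / s), D w ≠ 0 := fun w hw h1 => by
    refine hv _ (hmul w hw) ?_
    have h2 : ψ (s * lam₀ * w) / s = -1 / 4 := by linear_combination h1
    rw [div_eq_iff hsc] at h2
    rw [h2]; ring
  have hD0 : D 0 = (1 / 2 : ℂ) ^ 2 := by simp [hDdef, h.zero]; norm_num
  obtain ⟨S, hS, hSD, hS0⟩ := exists_sqrt_branch (div_pos hr hs0) hD hDne _ hD0
  have hSle : ∀ w ∈ ball (0 : ℂ) (r / s), ‖S w‖ ≤ 19 / 10 := fun w hw => by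
    have h1 : ‖S w‖ ^ 2 ≤ 3 / s + 1 / 4 := by
      rw [← norm_pow, hSD w hw]
      refine (norm_add_le _ _).trans ?_
      have h2 : ‖ψ (s * lam₀ * w)‖ < 3 := by simpa using h.mem _ (hmul w hw)
      rw [norm_div, Complex.norm_real, Real.norm_eq_abs, abs_of_pos hs0]
      have h3 : ‖(1 / 4 : ℂ)‖ = 1 / 4 := by norm_num
      rw [h3]
      gcongr
    have h2 : 3 / s ≤ 10 / 3 := by rw [div_le_iff₀ hs0]; linarith
    by_contra! h3
    nlinarith
  have hlinv : ‖lam₀⁻¹‖ = 1 := by rw [norm_inv, h0, inv_one]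
  have hlip : ∀ x ∈ ball (0 : ℂ) 3, ∀ y ∈ ball (0 : ℂ) 3,
      ‖lam₀⁻¹ * k x - lam₀⁻¹ * k y‖ ≤ 1 / 2 * ‖x - y‖ := fun x hx y hy => by
    rw [← mul_sub, norm_mul, hlinv, one_mul]; exact hk.lip hx hy
  obtain ⟨u, hud, hu⟩ := exists_inverse_near_id (h := fun z => lam₀⁻¹ * k z) (c := 0) (a := 5 / 2)
    (b := 3) (ε := 1 / 2) (by norm_num)
    ((hk.diff.mono (ball_subset_ball (by norm_num))).const_mul _) hlip
    (fun x hx => by rw [norm_mul, hlinv, one_mul]; exact hk.le_half hx) (by norm_num)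
  have hT : ∀ w ∈ ball (0 : ℂ) (r / s), lam₀⁻¹ * (S w - 1 / 2) ∈ ball (0 : ℂ) (5 / 2) :=
    fun w hw => by
    simp only [mem_ball, dist_zero_right, norm_mul, hlinv, one_mul]
    refine (norm_sub_le _ _).trans_lt ?_
    have h3 : ‖(1 / 2 : ℂ)‖ = 1 / 2 := by norm_num
    rw [h3]; linarith [hSle w hw]
  set ψ' : ℂ → ℂ := fun w => u (lam₀⁻¹ * (S w - 1 / 2)) with hψ'
  have hψ'd : DifferentiableOn ℂ ψ' (ball 0 (r / s)) :=
    hud.comp ((hS.sub_const _).const_mul _) hT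
  have hψ'm : ∀ w ∈ ball (0 : ℂ) (r / s), ψ' w ∈ ball (0 : ℂ) 3 := fun w hw => (hu _ (hT w hw)).1
  have hYψ' : ∀ w ∈ ball (0 : ℂ) (r / s), lam₀ * ψ' w + k (ψ' w) = S w - 1 / 2 := fun w hw => by
    have h1 := (hu _ (hT w hw)).2
    have h2 : lam₀ * (ψ' w + lam₀⁻¹ * k (ψ' w)) = lam₀ * (lam₀⁻¹ * (S w - 1 / 2)) := by rw [h1]
    rwa [mul_add, ← mul_assoc, ← mul_assoc, mul_inv_cancel₀ hl0, one_mul, one_mul] at h2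
  have hF : ∀ w ∈ ball (0 : ℂ) (r / s), quadMap s lam₀ k (ψ' w) = ψ (s * lam₀ * w) :=
    fun w hw => by
    have h1 : ψ (s * lam₀ * w) / s = S w ^ 2 - 1 / 4 := by rw [hSD w hw]; ring
    rw [div_eq_iff hsc] at h1
    rw [quadMap, hYψ' w hw, h1]; ring
  have hagree : EqOn ψ ψ' (ball 0 r) := by
    have hsq : EqOn ((fun w => (lam₀ * ψ w + k (ψ w)) + 1 / 2) ^ 2) (S ^ 2) (ball 0 r) :=
      fun w hw => by
      have h1 := h.eq w hw
      rw [quadMap] at h1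
      have h2 : ψ (s * lam₀ * w) / s = S w ^ 2 - 1 / 4 := by rw [hSD w (hsub hw)]; ring
      rw [div_eq_iff hsc] at h2
      rw [h2] at h1
      have h3 := mul_left_cancel₀ hsc (h1.trans (mul_comm _ _))
      simp only [Pi.pow_apply]
      linear_combination h3
    have hm3 : MapsTo ψ (ball 0 r) (ball 0 6) := fun w hw =>
      ball_subset_ball (by norm_num) (h.mem w hw)
    have heq : EqOn (fun w => (lam₀ * ψ w + k (ψ w)) + 1 / 2) S (ball 0 r) := by
      refine (convex_ball (0 : ℂ) r).isPreconnected.eq_of_sq_eq ?_ (hS.mono hsub).continuousOn hsq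
        (fun {w} hw => ?_) (mem_ball_self hr) ?_
      · exact (((h.diff.const_mul _).add (hk.diff.comp h.diff hm3)).add_const _).continuousOn
      · intro h1
        apply hDne w (hsub hw)
        rw [← hSD w (hsub hw), h1]; ring
      · simp [h.zero, hk.zero, hS0]
    intro w hw
    have h1 : lam₀ * ψ w + k (ψ w) = lam₀ * ψ' w + k (ψ' w) := by
      rw [hYψ' w (hsub hw), ← heq hw]; ring
    have h2 := hlip _ (h.mem w hw) _ (hψ'm w (hsub hw))
    have h3 : lam₀⁻¹ * k (ψ w) - lam₀⁻¹ * k (ψ' w) = ψ' w - ψ w := by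
      field_simp
      linear_combination h1
    rw [h3, norm_sub_rev] at h2
    exact sub_eq_zero.1 (norm_le_zero_iff.1 (by linarith))
  refine ⟨ψ', div_pos hr hs0, hψ'd, ?_, ?_, hψ'm, fun w hw => ?_⟩
  · rw [← hagree (mem_ball_self hr), h.zero]
  · rw [← h.deriv_zero]
    refine (EventuallyEq.deriv_eq ?_).symm
    filter_upwards [ball_mem_nhds (0 : ℂ) hr] with w hw using hagree hw
  · rw [hF w hw, hagree (hmul w hw)]

theorem exists_linearizes_critical (hk : UnitPert k) (h0 : ‖lam₀‖ = 1) (hs : 9 / 10 ≤ s)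
    (hs1 : s < 1) : ∃ r ψ w, Linearizes (quadMap s lam₀ k) (s * lam₀) r 3 ψ ∧
      w ∈ ball (0 : ℂ) r ∧ ψ w = -s / 4 := by
  by_contra! hno
  have hs0 : 0 < s := by linarith
  have hnl : ‖(s : ℂ) * lam₀‖ = s := by simp [h0, abs_of_pos hs0]
  have hl0 : (s : ℂ) * lam₀ ≠ 0 := by rw [← norm_pos_iff, hnl]; exact hs0
  obtain ⟨r, ψ, h⟩ := exists_linearizes (F := quadMap s lam₀ k) (lam := s * lam₀) (b := 3) (K := 4)
    (by norm_num) (by norm_num) hl0 (by rw [hnl]; exact hs1)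
    (hk.diff_quadMap.mono (ball_subset_ball (by norm_num)))
    (fun z hz => hk.quadMap_sub_le h0 hs0.le hs1.le hz)
  have hall : ∀ n : ℕ, ∃ ψ', Linearizes (quadMap s lam₀ k) (s * lam₀) (r / s ^ n) 3 ψ' := by
    intro n
    induction n with
    | zero => exact ⟨ψ, by simpa using h⟩
    | succ n ih =>
      obtain ⟨ψ', h'⟩ := ih
      rw [pow_succ, ← div_div]
      exact hk.extend h0 hs hs1 h' fun w hw => hno _ _ w h' hw
  obtain ⟨n, hn⟩ := exists_pow_lt_of_lt_one (div_pos h.pos (by norm_num : (0:ℝ) < 3)) hs1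
  obtain ⟨ψ', h'⟩ := hall n
  have h1 := h'.radius_le
  rw [div_le_iff₀ (by positivity)] at h1
  rw [lt_div_iff₀ (by norm_num)] at hn
  linarith

theorem norm_cube_le (hk : DifferentiableOn ℂ k (ball 0 6))
    (hk2 : ∀ z ∈ ball (0 : ℂ) 6, ‖k z‖ ≤ 1 / 48 * ‖z‖ ^ 2) (h0 : ‖lam₀‖ = 1) (hs : 9 / 10 ≤ s)
    (hs1 : s < 1) {r₀ r₁ : ℝ} {ψ₀ ψ₁ : ℂ → ℂ} {w₀ w₁ : ℂ}
    (h : Linearizes (quadMap s lam₀ 0) (s * lam₀) r₀ 3 ψ₀) (hw₀ : w₀ ∈ ball (0 : ℂ) r₀)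
    (hψ₀ : ψ₀ w₀ = -s / 4) (h1 : Linearizes (quadMap s lam₀ k) (s * lam₀) r₁ 3 ψ₁)
    (hw₁ : w₁ ∈ ball (0 : ℂ) r₁) (hψ₁ : ψ₁ w₁ = -s / 4) :
    3 * (‖w₀‖ / 3) ^ 3 ≤ ‖w₁‖ := by
  have hs0 : 0 < s := by linarith
  have hsc : (s : ℂ) ≠ 0 := by exact_mod_cast hs0.ne'
  have hnl : ‖(s : ℂ) * lam₀‖ = s := by simp [h0, abs_of_pos hs0]
  have hl0 : (s : ℂ) * lam₀ ≠ 0 := by rw [← norm_pos_iff, hnl]; exact hs0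
  have hl1 : ‖(s : ℂ) * lam₀‖ < 1 := by rw [hnl]; exact hs1
  have hv : (-s / 4 : ℂ) ≠ 0 := by simpa using hsc
  have hpert : ∀ η ∈ ball (0 : ℂ) 2, UnitPert (fun z => η * k z) := fun η hη =>
    ⟨hk.const_mul η, fun z hz => by
      have h2 : ‖η‖ < 2 := by simpa using hη
      rw [norm_mul]
      calc ‖η‖ * ‖k z‖ ≤ 2 * (1 / 48 * ‖z‖ ^ 2) := by gcongr; exact hk2 z hz
        _ = _ := by ring⟩
  set lam := (s : ℂ) * lam₀
  set a : ℕ → ℂ → ℂ := fun n η => (lam ^ n)⁻¹ * (quadMap s lam₀ (fun z => η * k z))^[n] (-s / 4)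
    with ha
  have hmem : ∀ η ∈ ball (0 : ℂ) 2, ∀ n,
      (quadMap s lam₀ (fun z => η * k z))^[n] (-s / 4) ∈ ball (0 : ℂ) 3 ∧
      (quadMap s lam₀ (fun z => η * k z))^[n] (-s / 4) ≠ 0 ∧ ‖a n η‖ ≤ 3 := by
    intro η hη n
    obtain ⟨r, ψ, w, hL, hw, hψ⟩ := (hpert η hη).exists_linearizes_critical h0 hs hs1
    rw [ha]
    simp only
    rw [← hψ]
    refine ⟨?_, hL.iterate_ne_zero hl0 hl1 hw (by rw [hψ]; exact hv) n,
      hL.norm_iterate_le hl0 hl1.le hw n⟩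
    rw [hL.iterate hl1.le n w hw]
    exact hL.mem _ (mul_mem_ball (by rw [norm_pow]; exact pow_le_one₀ (norm_nonneg _) hl1.le) hw)
  have had : ∀ n, DifferentiableOn ℂ (a n) (ball 0 2) := by
    intro n
    refine DifferentiableOn.const_mul ?_ _
    induction n with
    | zero => simp
    | succ n ih =>
      simp only [Function.iterate_succ_apply']
      have hkc : DifferentiableOn ℂ
          (fun η => η * k ((quadMap s lam₀ (fun z => η * k z))^[n] (-s / 4))) (ball 0 2) :=
        differentiableOn_id.mul (hk.comp ih fun η hη =>
          ball_subset_ball (by norm_num) (hmem η hη n).1)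
      have hY := (ih.const_mul lam₀).add hkc
      exact (hY.add (hY.pow 2)).const_mul _
  have key : ∀ n, (‖a n 0‖ / 3) ^ 3 ≤ ‖a n 1‖ / 3 := fun n => by
    have := cube_le_of_nonvanishing (g := fun η => a n η / 3) ((had n).div_const 3)
      (fun η hη => div_ne_zero (mul_ne_zero (inv_ne_zero (pow_ne_zero n hl0)) (hmem η hη n).2.1)
        (by norm_num))
      (fun η hη => by
        rw [norm_div, div_le_one (by simp)]
        simpa using (hmem η hη n).2.2)
    simpa [norm_div] using this
  have e0 : (fun z => (0 : ℂ) * k z) = 0 := by funext z; simp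
  have e1 : (fun z => (1 : ℂ) * k z) = k := by funext z; simp
  have t0 : Tendsto (fun n => a n 0) atTop (𝓝 w₀) := by
    have := h.tendsto hl0 hl1 hw₀
    simp only [ha, e0]
    rwa [hψ₀] at this
  have t1 : Tendsto (fun n => a n 1) atTop (𝓝 w₁) := by
    have := h1.tendsto hl0 hl1 hw₁
    simp only [ha, e1]
    rwa [hψ₁] at this
  have := le_of_tendsto_of_tendsto' ((t0.norm.div_const 3).pow 3) (t1.norm.div_const 3) key
  linarith

end UnitPert

end Critical

section QuadraticBound

open Metric Set Topology

theorem exists_quadratic_conj {lam₀ : ℂ} (h0 : ‖lam₀‖ = 1) {r : ℝ} (hr : 0 < r) {ψ : ℂ → ℂ}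
    (hψ : DifferentiableOn ℂ ψ (ball 0 r)) (hz : ψ 0 = 0) (hd : deriv ψ 0 = 1)
    (heq : ∀ z ∈ ball (0 : ℂ) r, ψ z ^ 2 + lam₀ * ψ z = ψ (lam₀ * z)) :
    ∃ δ > 0, ∃ A ≥ 0, ∃ χ : ℂ → ℂ, DifferentiableOn ℂ χ (ball 0 δ) ∧
      (∀ y ∈ ball (0 : ℂ) δ, ‖χ y - y‖ ≤ A * ‖y‖ ^ 2) ∧
      (∀ y ∈ ball (0 : ℂ) δ, ‖χ y - y‖ ≤ 1 / 2 * ‖y‖) ∧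
      ∀ y ∈ ball (0 : ℂ) δ, lam₀ * y + lam₀ ^ 2 * y ^ 2 ∈ ball (0 : ℂ) δ →
        χ (lam₀ * y + lam₀ ^ 2 * y ^ 2) = lam₀ * χ y := by
  have hl0 : lam₀ ≠ 0 := by rw [← norm_pos_iff, h0]; norm_num
  set c := lam₀ ^ 2 with hc
  have hc0 : c ≠ 0 := pow_ne_zero 2 hl0
  have hcn : ‖c‖ = 1 := by rw [hc, norm_pow, h0, one_pow]
  have hcm : ∀ {z : ℂ} {ρ : ℝ}, z ∈ ball (0 : ℂ) ρ → c * z ∈ ball (0 : ℂ) ρ := fun h =>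
    mul_mem_ball hcn.le h
  set p : ℂ → ℂ := fun z => c⁻¹ * ψ (c * z) with hp
  have hpd : DifferentiableOn ℂ p (ball 0 r) :=
    (hψ.comp (differentiableOn_id.const_mul _) fun z h => hcm h).const_mul _
  have hpeq : ∀ z ∈ ball (0 : ℂ) r, lam₀ * p z + c * p z ^ 2 = p (lam₀ * z) := fun z hz' => by
    have := heq _ (hcm hz')
    have e : c * (lam₀ * z) = lam₀ * (c * z) := by ring
    simp only [hp, e, ← this]
    field_simp
    ring
  set h : ℂ → ℂ := fun z => p z - z with hh
  have hhd : DifferentiableOn ℂ h (ball 0 r) := hpd.sub differentiableOn_id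
  have hh0 : h 0 = 0 := by simp [hh, hp, hz]
  have hh1 : deriv h 0 = 0 := by
    have h1 : HasDerivAt ψ 1 (c * 0) := by
      rw [mul_zero, ← hd]
      exact (hψ.differentiableAt (ball_mem_nhds _ hr)).hasDerivAt
    have h2 : HasDerivAt (fun z => ψ (c * z)) (1 * (c * 1)) 0 :=
      h1.comp (0 : ℂ) ((hasDerivAt_id (0 : ℂ)).const_mul c)
    have h3 : HasDerivAt h (c⁻¹ * (1 * (c * 1)) - 1) 0 := (h2.const_mul c⁻¹).sub (hasDerivAt_id 0)
    rw [h3.deriv]; field_simp; simp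
  obtain ⟨M, hM⟩ : ∃ M, ∀ z ∈ ball (0 : ℂ) (r / 2), ‖h z‖ ≤ M := by
    have hcont : ContinuousOn h (closedBall 0 (r / 2)) :=
      hhd.continuousOn.mono (closedBall_subset_ball (by linarith))
    obtain ⟨M, hM⟩ := (isCompact_closedBall (0 : ℂ) (r / 2)).exists_bound_of_continuousOn hcont
    exact ⟨M, fun z hz => hM z (ball_subset_closedBall hz)⟩
  have hM0 : 0 ≤ M := (norm_nonneg _).trans (hM 0 (mem_ball_self (by positivity)))
  set B := M / (r / 2) ^ 2 with hB
  have hB0 : 0 ≤ B := by positivity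
  have hquad : ∀ z ∈ ball (0 : ℂ) (r / 2), ‖h z‖ ≤ B * ‖z‖ ^ 2 := fun z hz' =>
    quad_bound (hhd.mono (ball_subset_ball (by linarith))) hM hh0 hh1 hz'
  set δ := min (r / 4) (1 / (8 * (B + 1))) with hδ
  have hδ0 : 0 < δ := lt_min (by positivity) (by positivity)
  have hδB : 4 * B * δ ≤ 1 / 2 := by
    have : δ ≤ 1 / (8 * (B + 1)) := min_le_right _ _
    rw [le_div_iff₀ (by positivity)] at this
    nlinarith
  have hδr : δ ≤ r / 4 := min_le_left _ _
  have hsub : ball (0 : ℂ) δ ⊆ ball 0 (r / 2) := ball_subset_ball (by linarith)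
  have hsub' : ball (0 : ℂ) (r / 2) ⊆ ball 0 r := ball_subset_ball (by linarith)
  have hlip : ∀ x ∈ ball (0 : ℂ) δ, ∀ y ∈ ball (0 : ℂ) δ, ‖h x - h y‖ ≤ 1 / 2 * ‖x - y‖ :=
    fun x hx y hy => (lipschitz_of_quad hB0 (hhd.mono hsub') hquad (by linarith) hx hy).trans
      (by gcongr)
  obtain ⟨χ, hχd, hχ⟩ := exists_inverse_near_id (h := h) (c := 0) (a := δ / 2) (b := δ)
    (ε := δ / 2) (by positivity) (hhd.mono (hsub.trans hsub')) hlip (fun x hx => by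
      refine (hquad x (hsub hx)).trans ?_
      have : ‖x‖ < δ := by simpa using hx
      have : ‖x‖ ^ 2 ≤ δ ^ 2 := by gcongr
      nlinarith) (by linarith)
  have hpχ : ∀ y ∈ ball (0 : ℂ) (δ / 2), p (χ y) = y := fun y hy => by
    have := (hχ y hy).2
    rw [hh] at this
    linear_combination this
  have hinj : ∀ x ∈ ball (0 : ℂ) δ, ∀ y ∈ ball (0 : ℂ) δ, p x = p y → x = y := by
    intro x hx y hy hxy
    have := hlip x hx y hy
    simp only [hh] at this
    rw [hxy, sub_sub_sub_cancel_left, norm_sub_rev] at this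
    exact sub_eq_zero.1 (norm_le_zero_iff.1 (by linarith))
  have hχn : ∀ y ∈ ball (0 : ℂ) (δ / 2), ‖χ y‖ ≤ 2 * ‖y‖ := fun y hy => by
    obtain ⟨h1, h2⟩ := hχ y hy
    have h3 := hlip _ h1 0 (mem_ball_self hδ0)
    rw [hh0, sub_zero, sub_zero] at h3
    have h4 : ‖χ y‖ ≤ ‖y‖ + ‖h (χ y)‖ := by
      calc ‖χ y‖ = ‖y - h (χ y)‖ := by congr 1; linear_combination h2
        _ ≤ _ := norm_sub_le _ _
    linarith
  have hχ2 : ∀ y ∈ ball (0 : ℂ) (δ / 2), ‖χ y - y‖ ≤ 4 * B * ‖y‖ ^ 2 := fun y hy => by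
    obtain ⟨h1, h2⟩ := hχ y hy
    have e : χ y - y = - h (χ y) := by linear_combination h2
    rw [e, norm_neg]
    refine (hquad _ (hsub h1)).trans ?_
    have h3 : ‖χ y‖ ^ 2 ≤ (2 * ‖y‖) ^ 2 := by gcongr; exact hχn y hy
    nlinarith
  refine ⟨δ / 2, by positivity, 4 * B, by positivity, χ, hχd, hχ2, fun y hy => ?_,
    fun y hy hQy => ?_⟩
  · refine (hχ2 y hy).trans ?_
    have : ‖y‖ < δ / 2 := by simpa using hy
    have h4 : 4 * B * ‖y‖ ≤ 1 / 2 := by nlinarith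
    nlinarith [norm_nonneg y]
  · have hm := (hχ y hy).1
    refine hinj _ (hχ _ hQy).1 _ (mul_mem_ball h0.le hm) ?_
    rw [hpχ _ hQy, ← hpeq _ (hsub' (hsub hm)), hpχ y hy]

set_option maxHeartbeats 1000000 in
theorem exists_iterate_lower_bound {lam₀ : ℂ} (h0 : ‖lam₀‖ = 1) {r : ℝ} (hr : 0 < r) {ψ : ℂ → ℂ}
    (hψ : DifferentiableOn ℂ ψ (ball 0 r)) (hz : ψ 0 = 0) (hd : deriv ψ 0 = 1)
    (heq : ∀ z ∈ ball (0 : ℂ) r, ψ z ^ 2 + lam₀ * ψ z = ψ (lam₀ * z)) :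
    ∃ ρ > 0, ∀ s : ℝ, 9 / 10 ≤ s → s < 1 → ∀ z ∈ ball (0 : ℂ) ρ, ∀ n : ℕ,
      ‖z‖ / 8 ≤ ‖((s * lam₀) ^ n)⁻¹ * (quadMap s lam₀ 0)^[n] z‖ := by
  obtain ⟨δ, hδ, A, hA, χ, hχd, hχA, hχh, hχQ⟩ := exists_quadratic_conj h0 hr hψ hz hd heq
  set C := 40 * (A + 1) with hC
  have hC0 : 0 < C := by positivity
  set ρ := min (min (δ / 32) (1 / (120 * C))) (1 / 8) with hρ
  have hρ0 : 0 < ρ := lt_min (lt_min (by positivity) (by positivity)) (by norm_num)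
  have hρδ : ρ ≤ δ / 32 := (min_le_left _ _).trans (min_le_left _ _)
  have hρC : 120 * C * ρ ≤ 1 := by
    have : ρ ≤ 1 / (120 * C) := (min_le_left _ _).trans (min_le_right _ _)
    rwa [le_div_iff₀ (by positivity), mul_comm] at this
  have hρ8 : ρ ≤ 1 / 8 := min_le_right _ _
  refine ⟨ρ, hρ0, fun s hs hs1 z hzρ n => ?_⟩
  have hzn : ‖z‖ < ρ := by simpa using hzρ
  have hs0 : 0 < s := by linarith
  have hsn : ‖(s : ℂ)‖ = s := by simp [abs_of_pos hs0]
  set lam := (s : ℂ) * lam₀ with hlam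
  have hnl : ‖lam‖ = s := by simp [hlam, h0, abs_of_pos hs0]
  have hl0 : lam ≠ 0 := by rw [← norm_pos_iff, hnl]; exact hs0
  have hlow : ∀ y ∈ ball (0 : ℂ) δ, ‖y‖ ≤ 2 * ‖χ y‖ ∧ ‖χ y‖ ≤ 3 / 2 * ‖y‖ := fun y hy => by
    have h1 := hχh y hy
    have h2 := norm_sub_norm_le y (χ y)
    have h3 := norm_sub_norm_le (χ y) y
    rw [norm_sub_rev] at h2
    constructor <;> linarith
  have hdil : ∀ y : ℂ, ‖y‖ < δ / 4 → ‖χ (s * y) - s * χ y‖ ≤ C * (1 - s) * ‖y‖ ^ 2 := by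
    intro y hy
    have e : χ (s * y) - s * χ y = ((χ (s * y) - s * y) - (χ y - y)) + (1 - s) * (χ y - y) := by
      ring
    have hy1 : y ∈ ball (0 : ℂ) δ := by simp; linarith
    rcases eq_or_ne y 0 with rfl | hy0
    · have : χ 0 = 0 := by simpa using hχA 0 (mem_ball_self hδ)
      simp [this]
    have hyp := norm_pos_iff.2 hy0
    have h1 : ‖(χ (s * y) - s * y) - (χ y - y)‖ ≤ 4 * A * (2 * ‖y‖) * ‖s * y - y‖ := by
      refine lipschitz_of_quad (f := fun y => χ y - y) (r := δ) hA
        (hχd.sub differentiableOn_id) hχA (by linarith) ?_ ?_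
      · simp only [mem_ball, dist_zero_right, norm_mul, hsn]; nlinarith
      · simp only [mem_ball, dist_zero_right]; linarith
    have h2 : ‖(s : ℂ) * y - y‖ = (1 - s) * ‖y‖ := by
      have : (s : ℂ) * y - y = ((s - 1 : ℝ) : ℂ) * y := by push_cast; ring
      rw [this, norm_mul, Complex.norm_real, Real.norm_eq_abs, abs_sub_comm,
        abs_of_pos (by linarith)]
    have h3 : ‖(1 - s : ℂ)‖ = 1 - s := by
      rw [← Complex.ofReal_one, ← Complex.ofReal_sub, Complex.norm_real, Real.norm_eq_abs,
        abs_of_pos (by linarith)]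
    rw [e]
    refine (norm_add_le _ _).trans ?_
    rw [norm_mul, h3]
    rw [h2] at h1
    have h4 := hχA y hy1
    have h5 : (1 - s) * ‖χ y - y‖ ≤ (1 - s) * (A * ‖y‖ ^ 2) := by gcongr
    have h6 : 0 ≤ (1 - s) * ‖y‖ ^ 2 := by positivity
    nlinarith
  set x : ℕ → ℂ := fun n => (quadMap s lam₀ 0)^[n] z with hx
  set y : ℕ → ℂ := fun n => (lam ^ n)⁻¹ * χ (x n) with hy
  have hxs : ∀ n, x (n + 1) = s * (lam₀ * x n + lam₀ ^ 2 * x n ^ 2) := fun n => by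
    simp only [hx, Function.iterate_succ_apply', quadMap, Pi.zero_apply]; ring
  have hχy : ∀ n, ‖χ (x n)‖ = s ^ n * ‖y n‖ := fun n => by
    simp only [hy, norm_mul, norm_inv, norm_pow, hnl]; field_simp
  have hz1 : z ∈ ball (0 : ℂ) δ := by simp; linarith
  have hy00 : y 0 = χ z := by simp [hy, hx]
  have hy0 : ‖y 0‖ ≤ 3 / 2 * ‖z‖ := by rw [hy00]; exact (hlow z hz1).2
  have hy0' : ‖z‖ ≤ 2 * ‖y 0‖ := by rw [hy00]; exact (hlow z hz1).1
  have hyC : 80 * C * ‖y 0‖ ≤ 1 := by nlinarith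
  have main : ∀ n, ‖x n‖ < ρ * 8 ∧ ‖y n - y 0‖ ≤ 40 * C * ‖y 0‖ ^ 2 * (1 - s ^ n) := by
    intro n
    induction n with
    | zero => simp [hx]; linarith
    | succ n ih =>
      obtain ⟨ih1, ih2⟩ := ih
      have hp : 0 < s ^ n := by positivity
      have hp1 : s ^ n ≤ 1 := pow_le_one₀ hs0.le hs1.le
      have hyn : ‖y n‖ ≤ 3 / 2 * ‖y 0‖ := by
        have h1 : 40 * C * ‖y 0‖ ^ 2 * (1 - s ^ n) ≤ 40 * C * ‖y 0‖ ^ 2 * 1 := by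
          gcongr; linarith
        have h2 := norm_sub_norm_le (y n) (y 0)
        nlinarith [norm_nonneg (y 0)]
      have hxn : ‖x n‖ ≤ 3 * s ^ n * ‖y 0‖ := by
        have h1 := (hlow (x n) (by simp; linarith)).1
        rw [hχy n] at h1
        nlinarith
      have hxn0 : ‖x n‖ ≤ 9 / 2 * ρ := by
        have h1 : 3 * s ^ n * ‖y 0‖ ≤ 3 * 1 * ‖y 0‖ := by gcongr
        linarith
      set Q := lam₀ * x n + lam₀ ^ 2 * x n ^ 2 with hQ
      have hQn : ‖Q‖ ≤ 7 / 4 * ‖x n‖ := by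
        refine (norm_add_le _ _).trans ?_
        rw [norm_mul, norm_mul, norm_pow, norm_pow, h0]
        nlinarith [norm_nonneg (x n)]
      have hQρ : ‖Q‖ < δ / 4 := by linarith
      have hstep : ‖χ (x (n + 1)) - lam * χ (x n)‖ ≤ C * (1 - s) * ‖Q‖ ^ 2 := by
        have h1 := hdil Q hQρ
        rw [hQ, hχQ (x n) (by simp; linarith) (by simp only [mem_ball, dist_zero_right]; linarith),
          ← mul_assoc, ← hlam, ← hxs n] at h1
        exact h1
      have hdiff : ‖y (n + 1) - y n‖ ≤ 40 * C * ‖y 0‖ ^ 2 * (s ^ n - s ^ (n + 1)) := by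
        have e : y (n + 1) - y n = (lam ^ (n + 1))⁻¹ * (χ (x (n + 1)) - lam * χ (x n)) := by
          simp only [hy, pow_succ]; field_simp
        rw [e, norm_mul, norm_inv, norm_pow, hnl]
        have h1 : ‖Q‖ ^ 2 ≤ (21 / 4 * s ^ n * ‖y 0‖) ^ 2 := by
          gcongr; linarith
        calc (s ^ (n + 1))⁻¹ * ‖χ (x (n + 1)) - lam * χ (x n)‖
            ≤ (s ^ (n + 1))⁻¹ * (C * (1 - s) * (21 / 4 * s ^ n * ‖y 0‖) ^ 2) := by
              gcongr; exact hstep.trans (by gcongr)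
          _ = (441 / 16 / s) * (C * (1 - s) * ‖y 0‖ ^ 2 * s ^ n) := by
              rw [pow_succ]; field_simp; ring
          _ ≤ 40 * (C * (1 - s) * ‖y 0‖ ^ 2 * s ^ n) := by
              have h2 : 441 / 16 / s ≤ 40 := by rw [div_le_iff₀ hs0]; linarith
              gcongr
          _ = _ := by rw [pow_succ]; ring
      have hfin : ‖y (n + 1) - y 0‖ ≤ 40 * C * ‖y 0‖ ^ 2 * (1 - s ^ (n + 1)) := by
        have := norm_sub_le_norm_sub_add_norm_sub (y (n + 1)) (y n) (y 0)
        linarith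
      refine ⟨?_, hfin⟩
      rw [hxs n, norm_mul, hsn]
      have : s * ‖Q‖ ≤ 1 * ‖Q‖ := by gcongr
      linarith
  obtain ⟨h1, h2⟩ := main n
  have h3 : ‖y 0‖ / 2 ≤ ‖y n‖ := by
    have hp : 0 < s ^ n := by positivity
    have h4 : 40 * C * ‖y 0‖ ^ 2 * (1 - s ^ n) ≤ 40 * C * ‖y 0‖ ^ 2 * 1 := by
      gcongr; linarith
    have h5 := norm_sub_norm_le (y 0) (y n)
    rw [norm_sub_rev] at h5
    nlinarith [norm_nonneg (y 0)]
  have h4 := (hlow (x n) (by simp; linarith)).2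
  rw [hχy n] at h4
  rw [norm_mul, norm_inv, norm_pow, hnl]
  have hp : 0 < s ^ n := by positivity
  have h5 : ‖y n‖ ≤ 3 / 2 * ((s ^ n)⁻¹ * ‖x n‖) := by
    rw [← mul_le_mul_iff_right₀ hp]
    refine h4.trans (le_of_eq ?_)
    field_simp
  change ‖z‖ / 8 ≤ (s ^ n)⁻¹ * ‖x n‖
  linarith

theorem exists_critical_lower_bound {lam₀ : ℂ} (h0 : ‖lam₀‖ = 1) {r : ℝ} (hr : 0 < r) {ψ : ℂ → ℂ}
    (hψ : DifferentiableOn ℂ ψ (ball 0 r)) (hz : ψ 0 = 0) (hd : deriv ψ 0 = 1)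
    (heq : ∀ z ∈ ball (0 : ℂ) r, ψ z ^ 2 + lam₀ * ψ z = ψ (lam₀ * z)) :
    ∃ c > 0, ∀ s : ℝ, 9 / 10 ≤ s → s < 1 → ∀ k : ℂ → ℂ, DifferentiableOn ℂ k (ball 0 6) →
      (∀ z ∈ ball (0 : ℂ) 6, ‖k z‖ ≤ 1 / 48 * ‖z‖ ^ 2) →
      ∃ ρ φ, Linearizes (quadMap s lam₀ k) (s * lam₀) ρ 3 φ ∧ c ≤ ρ := by
  obtain ⟨ρ', hρ', H'⟩ := exists_iterate_lower_bound h0 hr hψ hz hd heq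
  set ρ := min ρ' (1 / 8) with hρd
  have hρ : 0 < ρ := lt_min hρ' (by norm_num)
  have hρ8 : ρ ≤ 1 / 8 := min_le_right _ _
  refine ⟨3 * (ρ / 16 / 3) ^ 3, by positivity, fun s hs hs1 k hk hk2 => ?_⟩
  have hs0 : 0 < s := by linarith
  have hnl : ‖(s : ℂ) * lam₀‖ = s := by simp [h0, abs_of_pos hs0]
  have hl0 : (s : ℂ) * lam₀ ≠ 0 := by rw [← norm_pos_iff, hnl]; exact hs0
  have hp0 : UnitPert 0 := ⟨differentiableOn_const 0, fun z _ => by simp⟩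
  have hpk : UnitPert k := ⟨hk, fun z hz => (hk2 z hz).trans (by gcongr; norm_num)⟩
  obtain ⟨r₀, ψ₀, w₀, hL₀, hw₀, hv₀⟩ := hp0.exists_linearizes_critical h0 hs hs1
  obtain ⟨r₁, ψ₁, w₁, hL₁, hw₁, hv₁⟩ := hpk.exists_linearizes_critical h0 hs hs1
  have hmain := UnitPert.norm_cube_le hk hk2 h0 hs hs1 hL₀ hw₀ hv₀ hL₁ hw₁ hv₁
  have hw₁r : ‖w₁‖ < r₁ := by simpa using hw₁
  refine ⟨r₁, ψ₁, hL₁, ?_⟩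
  suffices h : ρ / 16 ≤ ‖w₀‖ by
    have : 3 * (ρ / 16 / 3) ^ 3 ≤ 3 * (‖w₀‖ / 3) ^ 3 := by gcongr
    linarith
  by_contra! hlt
  have hseg : ∀ t ∈ Icc (0 : ℝ) 1, (t : ℂ) * w₀ ∈ ball (0 : ℂ) r₀ := fun t ht =>
    mul_mem_ball (by simpa [abs_of_nonneg ht.1] using ht.2) hw₀
  have hcont : ContinuousOn (fun t : ℝ => ‖ψ₀ (t * w₀)‖) (Icc 0 1) := by
    refine (hL₀.diff.continuousOn.comp (by fun_prop) hseg).norm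
  have hivt := intermediate_value_Icc zero_le_one hcont
  have hv : ‖(-s / 4 : ℂ)‖ = s / 4 := by simp [abs_of_pos hs0]
  simp only [Complex.ofReal_zero, zero_mul, hL₀.zero, norm_zero, Complex.ofReal_one, one_mul, hv₀,
    hv] at hivt
  obtain ⟨t, ht, hte⟩ := hivt ⟨by positivity, by linarith⟩ (a := ρ / 2)
  have hlim := (hL₀.tendsto hl0 (by rw [hnl]; exact hs1) (hseg t ht)).norm
  have hge := ge_of_tendsto' hlim fun n => H' s hs hs1 (ψ₀ (t * w₀)) (by
    simp only at hte
    simp only [mem_ball, dist_zero_right, hte]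
    linarith [min_le_left ρ' (1 / 8)]) n
  simp only at hte
  rw [hte, norm_mul, Complex.norm_real, Real.norm_eq_abs, abs_of_nonneg ht.1] at hge
  have := mul_le_of_le_one_left (norm_nonneg w₀) ht.2
  linarith

end QuadraticBound

section UniformStability

open Metric Set Topology

theorem Linearizes.norm_iterate_le_three_mul {F : ℂ → ℂ} {lam : ℂ} {r c : ℝ} {φ : ℂ → ℂ}
    (h : Linearizes F lam r 3 φ) (hl : ‖lam‖ ≤ 1) (hc : 0 < c) (hcr : c ≤ r) {y : ℂ}
    (hy : ‖y‖ < c ^ 2 / 96) (n : ℕ) : ‖F^[n] y‖ ≤ 3 * ‖y‖ := by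
  have hc3 : c ≤ 3 := hcr.trans h.radius_le
  have hsub : ball (0 : ℂ) c ⊆ ball 0 r := ball_subset_ball hcr
  set g : ℂ → ℂ := fun z => φ z - z with hg
  have hgd : DifferentiableOn ℂ g (ball 0 c) := (h.diff.mono hsub).sub differentiableOn_id
  have hg1 : deriv g 0 = 0 := by
    have h1 : HasDerivAt φ 1 0 := by
      rw [← h.deriv_zero]
      exact (h.diff.differentiableAt (ball_mem_nhds _ h.pos)).hasDerivAt
    have h2 : HasDerivAt g (1 - 1) 0 := h1.sub (hasDerivAt_id 0)
    rw [h2.deriv, sub_self]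
  have hgq : ∀ z ∈ ball (0 : ℂ) c, ‖g z‖ ≤ 6 / c ^ 2 * ‖z‖ ^ 2 := fun z hz => by
    refine quad_bound hgd (fun x hx => ?_) (by simp [hg, h.zero]) hg1 hz
    have h1 : ‖φ x‖ < 3 := by simpa using h.mem x (hsub hx)
    have h2 : ‖x‖ < c := by simpa using hx
    exact (norm_sub_le _ _).trans (by linarith)
  set δ := c ^ 2 / 48 with hδ
  have hδ0 : 0 < δ := by positivity
  have hδc : δ ≤ c / 2 := by rw [hδ]; nlinarith
  have hlip : ∀ x ∈ ball (0 : ℂ) δ, ∀ y ∈ ball (0 : ℂ) δ, ‖g x - g y‖ ≤ 1 / 2 * ‖x - y‖ :=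
    fun x hx y hy => (lipschitz_of_quad (by positivity) hgd hgq hδc hx hy).trans (le_of_eq (by
      rw [hδ]; field_simp; ring))
  have hsubδ : ball (0 : ℂ) δ ⊆ ball 0 c := ball_subset_ball (by linarith)
  have hg0 : g 0 = 0 := by simp [hg, h.zero]
  have hgl : ∀ x ∈ ball (0 : ℂ) δ, ‖g x‖ ≤ 1 / 2 * ‖x‖ := fun x hx => by
    simpa [hg0] using hlip x hx 0 (mem_ball_self hδ0)
  obtain ⟨u, -, hu⟩ := exists_inverse_near_id (h := g) (c := 0) (a := δ / 2) (b := δ)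
    (ε := δ / 2) (by positivity) (hgd.mono hsubδ) hlip (fun x hx => by
      have : ‖x‖ < δ := by simpa using hx
      linarith [hgl x hx]) (by linarith)
  obtain ⟨h1, h2⟩ := hu y (by simp only [mem_ball, dist_zero_right]; rw [hδ]; linarith)
  have hφu : φ (u y) = y := by
    have h3 : φ (u y) = u y + g (u y) := by simp [hg]
    rw [h3, h2]
  have h3 : ‖u y‖ ≤ 2 * ‖y‖ := by
    have h4 : ‖u y‖ ≤ ‖y‖ + ‖g (u y)‖ := by
      calc ‖u y‖ = ‖y - g (u y)‖ := by congr 1; linear_combination h2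
        _ ≤ _ := norm_sub_le _ _
    linarith [hgl _ h1]
  have hln : ‖lam ^ n‖ ≤ 1 := by rw [norm_pow]; exact pow_le_one₀ (norm_nonneg _) hl
  have h5 := h.iterate hl n (u y) (hsub (hsubδ h1))
  rw [hφu] at h5
  have h6 := mul_mem_ball hln h1
  have h7 := hgl _ h6
  have h8 : ‖lam ^ n * u y‖ ≤ ‖u y‖ := by
    rw [norm_mul]; exact mul_le_of_le_one_left (norm_nonneg _) hln
  have h9 : φ (lam ^ n * u y) = lam ^ n * u y + g (lam ^ n * u y) := by simp [hg]
  rw [h5, h9]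
  exact (norm_add_le _ _).trans (by linarith)

theorem exists_uniform_stability {lam₀ : ℂ} (h0 : ‖lam₀‖ = 1) {r : ℝ} (hr : 0 < r) {ψ : ℂ → ℂ}
    (hψ : DifferentiableOn ℂ ψ (ball 0 r)) (hz : ψ 0 = 0) (hd : deriv ψ 0 = 1)
    (heq : ∀ z ∈ ball (0 : ℂ) r, ψ z ^ 2 + lam₀ * ψ z = ψ (lam₀ * z)) :
    ∃ σ > 0, ∀ f : ℂ → ℂ, InG lam₀ f → ∀ s : ℝ, 9 / 10 ≤ s → s < 1 → ∀ z : ℂ, ‖z‖ < σ →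
      ∀ n : ℕ, ‖(fun x => (s : ℂ) * f x)^[n] z‖ ≤ 3 * ‖z‖ := by
  obtain ⟨c, hc, H⟩ := exists_critical_lower_bound h0 hr hψ hz hd heq
  set σ := min (c ^ 2 / 96 / 25) (1 / 4) with hσ
  refine ⟨σ, lt_min (by positivity) (by norm_num), fun f hf s hs hs1 z hzσ => ?_⟩
  have hs0 : 0 < s := by linarith
  have hnl : ‖(s : ℂ) * lam₀‖ = s := by simp [h0, abs_of_pos hs0]
  have hz1 : ‖z‖ < 1 / 4 := hzσ.trans_le (min_le_right _ _)
  have hz2 : ‖z‖ < c ^ 2 / 96 / 25 := hzσ.trans_le (min_le_left _ _)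
  set G : ℂ → ℂ → ℂ := fun t x => s * (f x + t * f x ^ 2) with hG
  have hlarge : ∀ t : ℂ, 24 ≤ ‖t‖ → ‖t‖ < 25 → ∀ n, ‖(G t)^[n] z‖ ≤ 3 * ‖z‖ := by
    intro t ht ht' n
    have ht0 : t ≠ 0 := by rw [← norm_pos_iff]; linarith
    set k : ℂ → ℂ := fun ζ => t * f (ζ / t) - lam₀ * ζ with hk
    have hdiv : ∀ ζ ∈ ball (0 : ℂ) 6, ζ / t ∈ ball (0 : ℂ) 1 := fun ζ hζ => by
      simp only [mem_ball, dist_zero_right, norm_div] at hζ ⊢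
      rw [div_lt_one (by linarith)]; linarith
    obtain ⟨ρ, φ, hL, hcρ⟩ := H s hs hs1 k
      (((hf.1.comp (differentiableOn_id.div_const t) hdiv).const_mul t).sub
        (differentiableOn_id.const_mul lam₀)) (fun ζ hζ => by
      have h1 := hf.2 _ (hdiv ζ hζ)
      have e : k ζ = t * (f (ζ / t) - lam₀ * (ζ / t)) := by simp only [hk]; field_simp
      rw [e, norm_mul]
      rw [norm_div] at h1
      calc ‖t‖ * ‖f (ζ / t) - lam₀ * (ζ / t)‖ ≤ ‖t‖ * ((‖ζ‖ / ‖t‖) ^ 2 / 2) := by gcongr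
        _ = ‖ζ‖ ^ 2 / (2 * ‖t‖) := by field_simp
        _ ≤ ‖ζ‖ ^ 2 / 48 := by gcongr; linarith
        _ = _ := by ring)
    have hsc : Function.Semiconj (fun x => t * x) (G t) (quadMap s lam₀ k) := fun x => by
      simp only [hG, quadMap, hk]
      rw [mul_div_cancel_left₀ x ht0]
      ring
    have h1 := (hsc.iterate_right n).eq z
    have h2 := hL.norm_iterate_le_three_mul (by rw [hnl]; exact hs1.le) hc hcρ (y := t * z) (by
      rw [norm_mul]
      calc ‖t‖ * ‖z‖ ≤ 25 * ‖z‖ := by gcongr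
        _ < _ := by linarith) n
    rw [← h1, norm_mul, norm_mul] at h2
    have h3 : 0 < ‖t‖ := by linarith
    refine le_of_mul_le_mul_left ?_ h3
    linarith
  have hmem : ∀ x : ℂ, ‖x‖ ≤ 3 * ‖z‖ → x ∈ ball (0 : ℂ) 1 := fun x hx => by
    simp only [mem_ball, dist_zero_right]; linarith
  have hmain : ∀ n, (∀ t ∈ ball (0 : ℂ) 25, ‖(G t)^[n] z‖ ≤ 3 * ‖z‖) ∧
      DifferentiableOn ℂ (fun t => (G t)^[n] z) (ball 0 25) := by
    intro n
    induction n with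
    | zero => exact ⟨fun t _ => by simp; linarith [norm_nonneg z], by simp⟩
    | succ n ih =>
      have hfd : DifferentiableOn ℂ (fun t => f ((G t)^[n] z)) (ball 0 25) :=
        hf.1.comp ih.2 fun t ht => hmem _ (ih.1 t ht)
      have hdd : DifferentiableOn ℂ (fun t => (G t)^[n + 1] z) (ball 0 25) := by
        simp only [Function.iterate_succ_apply', hG]
        exact (hfd.add (differentiableOn_id.mul (hfd.pow 2))).const_mul _
      refine ⟨fun t ht => ?_, hdd⟩
      have ht' : ‖t‖ < 25 := by simpa using ht
      rcases le_or_gt 24 ‖t‖ with h24 | h24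
      · exact hlarge t h24 ht' _
      · refine Complex.norm_le_of_forall_mem_frontier_norm_le (U := ball 0 24) isBounded_ball
          (f := fun t => (G t)^[n + 1] z) ?_ (fun x hx => ?_) (subset_closure (by simpa using h24))
        · refine DifferentiableOn.diffContOnCl (hdd.mono ?_)
          rw [closure_ball _ (by norm_num)]
          exact closedBall_subset_ball (by norm_num)
        · rw [frontier_ball _ (by norm_num)] at hx
          have : ‖x‖ = 24 := by simpa using hx
          exact hlarge x this.ge (by rw [this]; norm_num) _
  intro n
  have := (hmain n).1 0 (by simp)
  simpa [hG] using this

theorem not_escP_of_linearizable {lam₀ : ℂ} (h0 : ‖lam₀‖ = 1) {r : ℝ} (hr : 0 < r) {ψ : ℂ → ℂ}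
    (hψ : DifferentiableOn ℂ ψ (ball 0 r)) (hz : ψ 0 = 0) (hd : deriv ψ 0 = 1)
    (heq : ∀ z ∈ ball (0 : ℂ) r, ψ z ^ 2 + lam₀ * ψ z = ψ (lam₀ * z)) {s₀ : ℝ} (hs₀ : 0 < s₀) :
    ∃ Y, ¬ EscP s₀ lam₀ Y := by
  obtain ⟨σ, hσ, H⟩ := exists_uniform_stability h0 hr hψ hz hd heq
  set ρ := min (min (σ / 2) (1 / 4)) (s₀ / 4) with hρ
  have hρ0 : 0 < ρ := lt_min (lt_min (by positivity) (by norm_num)) (by positivity)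
  refine ⟨-Real.log ρ, ?_⟩
  rintro ⟨f, hf, z, hzρ, n, -, hn⟩
  rw [neg_neg, Real.exp_log hρ0] at hzρ
  have h1 : ‖z‖ ≤ σ / 2 := hzρ.trans ((min_le_left _ _).trans (min_le_left _ _))
  have h2 : ‖z‖ ≤ 1 / 4 := hzρ.trans ((min_le_left _ _).trans (min_le_right _ _))
  have h3 : ‖z‖ ≤ s₀ / 4 := hzρ.trans (min_le_right _ _)
  have hb : ∀ᶠ s : ℝ in 𝓝[<] 1, 9 / 10 ≤ s ∧ s < 1 := by
    filter_upwards [Ioo_mem_nhdsLT (show (9 / 10 : ℝ) < 1 by norm_num)] with s hs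
    exact ⟨hs.1.le, hs.2⟩
  have hlim : ∀ n, Tendsto (fun s : ℝ => (fun x => (s : ℂ) * f x)^[n] z) (𝓝[<] 1) (𝓝 (f^[n] z)) ∧
      ‖f^[n] z‖ ≤ 3 * ‖z‖ := by
    intro n
    have hcl : Tendsto (fun s : ℝ => (fun x => (s : ℂ) * f x)^[n] z) (𝓝[<] 1) (𝓝 (f^[n] z)) →
        ‖f^[n] z‖ ≤ 3 * ‖z‖ := fun ht => by
      refine le_of_tendsto ht.norm ?_
      filter_upwards [hb] with s hs using H f hf s hs.1 hs.2 z (by linarith) n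
    induction n with
    | zero => exact ⟨by simp, by simp; linarith [norm_nonneg z]⟩
    | succ n ih =>
      suffices ht : Tendsto (fun s : ℝ => (fun x => (s : ℂ) * f x)^[n + 1] z) (𝓝[<] 1)
        (𝓝 (f^[n + 1] z)) from ⟨ht, hcl ht⟩
      simp only [Function.iterate_succ_apply']
      obtain ⟨ih1, ih2⟩ := ih fun ht => by
        refine le_of_tendsto ht.norm ?_
        filter_upwards [hb] with s hs using H f hf s hs.1 hs.2 z (by linarith) n
      have hcf : ContinuousAt f (f^[n] z) :=
        (hf.1.differentiableAt (isOpen_ball.mem_nhds (by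
          simp only [mem_ball, dist_zero_right]; linarith))).continuousAt
      have hs : Tendsto (fun s : ℝ => (s : ℂ)) (𝓝[<] 1) (𝓝 1) := by
        have : Tendsto (fun s : ℝ => (s : ℂ)) (𝓝 1) (𝓝 ((1 : ℝ) : ℂ)) :=
          Complex.continuous_ofReal.tendsto 1
        rw [Complex.ofReal_one] at this
        exact this.mono_left nhdsWithin_le_nhds
      simpa using hs.mul (hcf.tendsto.comp ih1)
  have := (hlim n).2
  linarith

end UniformStability

section CotRemainder
open Metric Set Topology

/-- The entire function `sin z / (z (z + π))`. -/
noncomputable def sinQuot : ℂ → ℂ := dslope (dslope Complex.sin 0) (-π)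

/-- The function `cot z - 1 / z - 1 / (z + π)`, continued across `0` and `-π`. -/
noncomputable def cotRem (z : ℂ) : ℂ := logDeriv sinQuot z

theorem differentiable_sinQuot : Differentiable ℂ sinQuot := by
  rw [← differentiableOn_univ, sinQuot, Complex.differentiableOn_dslope univ_mem,
    Complex.differentiableOn_dslope univ_mem]
  exact Complex.differentiable_sin.differentiableOn

theorem sin_eq_mul_sinQuot (z : ℂ) : Complex.sin z = z * (z + π) * sinQuot z := by
  have h1 := sub_smul_dslope Complex.sin 0 z
  have h2 := sub_smul_dslope (dslope Complex.sin 0) (-π : ℂ) z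
  have h3 := sub_smul_dslope Complex.sin 0 (-π : ℂ)
  have hpi : (-π : ℂ) ≠ 0 := by simp [Real.pi_ne_zero]
  simp only [sub_zero, Complex.sin_zero, smul_eq_mul, Complex.sin_neg, Complex.sin_pi, neg_zero,
    mul_eq_zero, hpi, false_or] at h1 h2 h3
  rw [h3, sub_zero, sub_neg_eq_add] at h2
  rw [mul_assoc, sinQuot, h2, h1]

theorem sinQuot_ne_zero {z : ℂ} (h1 : -(2 * π) < z.re) (h2 : z.re < π) : sinQuot z ≠ 0 := by
  intro h
  have hs : Complex.sin z = 0 := by rw [sin_eq_mul_sinQuot, h, mul_zero]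
  have hd : Complex.cos z = (1 * (z + π) + z * 1) * sinQuot z
      + z * (z + π) * deriv sinQuot z := by
    have e1 := (((hasDerivAt_id z).mul ((hasDerivAt_id z).add_const (π : ℂ))).mul
      (differentiable_sinQuot z).hasDerivAt)
    have e2 := Complex.hasDerivAt_sin z
    refine e2.unique ?_
    refine HasDerivAt.congr_of_eventuallyEq e1 (Eventually.of_forall fun w => ?_)
    exact sin_eq_mul_sinQuot w
  obtain ⟨k, rfl⟩ := Complex.sin_eq_zero_iff.1 hs
  have hre : ((k : ℂ) * π).re = k * π := by
    rw [← Complex.ofReal_intCast, ← Complex.ofReal_mul, Complex.ofReal_re]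
  rw [hre] at h1 h2
  have hpi := Real.pi_pos
  have k1 : (k : ℝ) < 1 := by nlinarith
  have k2 : (-2 : ℝ) < k := by nlinarith
  have k1' : k < 1 := by exact_mod_cast k1
  have k2' : -2 < k := by exact_mod_cast k2
  have hcos : Complex.cos (k * π) ≠ 0 := by
    have hc := Complex.sin_sq_add_cos_sq ((k : ℂ) * π)
    intro hc0
    rw [hs, hc0] at hc
    norm_num at hc
  apply hcos
  rw [hd, h]
  obtain rfl | rfl : k = 0 ∨ k = -1 := by omega
  · simp
  · simp

theorem cotRem_eq {z : ℂ} (hs : Complex.sin z ≠ 0) :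
    cotRem z = Complex.cot z - 1 / z - 1 / (z + π) := by
  have hz := sin_eq_mul_sinQuot z
  have hq : sinQuot z ≠ 0 := by rintro h; rw [h, mul_zero] at hz; exact hs hz
  have hz0 : z ≠ 0 := by rintro rfl; simp at hs
  have hz1 : z + π ≠ 0 := by rintro h; rw [h, mul_zero, zero_mul] at hz; exact hs hz
  have e : Complex.sin = fun z => (z * (z + π)) * sinQuot z := funext sin_eq_mul_sinQuot
  have h1 : Complex.cot z = logDeriv (fun z => (z * (z + π)) * sinQuot z) z := by
    rw [← e, Complex.logDeriv_sin]
  rw [logDeriv_mul (f := fun z : ℂ => z * (z + π)) z (mul_ne_zero hz0 hz1) hq (by fun_prop)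
    (differentiable_sinQuot z),
    logDeriv_mul (f := fun z : ℂ => z) z hz0 hz1 (by fun_prop) (by fun_prop)] at h1
  have h2 : logDeriv (fun z : ℂ => z) z = 1 / z := by simp [logDeriv_apply]
  have h3 : logDeriv (fun z : ℂ => z + π) z = 1 / (z + π) := by simp [logDeriv_apply]
  rw [h1, h2, h3, cotRem]
  ring

theorem differentiableOn_cotRem :
    DifferentiableOn ℂ cotRem {z | -(2 * π) < z.re ∧ z.re < π} := by
  have : cotRem = fun z => deriv sinQuot z / sinQuot z := by
    ext z; rw [cotRem, logDeriv_apply]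
  rw [this]
  intro z hz
  have h2 : DifferentiableAt ℂ (deriv sinQuot) z :=
    ((differentiable_sinQuot.differentiableOn (s := univ)).deriv isOpen_univ).differentiableAt
      univ_mem
  exact (h2.div (differentiable_sinQuot z) (sinQuot_ne_zero hz.1 hz.2)).differentiableWithinAt

theorem sin_ne_zero_of_im {z : ℂ} (h : z.im ≠ 0) : Complex.sin z ≠ 0 := by
  intro hs
  obtain ⟨k, rfl⟩ := Complex.sin_eq_zero_iff.1 hs
  apply h
  rw [← Complex.ofReal_intCast, ← Complex.ofReal_mul, Complex.ofReal_im]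

theorem norm_cot_sub_I_le {z : ℂ} (h : z.im ≤ -1) :
    ‖Complex.cot z - Complex.I‖ ≤ 3 * Real.exp (2 * z.im) := by
  have hI := Complex.I_ne_zero
  have hII := Complex.I_sq
  have hq : ‖Complex.exp (-(2 * Complex.I * z))‖ = Real.exp (2 * z.im) := by
    rw [Complex.norm_exp]
    congr 1
    simp
  set q := Complex.exp (-(2 * Complex.I * z)) with hqd
  have hlt : Real.exp (2 * z.im) ≤ 1 / 4 := by
    have e1 : Real.exp (2 * z.im) ≤ Real.exp (-2) := Real.exp_le_exp.2 (by linarith)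
    have e2 : Real.exp (-2) ≤ 1 / 4 := by
      rw [Real.exp_neg]
      have : (4 : ℝ) ≤ Real.exp 2 := by
        have h1 : Real.exp 2 = Real.exp 1 * Real.exp 1 := by rw [← Real.exp_add]; norm_num
        have h2 := Real.exp_one_gt_two
        nlinarith
      rw [one_div]
      exact inv_anti₀ (by norm_num) this
    linarith
  have h1q : 3 / 4 ≤ ‖1 - q‖ := by
    have := norm_sub_norm_le (1 : ℂ) q
    rw [norm_one, hq] at this
    linarith
  have hne : 1 - q ≠ 0 := by
    intro h0; rw [h0, norm_zero] at h1q; norm_num at h1q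
  have he : Complex.exp (2 * Complex.I * z) = q⁻¹ := by
    rw [hqd, ← Complex.exp_neg, neg_neg]
  have hq0 : q ≠ 0 := Complex.exp_ne_zero _
  have key : Complex.cot z - Complex.I = 2 * Complex.I * q / (1 - q) := by
    rw [Complex.cot_eq_exp_ratio, he]
    have : Complex.I * (1 - q⁻¹) ≠ 0 := by
      refine mul_ne_zero hI ?_
      rw [sub_ne_zero]
      intro h
      apply hne
      rw [← inv_inv q, ← h]; simp
    have h3 : q⁻¹ + 1 = (1 + q) / q := by field_simp
    have h4 : Complex.I * (1 - q⁻¹) = Complex.I * (-(1 - q)) / q := by field_simp; ring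
    rw [h3, h4]
    field_simp
    linear_combination (-(1 + q)) * hII
  rw [key, norm_div, norm_mul, norm_mul, hq, Complex.norm_I, div_le_iff₀ (by linarith)]
  have := Real.exp_pos (2 * z.im)
  norm_num
  nlinarith

theorem norm_cot_le {z : ℂ} (h : 1 ≤ |z.im|) : ‖Complex.cot z‖ ≤ 2 := by
  wlog hz : z.im ≤ 0 generalizing z
  · have := this (z := -z) (by simpa using h) (by simp; linarith)
    rwa [Complex.cot_eq_cos_div_sin, Complex.cos_neg, Complex.sin_neg, div_neg, norm_neg,
      ← Complex.cot_eq_cos_div_sin] at this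
  rw [abs_of_nonpos hz] at h
  have h1 := norm_cot_sub_I_le (z := z) (by linarith)
  have h2 := norm_add_le (Complex.cot z - Complex.I) Complex.I
  rw [sub_add_cancel, Complex.norm_I] at h2
  have e2 : Real.exp (2 * z.im) ≤ 1 / 3 := by
    have e1 : Real.exp (2 * z.im) ≤ Real.exp (-2) := Real.exp_le_exp.2 (by linarith)
    have e2 : Real.exp (-2) ≤ 1 / 3 := by
      rw [Real.exp_neg]
      have : (3 : ℝ) ≤ Real.exp 2 := by
        have h1 : Real.exp 2 = Real.exp 1 * Real.exp 1 := by rw [← Real.exp_add]; norm_num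
        have h2 := Real.exp_one_gt_two
        nlinarith
      rw [one_div]
      exact inv_anti₀ (by norm_num) this
    linarith
  linarith

theorem exists_norm_cotRem_le :
    ∃ R : ℝ, 0 < R ∧ ∀ z : ℂ, -(15 / 8 * π) ≤ z.re → z.re ≤ 7 / 8 * π → ‖cotRem z‖ ≤ R := by
  have hpi := Real.pi_pos
  have hc : IsCompact (Icc (-(15 / 8 * π)) (7 / 8 * π) ×ℂ Icc (-1 : ℝ) 1) :=
    isCompact_Icc.reProdIm isCompact_Icc
  obtain ⟨R, hR⟩ := hc.exists_bound_of_continuousOn (f := cotRem)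
    (differentiableOn_cotRem.continuousOn.mono fun z hz => by
      rw [Complex.mem_reProdIm] at hz
      exact ⟨by linarith [hz.1.1], by linarith [hz.1.2]⟩)
  refine ⟨max R 4, by positivity, fun z h1 h2 => ?_⟩
  by_cases hz : |z.im| ≤ 1
  · exact (hR z (Complex.mem_reProdIm.2 ⟨⟨h1, h2⟩, abs_le.1 hz⟩)).trans (le_max_left _ _)
  · refine le_trans ?_ (le_max_right _ _)
    push Not at hz
    have him : z.im ≠ 0 := by intro h; rw [h] at hz; norm_num at hz
    rw [cotRem_eq (sin_ne_zero_of_im him)]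
    have b1 := norm_cot_le hz.le
    have b2 : ‖1 / z‖ ≤ 1 := by
      rw [norm_div, norm_one]
      have := Complex.abs_im_le_norm z
      exact div_le_one_of_le₀ (by linarith) (norm_nonneg _)
    have b3 : ‖1 / (z + π)‖ ≤ 1 := by
      rw [norm_div, norm_one]
      have := Complex.abs_im_le_norm (z + π)
      simp only [Complex.add_im, Complex.ofReal_im, add_zero] at this
      exact div_le_one_of_le₀ (by linarith) (norm_nonneg _)
    calc _ ≤ ‖Complex.cot z - 1 / z‖ + ‖1 / (z + π)‖ := norm_sub_le _ _
      _ ≤ ‖Complex.cot z‖ + ‖1 / z‖ + ‖1 / (z + π)‖ := by gcongr; exact norm_sub_le _ _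
      _ ≤ 4 := by linarith

theorem exists_lipschitz_cotRem :
    ∃ R : ℝ, 0 < R ∧ ∀ z w : ℂ, -(7 / 4 * π) < z.re → z.re < 3 / 4 * π →
      -(7 / 4 * π) < w.re → w.re < 3 / 4 * π → ‖cotRem z - cotRem w‖ ≤ R * ‖z - w‖ := by
  have hpi := Real.pi_pos
  obtain ⟨R, hR, hb⟩ := exists_norm_cotRem_le
  refine ⟨R / (π / 8), by positivity, fun z w z1 z2 w1 w2 => ?_⟩
  have hU : IsOpen {z : ℂ | -(7 / 4 * π) < z.re ∧ z.re < 3 / 4 * π} :=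
    (isOpen_lt continuous_const Complex.continuous_re).inter
      (isOpen_lt Complex.continuous_re continuous_const)
  have hcv : Convex ℝ {z : ℂ | -(7 / 4 * π) < z.re ∧ z.re < 3 / 4 * π} :=
    (convex_halfSpace_re_gt _).inter (convex_halfSpace_re_lt _)
  refine lipschitz_of_deriv_le hU hcv (differentiableOn_cotRem.mono fun v hv => ?_)
    (fun v hv => ?_) ⟨z1, z2⟩ ⟨w1, w2⟩
  · exact ⟨by linarith [hv.1], by linarith [hv.2]⟩
  · have hsub : ∀ x ∈ ball v (π / 8), -(15 / 8 * π) < x.re ∧ x.re < 7 / 8 * π := by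
      intro x hx
      rw [mem_ball, dist_eq_norm] at hx
      have := (Complex.abs_re_le_norm (x - v)).trans_lt hx
      rw [Complex.sub_re, abs_lt] at this
      exact ⟨by linarith [hv.1, this.1], by linarith [hv.2, this.2]⟩
    refine norm_deriv_le_of_ball (by positivity)
      (differentiableOn_cotRem.mono fun x hx => ?_) fun x hx => ?_
    · exact ⟨by linarith [(hsub x hx).1], by linarith [(hsub x hx).2]⟩
    · exact hb x (hsub x hx).1.le (hsub x hx).2.le

theorem tendsto_cotRem : Tendsto cotRem (comap Complex.im atBot) (𝓝 Complex.I) := by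
  have him : Tendsto Complex.im (comap Complex.im atBot) atBot := tendsto_comap
  have hneg : ∀ᶠ z in comap Complex.im atBot, z.im ≤ -1 := him.eventually (eventually_le_atBot _)
  have h1 : Tendsto Complex.cot (comap Complex.im atBot) (𝓝 Complex.I) := by
    rw [tendsto_iff_norm_sub_tendsto_zero]
    have e : Tendsto (fun z : ℂ => 3 * Real.exp (2 * z.im)) (comap Complex.im atBot) (𝓝 0) := by
      have := (Real.tendsto_exp_atBot.comp (him.const_mul_atBot (by norm_num : (0:ℝ) < 2)))
      simpa using this.const_mul 3
    exact squeeze_zero' (Eventually.of_forall fun _ => norm_nonneg _)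
      (hneg.mono fun z hz => norm_cot_sub_I_le hz) e
  have hinv : ∀ c : ℝ, Tendsto (fun z : ℂ => 1 / (z + c)) (comap Complex.im atBot) (𝓝 0) := by
    intro c
    rw [tendsto_zero_iff_norm_tendsto_zero]
    have e : Tendsto (fun z : ℂ => |z.im|⁻¹) (comap Complex.im atBot) (𝓝 0) :=
      tendsto_inv_atTop_zero.comp (tendsto_abs_atBot_atTop.comp him)
    refine squeeze_zero' (Eventually.of_forall fun _ => norm_nonneg _)
      (hneg.mono fun z hz => ?_) e
    rw [norm_div, norm_one, one_div]
    have := Complex.abs_im_le_norm (z + c)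
    simp only [Complex.add_im, Complex.ofReal_im, add_zero] at this
    refine inv_anti₀ (abs_pos.2 (by linarith)) this
  have h2 := (h1.sub (hinv 0)).sub (hinv π)
  simp only [Complex.ofReal_zero, add_zero, sub_zero] at h2
  refine h2.congr' (hneg.mono fun z hz => ?_)
  rw [cotRem_eq (sin_ne_zero_of_im (by linarith))]

end CotRemainder

section RegKernel
open Metric Set Topology

/-- The regular part of `(π / s) cot (π y / s)`, with the poles at `0` and `-s` removed. -/
noncomputable def regK (s : ℝ) (y : ℂ) : ℂ := ((π / s : ℝ) : ℂ) * cotRem (((π / s : ℝ) : ℂ) * y)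

theorem re_real_mul (c : ℝ) (y : ℂ) : ((c : ℂ) * y).re = c * y.re := Complex.re_ofReal_mul c y

theorem exists_regK_bounds : ∃ R : ℝ, 0 < R ∧ ∀ s : ℝ, 2 ≤ s →
    (∀ y : ℂ, -(15 / 8 * s) ≤ y.re → y.re ≤ 7 / 8 * s → ‖regK s y‖ ≤ R) ∧
    (∀ y w : ℂ, -(7 / 4 * s) < y.re → y.re < 3 / 4 * s → -(7 / 4 * s) < w.re →
      w.re < 3 / 4 * s → ‖regK s y - regK s w‖ ≤ R * ‖y - w‖) := by
  obtain ⟨R₁, h1, b1⟩ := exists_norm_cotRem_le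
  obtain ⟨R₂, h2, b2⟩ := exists_lipschitz_cotRem
  have hpi := Real.pi_pos
  have hpi4 := Real.pi_le_four
  refine ⟨2 * R₁ + 4 * R₂, by positivity, fun s hs => ?_⟩
  have hs0 : 0 < s := by linarith
  have hc : π / s ≤ 2 := by rw [div_le_iff₀ hs0]; linarith
  have hc0 : 0 < π / s := by positivity
  have key : ∀ c x : ℝ, c * s < x ↔ c * π < π / s * x := by
    intro c x
    rw [div_mul_eq_mul_div, lt_div_iff₀ hs0]
    constructor <;> intro h <;> nlinarith
  have key2 : ∀ c x : ℝ, x < c * s ↔ π / s * x < c * π := by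
    intro c x
    rw [div_mul_eq_mul_div, div_lt_iff₀ hs0]
    constructor <;> intro h <;> nlinarith
  have key3 : ∀ c x : ℝ, c * s ≤ x ↔ c * π ≤ π / s * x := by
    intro c x
    rw [← not_lt, key2, not_lt]
  have key4 : ∀ c x : ℝ, x ≤ c * s ↔ π / s * x ≤ c * π := by
    intro c x
    rw [← not_lt, key, not_lt]
  have hn : ‖((π / s : ℝ) : ℂ)‖ = π / s := by
    rw [Complex.norm_real, Real.norm_eq_abs, abs_of_pos hc0]
  refine ⟨fun y l u => ?_, fun y w y1 y2 w1 w2 => ?_⟩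
  · rw [regK, norm_mul, hn]
    rw [← neg_mul, key3] at l
    rw [key4] at u
    have := b1 (((π / s : ℝ) : ℂ) * y) (by rw [re_real_mul]; linarith)
      (by rw [re_real_mul]; linarith)
    calc π / s * ‖cotRem (((π / s : ℝ) : ℂ) * y)‖ ≤ 2 * R₁ := by gcongr
      _ ≤ _ := by linarith
  · rw [regK, regK, ← mul_sub, norm_mul, hn]
    rw [← neg_mul, key] at y1 w1
    rw [key2] at y2 w2
    have := b2 (((π / s : ℝ) : ℂ) * y) (((π / s : ℝ) : ℂ) * w)
      (by rw [re_real_mul]; linarith) (by rw [re_real_mul]; linarith)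
      (by rw [re_real_mul]; linarith) (by rw [re_real_mul]; linarith)
    rw [← mul_sub, norm_mul, hn] at this
    calc π / s * ‖_‖ ≤ 2 * (R₂ * (2 * ‖y - w‖)) := by
          refine mul_le_mul hc (this.trans ?_) (norm_nonneg _) (by norm_num)
          gcongr
      _ ≤ _ := by nlinarith [norm_nonneg (y - w)]

theorem differentiableOn_regK {s : ℝ} (hs : 0 < s) :
    DifferentiableOn ℂ (regK s) {y | -(2 * s) < y.re ∧ y.re < s} := by
  have hpi := Real.pi_pos
  refine DifferentiableOn.const_mul ?_ _
  refine differentiableOn_cotRem.comp (by fun_prop) fun y hy => ?_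
  simp only [mem_ofPred_eq] at hy ⊢
  rw [re_real_mul, div_mul_eq_mul_div, lt_div_iff₀ hs, div_lt_iff₀ hs]
  exact ⟨by nlinarith [hy.1], by nlinarith [hy.2]⟩

theorem regK_sub {s : ℝ} (hs : 0 < s) {y : ℂ} (h1 : -s < y.re) (h2 : y.re < 0) :
    regK s (y - s) + 1 / (y - s) = regK s y + 1 / (y + s) := by
  have hpi := Real.pi_pos
  have hpc : (π : ℂ) ≠ 0 := by exact_mod_cast hpi.ne'
  have hsc : (s : ℂ) ≠ 0 := by exact_mod_cast hs.ne'
  set v : ℂ := ((π / s : ℝ) : ℂ) * y with hv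
  have hvre : v.re = π / s * y.re := re_real_mul _ _
  have hlt : v.re < 0 := by
    rw [hvre]; exact mul_neg_of_pos_of_neg (by positivity) h2
  have hgt : -π < v.re := by
    rw [hvre, div_mul_eq_mul_div, lt_div_iff₀ hs]; nlinarith
  have hsin : Complex.sin v ≠ 0 := by
    intro hs0
    obtain ⟨k, hk⟩ := Complex.sin_eq_zero_iff.1 hs0
    have hre : v.re = k * π := by
      rw [hk, ← Complex.ofReal_intCast, ← Complex.ofReal_mul, Complex.ofReal_re]
    rw [hre] at hlt hgt
    have k1 : (k : ℝ) < 0 := by nlinarith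
    have k2 : (-1 : ℝ) < k := by nlinarith
    have k1' : k < 0 := by exact_mod_cast k1
    have k2' : -1 < k := by exact_mod_cast k2
    omega
  have e1 : ((π / s : ℝ) : ℂ) * (y - s) = v - π := by
    rw [hv]; push_cast; field_simp
  have hy0 : y ≠ 0 := by rintro rfl; simp at h2
  have hy1 : y + s ≠ 0 := by
    intro h; have := congrArg Complex.re h; simp at this; linarith
  have hy2 : y - s ≠ 0 := by
    intro h; have := congrArg Complex.re h; simp at this; linarith
  have hsin2 : Complex.sin (v - π) ≠ 0 := by
    rw [Complex.sin_sub_pi]; exact neg_ne_zero.2 hsin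
  have hcot : Complex.cot (v - π) = Complex.cot v := by
    rw [Complex.cot_eq_cos_div_sin, Complex.cot_eq_cos_div_sin, Complex.sin_sub_pi,
      Complex.cos_sub_pi, neg_div_neg_eq]
  rw [regK, regK, e1, ← hv, cotRem_eq hsin, cotRem_eq hsin2, hcot, sub_add_cancel]
  have f1 : v = π * y / s := by rw [hv]; push_cast; ring
  have f2 : v - π = π * (y - s) / s := by rw [f1]; field_simp
  have f3 : v + π = π * (y + s) / s := by rw [f1]; field_simp
  rw [f2, f3]
  push_cast
  field_simp
  ring

theorem tendsto_regK {s : ℝ} (hs : 0 < s) :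
    Tendsto (regK s) (comap Complex.im atBot) (𝓝 (((π / s : ℝ) : ℂ) * Complex.I)) := by
  refine Tendsto.const_mul _ (tendsto_cotRem.comp ?_)
  rw [tendsto_comap_iff]
  have : (Complex.im ∘ fun y : ℂ => ((π / s : ℝ) : ℂ) * y) = fun y => π / s * y.im := by
    ext y; simp
  rw [this]
  exact tendsto_comap.const_mul_atBot (by have := Real.pi_pos; positivity)

end RegKernel

section HalfBand
open Metric Set Topology MeasureTheory

theorem rect_integral_inv {a b c d : ℝ} {Y : ℂ} (ha : a < Y.re) (hb : Y.re < b) (hc : c < Y.im)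
    (hd : Y.im < d) :
    (∫ x in a..b, 1 / ((x : ℂ) + c * Complex.I - Y)) - (∫ x in a..b, 1 / (x + d * Complex.I - Y))
      + Complex.I * (∫ t in c..d, 1 / (b + t * Complex.I - Y))
      - Complex.I * (∫ t in c..d, 1 / (a + t * Complex.I - Y)) = 2 * π * Complex.I := by
  have hab : a ≤ b := by linarith
  have hcd : c ≤ d := by linarith
  have dh : ∀ (e : ℝ) (x : ℝ), HasDerivAt (fun x : ℝ => (x : ℂ) + e * Complex.I - Y) 1 x :=
    fun e x => ((Complex.ofRealCLM.hasDerivAt).add_const _).sub_const _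
  have dv : ∀ (e : ℝ) (t : ℝ), HasDerivAt (fun t : ℝ => (e : ℂ) + t * Complex.I - Y)
      Complex.I t := fun e t => by
    have := (((Complex.ofRealCLM.hasDerivAt (x := t)).mul_const Complex.I).const_add
      (e : ℂ)).sub_const Y
    simpa using this
  have ne : ∀ z : ℂ, z ∈ Complex.slitPlane → z ≠ 0 := fun z hz => Complex.slitPlane_ne_zero hz
  have H : ∀ e : ℝ, e ≠ Y.im → ∫ x in a..b, 1 / ((x : ℂ) + e * Complex.I - Y) =
      Complex.log (b + e * Complex.I - Y) - Complex.log (a + e * Complex.I - Y) := by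
    intro e he
    have hs : ∀ x : ℝ, (x : ℂ) + e * Complex.I - Y ∈ Complex.slitPlane := fun x => by
      right; simpa [sub_eq_zero] using he
    refine intervalIntegral.integral_eq_sub_of_hasDerivAt
      (f := fun x : ℝ => Complex.log (x + e * Complex.I - Y))
      (fun x _ => (dh e x).clog_real (hs x)) ?_
    refine ContinuousOn.intervalIntegrable fun x _ => ?_
    refine ContinuousAt.continuousWithinAt ?_
    exact continuousAt_const.div (dh e x).continuousAt (ne _ (hs x))
  have V1 : ∫ t in c..d, 1 / ((b : ℂ) + t * Complex.I - Y) =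
      (Complex.log (b + d * Complex.I - Y) - Complex.log (b + c * Complex.I - Y))
        / Complex.I := by
    have hs : ∀ t : ℝ, (b : ℂ) + t * Complex.I - Y ∈ Complex.slitPlane := fun x => by
      left; simpa [sub_eq_zero] using hb
    rw [eq_div_iff Complex.I_ne_zero, ← intervalIntegral.integral_mul_const]
    refine intervalIntegral.integral_eq_sub_of_hasDerivAt
      (f := fun t : ℝ => Complex.log (b + t * Complex.I - Y))
      (fun x _ => ?_) ?_
    · have := (dv b x).clog_real (hs x)
      rwa [div_eq_mul_one_div, mul_comm] at this
    · refine ContinuousOn.intervalIntegrable fun x _ => ?_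
      refine ContinuousAt.continuousWithinAt ?_
      exact (continuousAt_const.div (dv b x).continuousAt (ne _ (hs x))).mul continuousAt_const
  have V2 : ∫ t in c..d, 1 / ((a : ℂ) + t * Complex.I - Y) =
      (Complex.log (-(a + d * Complex.I - Y)) - Complex.log (-(a + c * Complex.I - Y)))
        / Complex.I := by
    have hs : ∀ t : ℝ, -((a : ℂ) + t * Complex.I - Y) ∈ Complex.slitPlane := fun x => by
      left; simpa [sub_eq_zero] using ha
    have hn : ∀ t : ℝ, (a : ℂ) + t * Complex.I - Y ≠ 0 := fun t => neg_ne_zero.1 (ne _ (hs t))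
    rw [eq_div_iff Complex.I_ne_zero, ← intervalIntegral.integral_mul_const]
    refine intervalIntegral.integral_eq_sub_of_hasDerivAt
      (f := fun t : ℝ => Complex.log (-(a + t * Complex.I - Y)))
      (fun x _ => ?_) ?_
    · have := (dv a x).neg.clog_real (hs x)
      have e : -Complex.I / -((a : ℂ) + x * Complex.I - Y) =
        1 / ((a : ℂ) + x * Complex.I - Y) * Complex.I := by rw [neg_div_neg_eq]; ring
      exact e ▸ this
    · refine ContinuousOn.intervalIntegrable fun x _ => ?_
      refine ContinuousAt.continuousWithinAt ?_
      exact (continuousAt_const.div (dv a x).continuousAt (hn x)).mul continuousAt_const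
  have n1 : Complex.log (-((a : ℂ) + d * Complex.I - Y)) =
      Complex.log (a + d * Complex.I - Y) - π * Complex.I := by
    apply Complex.ext
    · rw [Complex.log_re, norm_neg, Complex.sub_re, Complex.log_re]
      simp
    · rw [Complex.log_im, Complex.arg_neg_eq_arg_sub_pi_of_im_pos (by simpa using hd)]
      simp [Complex.log_im]
  have n2 : Complex.log (-((a : ℂ) + c * Complex.I - Y)) =
      Complex.log (a + c * Complex.I - Y) + π * Complex.I := by
    apply Complex.ext
    · rw [Complex.log_re, norm_neg, Complex.add_re, Complex.log_re]
      simp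
    · rw [Complex.log_im, Complex.arg_neg_eq_arg_add_pi_of_im_neg (by simpa using hc)]
      simp [Complex.log_im]
  rw [H c hc.ne, H d hd.ne', V1, V2, n1, n2, mul_div_cancel₀ _ Complex.I_ne_zero,
    mul_div_cancel₀ _ Complex.I_ne_zero]
  ring

theorem rect_cauchy {a b c d : ℝ} {F G : ℂ → ℂ} {A Y : ℂ} (ha : a < Y.re) (hb : Y.re < b)
    (hc : c < Y.im) (hd : Y.im < d)
    (hG : DifferentiableOn ℂ G {z | (a ≤ z.re ∧ z.re ≤ b) ∧ c ≤ z.im})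
    (hF : ∀ z : ℂ, (a ≤ z.re ∧ z.re ≤ b) ∧ c ≤ z.im → z ≠ Y → F z = G z + A * (1 / (z - Y))) :
    (∫ x in a..b, F ((x : ℂ) + c * Complex.I)) - (∫ x in a..b, F (x + d * Complex.I))
      + Complex.I * (∫ t in c..d, F (b + t * Complex.I))
      - Complex.I * (∫ t in c..d, F (a + t * Complex.I)) = 2 * π * Complex.I * A := by
  have hab : a ≤ b := by linarith
  have hcd : c ≤ d := by linarith
  have hGc := hG.continuousOn
  have main := Complex.integral_boundary_rect_eq_zero_of_differentiableOn G
    (a + c * Complex.I) (b + d * Complex.I) (hG.mono fun z hz => by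
      rw [Complex.mem_reProdIm] at hz
      simp only [Complex.add_re, Complex.ofReal_re, Complex.mul_re, Complex.I_re, mul_zero,
        Complex.ofReal_im, Complex.I_im, mul_one, sub_self, add_zero, uIcc_of_le hab,
        Complex.add_im, Complex.mul_im, zero_add, uIcc_of_le hcd] at hz
      exact ⟨hz.1, hz.2.1⟩)
  simp only [Complex.add_re, Complex.ofReal_re, Complex.mul_re, Complex.I_re, mul_zero,
        Complex.ofReal_im, Complex.I_im, mul_one, sub_self, add_zero,
        Complex.add_im, Complex.mul_im, zero_add, smul_eq_mul] at main
  have inv := rect_integral_inv ha hb hc hd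
  have ch : ∀ e : ℝ, c ≤ e → e ≠ Y.im → (∫ x in a..b, F ((x : ℂ) + e * Complex.I)) =
      (∫ x in a..b, G ((x : ℂ) + e * Complex.I))
        + A * ∫ x in a..b, 1 / ((x : ℂ) + e * Complex.I - Y) := by
    intro e he he'
    have hne : ∀ x : ℝ, (x : ℂ) + e * Complex.I ≠ Y := by
      rintro x rfl; simp at he'
    rw [← intervalIntegral.integral_const_mul, ← intervalIntegral.integral_add]
    · refine intervalIntegral.integral_congr fun x hx => ?_
      rw [uIcc_of_le hab] at hx
      exact hF _ (by simpa using ⟨hx, he⟩) (hne x)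
    · refine ContinuousOn.intervalIntegrable ?_
      refine hGc.comp (by fun_prop) fun x hx => ?_
      rw [uIcc_of_le hab] at hx
      simpa using ⟨hx, he⟩
    · refine Continuous.intervalIntegrable ?_ _ _
      exact continuous_const.mul (continuous_const.div (by fun_prop)
        fun x => sub_ne_zero.2 (hne x))
  have cv : ∀ e : ℝ, (a ≤ e ∧ e ≤ b) → e ≠ Y.re → (∫ t in c..d, F ((e : ℂ) + t * Complex.I)) =
      (∫ t in c..d, G ((e : ℂ) + t * Complex.I))
        + A * ∫ t in c..d, 1 / ((e : ℂ) + t * Complex.I - Y) := by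
    intro e he he'
    have hne : ∀ x : ℝ, (e : ℂ) + x * Complex.I ≠ Y := by
      rintro x rfl; simp at he'
    rw [← intervalIntegral.integral_const_mul, ← intervalIntegral.integral_add]
    · refine intervalIntegral.integral_congr fun x hx => ?_
      rw [uIcc_of_le hcd] at hx
      exact hF _ (by simpa using ⟨he, hx.1⟩) (hne x)
    · refine ContinuousOn.intervalIntegrable ?_
      refine hGc.comp (by fun_prop) fun x hx => ?_
      rw [uIcc_of_le hcd] at hx
      simpa using ⟨he, hx.1⟩
    · refine Continuous.intervalIntegrable ?_ _ _
      exact continuous_const.mul (continuous_const.div (by fun_prop)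
        fun x => sub_ne_zero.2 (hne x))
  rw [ch c le_rfl hc.ne, ch d hcd hd.ne', cv b ⟨hab, le_rfl⟩ hb.ne', cv a ⟨le_rfl, hab⟩ ha.ne]
  linear_combination main + A * inv

theorem halfBand_cauchy {a b c : ℝ} {F G : ℂ → ℂ} {A Y : ℂ} {C : ℝ} (ha : a < Y.re)
    (hb : Y.re < b) (hc : c < Y.im)
    (hG : DifferentiableOn ℂ G {z | (a ≤ z.re ∧ z.re ≤ b) ∧ c ≤ z.im})
    (hF : ∀ z : ℂ, (a ≤ z.re ∧ z.re ≤ b) ∧ c ≤ z.im → z ≠ Y → F z = G z + A * (1 / (z - Y)))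
    (hlim : ∀ᶠ d : ℝ in atTop, ∀ x : ℝ, a ≤ x → x ≤ b → ‖F (x + d * Complex.I)‖ ≤ C / d)
    (hib : IntegrableOn (fun t : ℝ => F (b + t * Complex.I)) (Ioi c))
    (hia : IntegrableOn (fun t : ℝ => F (a + t * Complex.I)) (Ioi c)) :
    (∫ x in a..b, F ((x : ℂ) + c * Complex.I))
      + Complex.I * (∫ t in Ioi c, F (b + t * Complex.I))
      - Complex.I * (∫ t in Ioi c, F (a + t * Complex.I)) = 2 * π * Complex.I * A := by
  have hab : a ≤ b := by linarith
  have t1 := intervalIntegral_tendsto_integral_Ioi c hib tendsto_id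
  have t2 := intervalIntegral_tendsto_integral_Ioi c hia tendsto_id
  have t3 : Tendsto (fun d : ℝ => ∫ x in a..b, F ((x : ℂ) + d * Complex.I)) atTop (𝓝 0) := by
    rw [tendsto_zero_iff_norm_tendsto_zero]
    have e : Tendsto (fun d : ℝ => C / d * |b - a|) atTop (𝓝 0) := by
      simpa using (tendsto_const_nhds.div_atTop tendsto_id : Tendsto (fun d : ℝ => C / d)
        atTop (𝓝 0)).mul_const |b - a|
    refine squeeze_zero' (Eventually.of_forall fun _ => norm_nonneg _) (hlim.mono fun d hd => ?_) e
    refine intervalIntegral.norm_integral_le_of_norm_le_const fun x hx => ?_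
    rw [uIoc_of_le hab] at hx
    exact hd x hx.1.le hx.2
  have t4 := ((tendsto_const_nhds (x := ∫ x in a..b, F ((x : ℂ) + c * Complex.I))).sub t3).add
    (t1.const_mul Complex.I) |>.sub (t2.const_mul Complex.I)
  rw [sub_zero] at t4
  refine tendsto_nhds_unique t4 (tendsto_const_nhds.congr' ?_)
  filter_upwards [eventually_gt_atTop Y.im] with d hd
  exact (rect_cauchy ha hb hc hd hG hF).symm

end HalfBand

section Contours
open Metric Set Topology MeasureTheory

/-- A weighted contour `t ↦ γ t` with weight `ω`, supported in `S`, of quadratic growth. -/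
structure IsContour (γ ω : ℝ → ℂ) (S : Set ℂ) : Prop where
  meas_path : Measurable γ
  meas_weight : Measurable ω
  norm_weight_le : ∀ t, ‖ω t‖ ≤ 1
  mem : ∀ t, ω t ≠ 0 → γ t ∈ S
  growth : ∀ t, ω t ≠ 0 → 4 / 5 * (1 + t ^ 2) ≤ ‖γ t‖ ^ 2
  finite : ∀ Y, {t | ω t ≠ 0 ∧ γ t = Y}.Finite

/-- The left vertical line. -/
noncomputable def gamM (t : ℝ) : ℂ := ((-1 / 4 : ℝ) : ℂ) + t * Complex.I

/-- The weight on the left vertical line. -/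
noncomputable def omM (t : ℝ) : ℂ := if 2 < |t| then Complex.I else 0

/-- The right vertical line, together with the two horizontal segments. -/
noncomputable def gamP (t : ℝ) : ℂ :=
  if 2 < |t| then ((5 / 4 : ℝ) : ℂ) + t * Complex.I
  else if 0 < t then ((t - 3 / 4 : ℝ) : ℂ) + (2 : ℝ) * Complex.I
  else ((-3 / 4 - t : ℝ) : ℂ) + (-2 : ℝ) * Complex.I

/-- The weight on the right contour. -/
noncomputable def omP (t : ℝ) : ℂ :=
  if 2 < |t| then Complex.I
  else if 1 / 2 < t then 1
  else if t < -1 / 2 then -1 else 0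

def suppM : Set ℂ := {z | z.re = -1 / 4 ∧ 2 < |z.im|}

def suppP : Set ℂ := {z | -1 / 4 ≤ z.re ∧ z.re ≤ 5 / 4 ∧ 2 ≤ |z.im| ∧ (z.re = 5 / 4 ∨ |z.im| = 2)}

theorem measurableSet_two_lt_abs : MeasurableSet {t : ℝ | 2 < |t|} :=
  (isOpen_lt continuous_const continuous_abs).measurableSet

theorem norm_sq_eq (z : ℂ) : ‖z‖ ^ 2 = z.re ^ 2 + z.im ^ 2 := by
  rw [Complex.sq_norm, Complex.normSq_apply]; ring

theorem four_le_sq_of_two_lt_abs {t : ℝ} (h : 2 < |t|) : 4 ≤ t ^ 2 := by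
  rw [← sq_abs]; nlinarith

theorem isContour_M : IsContour gamM omM suppM where
  meas_path := by unfold gamM; fun_prop
  meas_weight := Measurable.ite measurableSet_two_lt_abs measurable_const measurable_const
  norm_weight_le t := by unfold omM; split_ifs <;> simp
  mem t ht := by
    have h : 2 < |t| := by by_contra h; exact ht (by simp [omM, h])
    exact ⟨by simp [gamM], by simpa [gamM] using h⟩
  growth t ht := by
    have h : 2 < |t| := by by_contra h; exact ht (by simp [omM, h])
    have h4 := four_le_sq_of_two_lt_abs h
    rw [norm_sq_eq]
    simp only [gamM, Complex.add_re, Complex.ofReal_re, Complex.mul_re, Complex.I_re, mul_zero,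
      Complex.ofReal_im, Complex.I_im, mul_one, sub_self, add_zero, Complex.add_im,
      Complex.mul_im, zero_add]
    nlinarith
  finite Y := by
    refine (finite_singleton Y.im).subset fun t ht => ?_
    have := congrArg Complex.im ht.2
    simpa [gamM] using this

theorem isContour_P : IsContour gamP omP suppP where
  meas_path := by
    unfold gamP
    refine Measurable.ite measurableSet_two_lt_abs (by fun_prop)
      (Measurable.ite measurableSet_Ioi (by fun_prop) (by fun_prop))
  meas_weight := by
    unfold omP
    refine Measurable.ite measurableSet_two_lt_abs measurable_const
      (Measurable.ite measurableSet_Ioi measurable_const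
        (Measurable.ite measurableSet_Iio measurable_const measurable_const))
  norm_weight_le t := by unfold omP; split_ifs <;> simp
  mem t ht := by
    by_cases h : 2 < |t|
    · refine ⟨?_, ?_, ?_, Or.inl ?_⟩ <;> simp [gamP, h] <;> norm_num
      exact h.le
    · have h' := h
      rw [not_lt, abs_le] at h'
      by_cases h0 : 0 < t
      · have h1 : 1 / 2 < t := by
          by_contra h1
          refine ht ?_
          rw [omP, if_neg h, if_neg h1, if_neg (by linarith)]
        refine ⟨?_, ?_, ?_, Or.inr ?_⟩ <;> simp [gamP, h, h0] <;> linarith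
      · have h1 : t < -1 / 2 := by
          by_contra h1
          refine ht ?_
          rw [omP, if_neg h, if_neg (by linarith), if_neg h1]
        refine ⟨?_, ?_, ?_, Or.inr ?_⟩ <;> simp [gamP, h, h0] <;> linarith
  growth t ht := by
    by_cases h : 2 < |t|
    · have h4 := four_le_sq_of_two_lt_abs h
      rw [norm_sq_eq]
      simp only [gamP, h, if_true, Complex.add_re, Complex.ofReal_re, Complex.mul_re,
        Complex.I_re, mul_zero, Complex.ofReal_im, Complex.I_im, mul_one, sub_self, add_zero,
        Complex.add_im, Complex.mul_im, zero_add]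
      nlinarith
    · have h' := h
      rw [not_lt, abs_le] at h'
      have h4 : t ^ 2 ≤ 4 := by nlinarith
      have h5 : (gamP t).im ^ 2 = 4 := by
        by_cases h0 : 0 < t <;> simp [gamP, h, h0] <;> norm_num
      rw [norm_sq_eq, h5]
      nlinarith [sq_nonneg (gamP t).re]
  finite Y := by
    refine (Set.toFinite {Y.im, Y.re + 3 / 4, -3 / 4 - Y.re}).subset fun t ht => ?_
    rw [mem_insert_iff, mem_insert_iff, mem_singleton_iff]
    obtain ⟨-, rfl⟩ := ht
    by_cases h : 2 < |t|
    · left; simp [gamP, h]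
    · by_cases h0 : 0 < t
      · right; left; simp [gamP, h, h0]
      · right; right; simp [gamP, h, h0]

theorem measurable_indicator_of_continuousOn {V : Set ℂ} (hV : IsOpen V) {F : ℂ → ℂ}
    (hF : ContinuousOn F V) : Measurable (V.indicator F) := by
  classical
  rw [← Set.piecewise_eq_indicator]
  exact hF.measurable_piecewise continuousOn_const hV.measurableSet

namespace IsContour

variable {γ ω : ℝ → ℂ} {S : Set ℂ}

theorem ae_ne (h : IsContour γ ω S) (Y : ℂ) : ∀ᵐ t, ω t ≠ 0 → γ t ≠ Y := by
  filter_upwards [(h.finite Y).countable.ae_notMem volume] with t ht h1 h2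
  exact ht ⟨h1, h2⟩

theorem aestronglyMeasurable (h : IsContour γ ω S) {V : Set ℂ} (hV : IsOpen V) {F : ℂ → ℂ} {Y : ℂ}
    (hF : ContinuousOn F V) (hm : ∀ z ∈ S, z ≠ Y → z ∈ V) :
    AEStronglyMeasurable (fun t => ω t * F (γ t)) := by
  have h1 : Measurable fun t => ω t * V.indicator F (γ t) :=
    h.meas_weight.mul ((measurable_indicator_of_continuousOn hV hF).comp h.meas_path)
  refine h1.aestronglyMeasurable.congr ?_
  filter_upwards [h.ae_ne Y] with t ht
  by_cases h0 : ω t = 0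
  · simp [h0]
  · rw [indicator_of_mem (hm _ (h.mem t h0) (ht h0))]

theorem bound_pointwise (h : IsContour γ ω S) {F : ℂ → ℂ} {b : ℝ} {t : ℝ} (hb : 0 ≤ b)
    (hF : ω t ≠ 0 → ‖F (γ t)‖ ≤ b / ‖γ t‖ ^ 2) :
    ‖ω t * F (γ t)‖ ≤ 5 / 4 * b * (1 + t ^ 2)⁻¹ := by
  by_cases h0 : ω t = 0
  · rw [h0, zero_mul, norm_zero]; positivity
  · rw [norm_mul]
    have h1 := h.growth t h0
    have h2 : (0 : ℝ) < 1 + t ^ 2 := by positivity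
    calc ‖ω t‖ * ‖F (γ t)‖ ≤ 1 * (b / ‖γ t‖ ^ 2) :=
          mul_le_mul (h.norm_weight_le t) (hF h0) (norm_nonneg _) zero_le_one
      _ ≤ 1 * (b / (4 / 5 * (1 + t ^ 2))) := by gcongr
      _ = _ := by field_simp

theorem integrable_bound (b : ℝ) : Integrable fun t : ℝ => 5 / 4 * b * (1 + t ^ 2)⁻¹ :=
  integrable_inv_one_add_sq.const_mul _

theorem integrable (h : IsContour γ ω S) {V : Set ℂ} (hV : IsOpen V) {F : ℂ → ℂ} {Y : ℂ} {b : ℝ}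
    (hF : ContinuousOn F V) (hm : ∀ z ∈ S, z ≠ Y → z ∈ V) (hb : 0 ≤ b)
    (hbd : ∀ z ∈ S, z ≠ Y → ‖F z‖ ≤ b / ‖z‖ ^ 2) :
    Integrable fun t => ω t * F (γ t) := by
  refine (integrable_bound b).mono' (h.aestronglyMeasurable hV hF hm) ?_
  filter_upwards [h.ae_ne Y] with t ht
  exact h.bound_pointwise hb fun h0 => hbd _ (h.mem t h0) (ht h0)

theorem norm_integral_le (h : IsContour γ ω S) {F : ℂ → ℂ} {Y : ℂ} {b : ℝ} (hb : 0 ≤ b)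
    (hbd : ∀ z ∈ S, z ≠ Y → ‖F z‖ ≤ b / ‖z‖ ^ 2) :
    ‖∫ t, ω t * F (γ t)‖ ≤ 4 * b := by
  have h1 : ‖∫ t, ω t * F (γ t)‖ ≤ ∫ t : ℝ, 5 / 4 * b * (1 + t ^ 2)⁻¹ := by
    refine norm_integral_le_of_norm_le (integrable_bound b) ?_
    filter_upwards [h.ae_ne Y] with t ht
    exact h.bound_pointwise hb fun h0 => hbd _ (h.mem t h0) (ht h0)
  rw [integral_const_mul, integral_univ_inv_one_add_sq] at h1
  nlinarith [Real.pi_lt_d2]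

end IsContour

theorem integral_gamM {F : ℂ → ℂ} (hi : Integrable fun t => omM t * F (gamM t)) :
    IntegrableOn (fun t : ℝ => F (((-1 / 4 : ℝ) : ℂ) + t * Complex.I)) (Ioi 2) ∧
    IntegrableOn (fun t : ℝ => F (((-1 / 4 : ℝ) : ℂ) + t * Complex.I)) (Iio (-2)) ∧
    ∫ t, omM t * F (gamM t) =
      Complex.I * (∫ t in Ioi (2 : ℝ), F (((-1 / 4 : ℝ) : ℂ) + t * Complex.I))
      + Complex.I * (∫ t in Iio (-2 : ℝ), F (((-1 / 4 : ℝ) : ℂ) + t * Complex.I)) := by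
  set f := fun t : ℝ => F (((-1 / 4 : ℝ) : ℂ) + t * Complex.I) with hf
  have e1 : EqOn (fun t => omM t * F (gamM t)) (fun t => Complex.I * f t) (Ioi 2) := by
    intro t ht
    have : 2 < |t| := lt_of_lt_of_le ht (le_abs_self t)
    simp [omM, gamM, this, hf]
  have e2 : EqOn (fun t => omM t * F (gamM t)) (fun t => Complex.I * f t) (Iio (-2)) := by
    intro t ht
    have : 2 < |t| := lt_of_lt_of_le (lt_neg_of_lt_neg ht) (neg_le_abs t)
    simp [omM, gamM, this, hf]
  have cancel : ∀ s : Set ℝ, IntegrableOn (fun t => Complex.I * f t) s → IntegrableOn f s := by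
    intro s hs
    have := hs.const_mul (-Complex.I)
    refine this.congr (Eventually.of_forall fun t => ?_)
    simp only
    rw [← mul_assoc, neg_mul, Complex.I_mul_I, neg_neg, one_mul]
  refine ⟨cancel _ (hi.integrableOn.congr_fun e1 measurableSet_Ioi),
    cancel _ (hi.integrableOn.congr_fun e2 measurableSet_Iio), ?_⟩
  have hz : ∀ t, t ∉ Ioi (2 : ℝ) ∪ Iio (-2) → omM t * F (gamM t) = 0 := by
    intro t ht
    have : ¬ 2 < |t| := by
      rw [lt_abs]
      rintro (h | h)
      · exact ht (Or.inl h)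
      · exact ht (Or.inr (by rw [mem_Iio]; linarith))
    simp [omM, this]
  rw [← setIntegral_eq_integral_of_forall_compl_eq_zero (s := Ioi (2 : ℝ) ∪ Iio (-2)) hz,
    setIntegral_union ?_ measurableSet_Iio hi.integrableOn hi.integrableOn,
    setIntegral_congr_fun measurableSet_Ioi e1, setIntegral_congr_fun measurableSet_Iio e2,
    integral_const_mul, integral_const_mul]
  rw [disjoint_left]
  intro t h1 h2
  rw [mem_Ioi] at h1; rw [mem_Iio] at h2; linarith

theorem integral_gamP {F : ℂ → ℂ} (hi : Integrable fun t => omP t * F (gamP t)) :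
    IntegrableOn (fun t : ℝ => F (((5 / 4 : ℝ) : ℂ) + t * Complex.I)) (Ioi 2) ∧
    IntegrableOn (fun t : ℝ => F (((5 / 4 : ℝ) : ℂ) + t * Complex.I)) (Iio (-2)) ∧
    ∫ t, omP t * F (gamP t) =
      Complex.I * (∫ t in Ioi (2 : ℝ), F (((5 / 4 : ℝ) : ℂ) + t * Complex.I))
      + Complex.I * (∫ t in Iio (-2 : ℝ), F (((5 / 4 : ℝ) : ℂ) + t * Complex.I))
      + (∫ x in (-1 / 4 : ℝ)..(5 / 4), F ((x : ℂ) + (2 : ℝ) * Complex.I))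
      - ∫ x in (-1 / 4 : ℝ)..(5 / 4), F ((x : ℂ) + (-2 : ℝ) * Complex.I) := by
  set f := fun t : ℝ => F (((5 / 4 : ℝ) : ℂ) + t * Complex.I) with hf
  have e1 : EqOn (fun t => omP t * F (gamP t)) (fun t => Complex.I * f t) (Ioi 2) := by
    intro t ht
    have : 2 < |t| := lt_of_lt_of_le ht (le_abs_self t)
    simp [omP, gamP, this, hf]
  have e2 : EqOn (fun t => omP t * F (gamP t)) (fun t => Complex.I * f t) (Iio (-2)) := by
    intro t ht
    have : 2 < |t| := lt_of_lt_of_le (lt_neg_of_lt_neg ht) (neg_le_abs t)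
    simp [omP, gamP, this, hf]
  have e3 : EqOn (fun t => omP t * F (gamP t))
      (fun t => F (((t - 3 / 4 : ℝ) : ℂ) + (2 : ℝ) * Complex.I)) (Ioc (1 / 2) 2) := by
    intro t ht
    have h1 : ¬ 2 < |t| := by rw [not_lt, abs_le]; exact ⟨by linarith [ht.1], ht.2⟩
    have h2 : 0 < t := by linarith [ht.1]
    simp only [omP, gamP, if_neg h1, if_pos ht.1, if_pos h2, one_mul]
  have e4 : EqOn (fun t => omP t * F (gamP t))
      (fun t => -F (((-3 / 4 - t : ℝ) : ℂ) + (-2 : ℝ) * Complex.I)) (Ico (-2) (-1 / 2)) := by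
    intro t ht
    have h1 : ¬ 2 < |t| := by rw [not_lt, abs_le]; exact ⟨ht.1, by linarith [ht.2]⟩
    have h2 : ¬ 0 < t := by linarith [ht.2]
    have h3 : ¬ 1 / 2 < t := by linarith [ht.2]
    simp only [omP, gamP, if_neg h1, if_pos ht.2, if_neg h2, if_neg h3, neg_mul, one_mul]
  have cancel : ∀ s : Set ℝ, IntegrableOn (fun t => Complex.I * f t) s → IntegrableOn f s := by
    intro s hs
    have := hs.const_mul (-Complex.I)
    refine this.congr (Eventually.of_forall fun t => ?_)
    simp only
    rw [← mul_assoc, neg_mul, Complex.I_mul_I, neg_neg, one_mul]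
  refine ⟨cancel _ (hi.integrableOn.congr_fun e1 measurableSet_Ioi),
    cancel _ (hi.integrableOn.congr_fun e2 measurableSet_Iio), ?_⟩
  have hz : ∀ t, t ∉ ((Ioi (2 : ℝ) ∪ Iio (-2)) ∪ Ioc (1 / 2) 2) ∪ Ico (-2) (-1 / 2) →
      omP t * F (gamP t) = 0 := by
    intro t ht
    simp only [mem_union, not_or, mem_Ioi, mem_Iio, mem_Ioc, mem_Ico, not_lt, not_and, not_le] at ht
    obtain ⟨⟨⟨h1, h2⟩, h3⟩, h4⟩ := ht
    have a1 : ¬ 2 < |t| := by rw [not_lt, abs_le]; exact ⟨h2, h1⟩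
    have a2 : ¬ 1 / 2 < t := fun h => by linarith [h3 h]
    have a3 : ¬ t < -1 / 2 := by linarith [h4 h2]
    simp only [omP, if_neg a1, if_neg a2, if_neg a3, zero_mul]
  have i3 : ∫ t in Ioc (1 / 2 : ℝ) 2, F (((t - 3 / 4 : ℝ) : ℂ) + (2 : ℝ) * Complex.I) =
      ∫ x in (-1 / 4 : ℝ)..(5 / 4), F ((x : ℂ) + (2 : ℝ) * Complex.I) := by
    rw [← intervalIntegral.integral_of_le (by norm_num),
      intervalIntegral.integral_comp_sub_right
        (fun x : ℝ => F ((x : ℂ) + (2 : ℝ) * Complex.I)) (3 / 4)]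
    norm_num
  have i4 : ∫ t in Ico (-2 : ℝ) (-1 / 2), -F (((-3 / 4 - t : ℝ) : ℂ) + (-2 : ℝ) * Complex.I) =
      -∫ x in (-1 / 4 : ℝ)..(5 / 4), F ((x : ℂ) + (-2 : ℝ) * Complex.I) := by
    rw [integral_neg, integral_Ico_eq_integral_Ioc,
      ← intervalIntegral.integral_of_le (by norm_num),
      intervalIntegral.integral_comp_sub_left
        (fun x : ℝ => F ((x : ℂ) + (-2 : ℝ) * Complex.I)) (-3 / 4)]
    norm_num
  rw [← setIntegral_eq_integral_of_forall_compl_eq_zero hz,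
    setIntegral_union ?_ measurableSet_Ico hi.integrableOn hi.integrableOn,
    setIntegral_union ?_ measurableSet_Ioc hi.integrableOn hi.integrableOn,
    setIntegral_union ?_ measurableSet_Iio hi.integrableOn hi.integrableOn,
    setIntegral_congr_fun measurableSet_Ioi e1, setIntegral_congr_fun measurableSet_Iio e2,
    setIntegral_congr_fun measurableSet_Ioc e3, setIntegral_congr_fun measurableSet_Ico e4,
    integral_const_mul, integral_const_mul, i3, i4]
  · ring
  · rw [disjoint_left]
    intro t h1 h2
    rw [mem_Ioi] at h1; rw [mem_Iio] at h2; linarith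
  · rw [disjoint_left]
    rintro t (h1 | h1) h2
    · rw [mem_Ioi] at h1; linarith [h2.2]
    · rw [mem_Iio] at h1; linarith [h2.1]
  · rw [disjoint_left]
    rintro t ((h1 | h1) | h1) h2
    · rw [mem_Ioi] at h1; linarith [h2.2]
    · rw [mem_Iio] at h1; linarith [h2.1]
    · linarith [h2.2, h1.1]

/-- The closed band enclosed by the two contours. -/
def bandC : Set ℂ := {z | (-1 / 4 ≤ z.re ∧ z.re ≤ 5 / 4) ∧ 2 ≤ |z.im|}

theorem contour_cauchy {F G₁ G₂ : ℂ → ℂ} {A₁ Y₁ A₂ Y₂ : ℂ} {C D : ℝ} (ha : -1 / 4 < Y₁.re)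
    (hb : Y₁.re < 5 / 4) (hc : 2 < Y₁.im) (ha₂ : -1 / 4 < Y₂.re)
    (hb₂ : Y₂.re < 5 / 4) (hc₂ : Y₂.im < -2)
    (hG₁ : DifferentiableOn ℂ G₁ {z | (-1 / 4 ≤ z.re ∧ z.re ≤ 5 / 4) ∧ 2 ≤ z.im})
    (hG₂ : DifferentiableOn ℂ G₂ {z | (-1 / 4 ≤ z.re ∧ z.re ≤ 5 / 4) ∧ z.im ≤ -2})
    (hF₁ : ∀ z : ℂ, (-1 / 4 ≤ z.re ∧ z.re ≤ 5 / 4) ∧ 2 ≤ z.im → z ≠ Y₁ →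
      F z = G₁ z + A₁ * (1 / (z - Y₁)))
    (hF₂ : ∀ z : ℂ, (-1 / 4 ≤ z.re ∧ z.re ≤ 5 / 4) ∧ z.im ≤ -2 → z ≠ Y₂ →
      F z = G₂ z + A₂ * (1 / (z - Y₂)))
    (hlim : ∀ z ∈ bandC, ‖F z‖ * (|z.im| - D) ≤ C)
    (hiM : Integrable fun t => omM t * F (gamM t))
    (hiP : Integrable fun t => omP t * F (gamP t)) :
    (∫ t, omP t * F (gamP t)) - ∫ t, omM t * F (gamM t) = 2 * π * Complex.I * (A₁ + A₂) := by
  obtain ⟨iM1, iM2, eM⟩ := integral_gamM hiM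
  obtain ⟨iP1, iP2, eP⟩ := integral_gamP hiP
  have hlim' : ∀ᶠ d : ℝ in atTop, ∀ z : ℂ, -1 / 4 ≤ z.re → z.re ≤ 5 / 4 → |z.im| = d →
      ‖F z‖ ≤ (2 * C) / d := by
    filter_upwards [eventually_ge_atTop (2 * |D| + 2)] with d hd z h1 h2 h3
    have hY := abs_nonneg D
    have hY' := le_abs_self D
    have := hlim z ⟨⟨h1, h2⟩, by rw [h3]; linarith⟩
    rw [h3] at this
    rw [le_div_iff₀ (by linarith)]
    nlinarith [norm_nonneg (F z)]
  have up := halfBand_cauchy (F := F) (G := G₁) (A := A₁) (C := 2 * C) ha hb hc hG₁ hF₁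
    (by
      filter_upwards [hlim', eventually_gt_atTop 0] with d hd hd0 x h1 h2
      exact hd _ (by simpa using h1) (by simpa using h2) (by simpa using hd0.le))
    iP1 iM1
  have low := halfBand_cauchy (F := fun z => F (1 - z))
    (G := fun z => G₂ (1 - z)) (A := -A₂)
    (C := 2 * C) (Y := 1 - Y₂) (a := -1 / 4) (b := 5 / 4) (c := 2)
    (by simp; linarith) (by simp; linarith) (by simp; linarith)
    (by
      refine hG₂.comp (by fun_prop) fun z hz => ?_
      refine ⟨⟨?_, ?_⟩, ?_⟩
      · simp; linarith [hz.1.2]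
      · simp; linarith [hz.1.1]
      · simp; exact hz.2)
    (fun z hz hne => by
      have hne' : 1 - z ≠ Y₂ := by rintro rfl; simp at hne
      rw [hF₂ _ ⟨⟨?_, ?_⟩, ?_⟩ hne']
      · have e : 1 - z - Y₂ = -(z - (1 - Y₂)) := by ring
        rw [e, one_div, one_div, inv_neg]; ring
      · simp; linarith [hz.1.2]
      · simp; linarith [hz.1.1]
      · simp; exact hz.2)
    (by
      filter_upwards [hlim', eventually_gt_atTop 0] with d hd hd0 x h1 h2
      refine hd _ ?_ ?_ ?_
      · simp; linarith
      · simp; linarith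
      · simp [hd0.le])
    (by
      have := iM2.comp_neg
      rw [neg_Iio, neg_neg] at this
      refine this.congr_fun (fun t _ => ?_) measurableSet_Ioi
      simp only
      congr 1
      push_cast; ring)
    (by
      have := iP2.comp_neg
      rw [neg_Iio, neg_neg] at this
      refine this.congr_fun (fun t _ => ?_) measurableSet_Ioi
      simp only
      congr 1
      push_cast; ring)
  have r1 : (∫ x in (-1 / 4 : ℝ)..(5 / 4), F (1 - ((x : ℂ) + (2 : ℝ) * Complex.I))) =
      ∫ x in (-1 / 4 : ℝ)..(5 / 4), F ((x : ℂ) + (-2 : ℝ) * Complex.I) := by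
    have := intervalIntegral.integral_comp_sub_left (a := -1 / 4) (b := 5 / 4)
        (fun x : ℝ => F ((x : ℂ) + (-2 : ℝ) * Complex.I)) 1
    norm_num at this ⊢
    rw [← this]
    congr 1 with x
    congr 1; ring
  have r2 : ∀ a b : ℝ, a + b = 1 →
      (∫ t in Ioi (2 : ℝ), F (1 - ((a : ℂ) + t * Complex.I))) =
      ∫ t in Iio (-2 : ℝ), F ((b : ℂ) + t * Complex.I) := by
    intro a b hab
    have e : (b : ℂ) = 1 - a := by rw [eq_sub_iff_add_eq, add_comm]; exact_mod_cast hab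
    rw [← integral_Iic_eq_integral_Iio, ← integral_comp_neg_Ioi]
    refine setIntegral_congr_fun measurableSet_Ioi fun t _ => ?_
    rw [e]
    congr 1
    push_cast; ring
  rw [eM, eP]
  rw [r1, r2 _ _ (by norm_num : (5 / 4 : ℝ) + -1 / 4 = 1),
    r2 _ _ (by norm_num : (-1 / 4 : ℝ) + 5 / 4 = 1)] at low
  linear_combination up - low

/-- The open neighbourhood of the closed band on which densities live. -/
def bandO : Set ℂ := {z | (-3 / 8 < z.re ∧ z.re < 11 / 8) ∧ 7 / 4 < |z.im|}

theorem isOpen_bandO : IsOpen bandO :=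
  ((isOpen_lt continuous_const Complex.continuous_re).inter
    (isOpen_lt Complex.continuous_re continuous_const)).inter
    (isOpen_lt continuous_const Complex.continuous_im.abs)

theorem bandC_subset_bandO : bandC ⊆ bandO := fun z hz =>
  ⟨⟨by linarith [hz.1.1], by linarith [hz.1.2]⟩, by linarith [hz.2]⟩

theorem suppM_subset_bandC : suppM ⊆ bandC := fun z hz =>
  ⟨⟨by linarith [hz.1], by linarith [hz.1]⟩, hz.2.le⟩

theorem suppP_subset_bandC : suppP ⊆ bandC := fun _ hz => ⟨⟨hz.1, hz.2.1⟩, hz.2.2.1⟩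

theorem exists_dist_supp {Y : ℂ} (h1 : -1 / 4 < Y.re) (h2 : Y.re < 5 / 4) (h3 : 2 < |Y.im|) :
    ∃ δ : ℝ, 0 < δ ∧ ∀ z ∈ suppP ∪ suppM, δ ≤ ‖z - Y‖ := by
  refine ⟨min (min (Y.re + 1 / 4) (5 / 4 - Y.re)) (|Y.im| - 2), ?_, ?_⟩
  · refine lt_min (lt_min ?_ ?_) ?_ <;> linarith
  · have r1 : ∀ z : ℂ, |z.re - Y.re| ≤ ‖z - Y‖ := fun z => by
      simpa using Complex.abs_re_le_norm (z - Y)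
    have r2 : ∀ z : ℂ, |z.im - Y.im| ≤ ‖z - Y‖ := fun z => by
      simpa using Complex.abs_im_le_norm (z - Y)
    rintro z (⟨-, -, -, h | h⟩ | ⟨h, -⟩)
    · refine (min_le_left _ _).trans ((min_le_right _ _).trans (le_trans ?_ (r1 z)))
      rw [h]; exact le_abs_self _
    · refine (min_le_right _ _).trans (le_trans ?_ (r2 z))
      rw [← h, abs_sub_comm]; exact abs_sub_abs_le_abs_sub _ _
    · refine (min_le_left _ _).trans ((min_le_left _ _).trans (le_trans ?_ (r1 z)))
      rw [h, abs_sub_comm]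
      exact le_trans (by linarith) (le_abs_self _)

theorem norm_inv_shift_le {s : ℝ} (hs : 2 ≤ s) {z Y : ℂ} (h1 : -1 / 4 ≤ z.re)
    (h2 : Y.re ≤ 11 / 8) : z + s - Y ≠ 0 ∧ ‖1 / (z + s - Y)‖ ≤ 3 := by
  have hre : 3 / 8 ≤ (z + s - Y).re := by simp; linarith
  have hn := hre.trans (Complex.re_le_norm _)
  refine ⟨norm_pos_iff.1 (by linarith), ?_⟩
  rw [norm_div, norm_one, div_le_iff₀ (by linarith)]
  linarith

theorem band_cauchy_integrable {u : ℂ → ℂ} (hu : DifferentiableOn ℂ u bandO) {a : ℝ} (ha0 : 0 ≤ a)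
    (ha : ∀ z ∈ bandO, ‖u z‖ ≤ a / ‖z‖ ^ 2) {s : ℝ} (hs : 2 ≤ s) {Y : ℂ} (h1 : -1 / 4 < Y.re)
    (h2 : Y.re < 5 / 4) (h3 : 2 < |Y.im|) {γ ω : ℝ → ℂ} {S : Set ℂ} (hc : IsContour γ ω S)
    (hS : S ⊆ suppP ∪ suppM) :
    Integrable fun t => ω t * (u (γ t) * (1 / (γ t - Y) - 1 / (γ t + s - Y))) := by
  obtain ⟨δ, hδ, hd⟩ := exists_dist_supp h1 h2 h3
  have hV : IsOpen (bandO ∩ {z | -1 / 4 - 1 / 100 < z.re} ∩ {z | z ≠ Y}) :=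
    (isOpen_bandO.inter (isOpen_lt continuous_const Complex.continuous_re)).inter isOpen_ne
  have hSB : S ⊆ bandC := hS.trans (union_subset suppP_subset_bandC suppM_subset_bandC)
  refine hc.integrable (F := fun z => u z * (1 / (z - Y) - 1 / (z + s - Y))) (Y := Y)
    (b := a * (1 / δ + 3)) hV ?_ ?_ (by positivity) ?_
  · intro z hz
    have e1 : z - Y ≠ 0 := sub_ne_zero.2 hz.2
    have e2 : z + s - Y ≠ 0 := by
      intro h
      have h' := congrArg Complex.re h
      have h'' := hz.1.2
      simp only [mem_ofPred_eq] at h''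
      simp at h'
      linarith
    have e3 := hu.differentiableAt (isOpen_bandO.mem_nhds hz.1.1)
    have e4 : DifferentiableAt ℂ (fun z => u z * (1 / (z - Y) - 1 / (z + s - Y))) z := by
      fun_prop (disch := assumption)
    exact e4.continuousAt.continuousWithinAt
  · intro z hz hne
    refine ⟨⟨bandC_subset_bandO (hSB hz), ?_⟩, hne⟩
    have := (hSB hz).1.1
    simp only [mem_ofPred_eq]
    linarith
  · intro z hz _
    have hzb := hSB hz
    have hdz := hd z (hS hz)
    rw [norm_mul]
    have e1 : ‖1 / (z - Y)‖ ≤ 1 / δ := by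
      rw [norm_div, norm_one]; exact one_div_le_one_div_of_le hδ hdz
    have e2 := (norm_inv_shift_le hs hzb.1.1 (Y := Y) (by linarith)).2
    calc _ ≤ a / ‖z‖ ^ 2 * (1 / δ + 3) := by
          refine mul_le_mul (ha z (bandC_subset_bandO hzb)) ((norm_sub_le _ _).trans
            (add_le_add e1 e2)) (norm_nonneg _) (by positivity)
      _ = _ := by ring

theorem band_cauchy {u : ℂ → ℂ} (hu : DifferentiableOn ℂ u bandO) {a : ℝ} (ha0 : 0 ≤ a)
    (ha : ∀ z ∈ bandO, ‖u z‖ ≤ a / ‖z‖ ^ 2) {s : ℝ} (hs : 2 ≤ s) {Y : ℂ} (h1 : -1 / 4 < Y.re)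
    (h2 : Y.re < 5 / 4) (h3 : 2 < |Y.im|) :
    (∫ t, omP t * (u (gamP t) * (1 / (gamP t - Y) - 1 / (gamP t + s - Y))))
      - ∫ t, omM t * (u (gamM t) * (1 / (gamM t - Y) - 1 / (gamM t + s - Y)))
      = 2 * π * Complex.I * u Y := by
  have iP := band_cauchy_integrable hu ha0 ha hs h1 h2 h3 isContour_P subset_union_left
  have iM := band_cauchy_integrable hu ha0 ha hs h1 h2 h3 isContour_M subset_union_right
  set F : ℂ → ℂ := fun z => u z * (1 / (z - Y) - 1 / (z + s - Y)) with hF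
  have hYO : Y ∈ bandO := ⟨⟨by linarith, by linarith⟩, by linarith⟩
  have hlim : ∀ z ∈ bandC, ‖F z‖ * (|z.im| - |Y.im|) ≤ 2 * a := by
    intro z hz
    by_cases hle : |z.im| ≤ |Y.im|
    · have := mul_nonneg (norm_nonneg (F z)) (sub_nonneg.2 hle)
      linarith
    push Not at hle
    have hzi : |z.im| ≤ ‖z‖ := Complex.abs_im_le_norm z
    have hz2 := hz.2
    have hzY : |z.im| - |Y.im| ≤ ‖z - Y‖ := by
      refine (abs_sub_abs_le_abs_sub _ _).trans ?_
      simpa using Complex.abs_im_le_norm (z - Y)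
    have hp : 0 < ‖z - Y‖ := by linarith
    have e1 := (norm_inv_shift_le hs hz.1.1 (Y := Y) (by linarith)).2
    have e2 : ‖1 / (z + s - Y)‖ ≤ 3 := e1
    have hdnn : 0 ≤ |z.im| - |Y.im| := by linarith
    have hb : ‖F z‖ ≤ a / ‖z‖ ^ 2 * (1 / ‖z - Y‖ + 3) := by
      rw [hF, norm_mul]
      refine mul_le_mul (ha z (bandC_subset_bandO hz)) ((norm_sub_le _ _).trans
        (add_le_add (by rw [norm_div, norm_one]) e2)) (norm_nonneg _) (by positivity)
    have e3 : (1 / ‖z - Y‖ + 3) * (|z.im| - |Y.im|) ≤ 1 + 3 * ‖z‖ := by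
      rw [add_mul]
      refine add_le_add ?_ ?_
      · rw [one_div_mul_eq_div]; exact div_le_one_of_le₀ hzY hp.le
      · have := abs_nonneg Y.im
        nlinarith
    calc ‖F z‖ * (|z.im| - |Y.im|)
        ≤ a / ‖z‖ ^ 2 * (1 / ‖z - Y‖ + 3) * (|z.im| - |Y.im|) := by gcongr
      _ = a / ‖z‖ ^ 2 * ((1 / ‖z - Y‖ + 3) * (|z.im| - |Y.im|)) := by ring
      _ ≤ a / ‖z‖ ^ 2 * (1 + 3 * ‖z‖) := by gcongr
      _ ≤ 2 * a := by
        rw [div_mul_eq_mul_div, div_le_iff₀ (by nlinarith)]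
        have : 1 + 3 * ‖z‖ ≤ 2 * ‖z‖ ^ 2 := by nlinarith
        nlinarith
  have hshift : ∀ z : ℂ, -1 / 4 ≤ z.re → z + s - Y ≠ 0 := fun z hz =>
    (norm_inv_shift_le hs hz (Y := Y) (by linarith)).1
  have hUp : ∀ z : ℂ, (-1 / 4 ≤ z.re ∧ z.re ≤ 5 / 4) ∧ 2 ≤ z.im → z ∈ bandC := fun z hz =>
    ⟨hz.1, hz.2.trans (le_abs_self _)⟩
  have hLo : ∀ z : ℂ, (-1 / 4 ≤ z.re ∧ z.re ≤ 5 / 4) ∧ z.im ≤ -2 → z ∈ bandC := fun z hz =>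
    ⟨hz.1, by linarith [neg_le_abs z.im, hz.2]⟩
  have dF : ∀ z ∈ bandC, z ≠ Y → DifferentiableAt ℂ F z := fun z hz hne => by
    have e1 : z - Y ≠ 0 := sub_ne_zero.2 hne
    have e2 := hshift z hz.1.1
    have e3 := hu.differentiableAt (isOpen_bandO.mem_nhds (bandC_subset_bandO hz))
    simp only [hF]
    fun_prop (disch := assumption)
  have dG : ∀ z ∈ bandC, DifferentiableAt ℂ (fun z => dslope u Y z - u z / (z + s - Y)) z :=
    fun z hz => by
      have e2 := hshift z hz.1.1
      have e3 := hu.differentiableAt (isOpen_bandO.mem_nhds (bandC_subset_bandO hz))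
      have e4 := ((Complex.differentiableOn_dslope (isOpen_bandO.mem_nhds hYO)).2
        hu).differentiableAt (isOpen_bandO.mem_nhds (bandC_subset_bandO hz))
      fun_prop (disch := assumption)
  have eG : ∀ z, z ≠ Y → F z = (dslope u Y z - u z / (z + s - Y)) + u Y * (1 / (z - Y)) := by
    intro z hne
    rw [dslope_of_ne _ hne, slope_def_field]
    simp only [hF]
    ring
  rcases lt_abs.1 h3 with hY | hY
  · have := contour_cauchy (F := F) (G₁ := fun z => dslope u Y z - u z / (z + s - Y)) (G₂ := F)
      (A₁ := u Y) (Y₁ := Y) (A₂ := 0) (Y₂ := -3 * Complex.I) h1 h2 hY (by norm_num) (by norm_num)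
      (by norm_num) (fun z hz => (dG z (hUp z hz)).differentiableWithinAt)
      (fun z hz => (dF z (hLo z hz)
        (by rintro rfl; linarith [hz.2])).differentiableWithinAt)
      (fun z _ hne => eG z hne) (fun z _ _ => by simp) hlim iM iP
    rwa [add_zero] at this
  · have := contour_cauchy (F := F) (G₂ := fun z => dslope u Y z - u z / (z + s - Y)) (G₁ := F)
      (A₂ := u Y) (Y₂ := Y) (A₁ := 0) (Y₁ := 3 * Complex.I) (by norm_num) (by norm_num)
      (by norm_num) h1 h2 (by linarith) (fun z hz => (dF z (hUp z hz)
        (by rintro rfl; linarith [hz.2])).differentiableWithinAt)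
      (fun z hz => (dG z (hLo z hz)).differentiableWithinAt)
      (fun z _ _ => by simp) (fun z _ hne => eG z hne) hlim iM iP
    rwa [zero_add] at this

end Contours

section Kernels
open Metric Set Topology MeasureTheory

/-- A domain on which the perturbation is controlled. -/
def bandW : Set ℂ := {z | (-2 < z.re ∧ z.re < 2) ∧ 3 / 2 < |z.im|}

/-- A small perturbation on the two half-bands, with quartic decay. -/
structure SmallPert (ε : ℝ) (φ : ℂ → ℂ) : Prop where
  pos : 0 < ε
  le : ε ≤ 1 / 1000
  diff : DifferentiableOn ℂ φ bandW
  bound : ∀ z ∈ bandW, ‖φ z‖ ≤ ε / ‖z‖ ^ 4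
  deriv_bound : ∀ z ∈ bandW, ‖deriv φ z‖ ≤ ε / ‖z‖ ^ 4

theorem isOpen_bandW : IsOpen bandW :=
  ((isOpen_lt continuous_const Complex.continuous_re).inter
    (isOpen_lt Complex.continuous_re continuous_const)).inter
    (isOpen_lt continuous_const Complex.continuous_im.abs)

theorem bandO_subset_bandW : bandO ⊆ bandW := fun z hz =>
  ⟨⟨by linarith [hz.1.1], by linarith [hz.1.2]⟩, by linarith [hz.2]⟩

theorem one_le_norm_of_bandW {z : ℂ} (hz : z ∈ bandW) : 3 / 2 ≤ ‖z‖ :=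
  hz.2.le.trans (Complex.abs_im_le_norm z)

theorem norm_of_bandO {z : ℂ} (hz : z ∈ bandO) : 7 / 4 ≤ ‖z‖ :=
  hz.2.le.trans (Complex.abs_im_le_norm z)

theorem ball_subset_bandW {z : ℂ} (hz : z ∈ bandO) : ball z (1 / 4) ⊆ bandW := by
  intro x hx
  rw [mem_ball, dist_eq_norm] at hx
  have h1 := (Complex.abs_re_le_norm (x - z)).trans_lt hx
  have h2 := ((abs_sub_abs_le_abs_sub z.im x.im).trans
    (by rw [abs_sub_comm, ← Complex.sub_im]; exact Complex.abs_im_le_norm (x - z))).trans_lt hx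
  rw [Complex.sub_re, abs_lt] at h1
  exact ⟨⟨by linarith [hz.1.1, h1.1], by linarith [hz.1.2, h1.2]⟩, by linarith [hz.2]⟩

/-- The difference of the perturbed and the unperturbed Cauchy kernels, with the leading term at
infinity removed. -/
noncomputable def dK (φ : ℂ → ℂ) (ζ X : ℂ) : ℂ :=
  (1 + deriv φ ζ) / (ζ + φ ζ - X) - 1 / (ζ - X) + deriv φ ζ / X

/-- The continuation across the diagonal of `g' ζ / (g ζ - g Y) - 1 / (ζ - Y)`, where
`g = id + φ`. -/
noncomputable def sK (φ : ℂ → ℂ) (ζ Y : ℂ) : ℂ :=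
  dslope (dslope φ ζ) ζ Y / (1 + dslope φ ζ Y)

noncomputable def KP (s : ℝ) (φ : ℂ → ℂ) (Y ζ : ℂ) : ℂ :=
  1 / (ζ + s - Y) - 1 / (ζ + s - (Y + φ Y))

noncomputable def KM (s : ℝ) (φ : ℂ → ℂ) (Y ζ : ℂ) : ℂ :=
  dK φ ζ (Y + s) + (regK s (ζ - Y) - regK s (ζ - (Y + φ Y))) - (sK φ ζ Y + deriv φ ζ / (Y + φ Y))

theorem norm_dK_le {φ : ℂ → ℂ} {ε c : ℝ} {ζ X : ℂ} (hε : 0 ≤ ε) (hc0 : 0 < c) (hc1 : c ≤ 1)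
    (hεc : ε ≤ c / 2) (hζ : 1 ≤ ‖ζ‖) (hX : X ≠ 0) (h0 : ‖φ ζ‖ ≤ ε / ‖ζ‖ ^ 4)
    (h1 : ‖deriv φ ζ‖ ≤ ε / ‖ζ‖ ^ 4) (hc : c ≤ ‖ζ - X‖) :
    ‖dK φ ζ X‖ ≤ 16 * ε / c ^ 2 / ‖X‖ ^ 2 := by
  set y := ζ - X with hy
  set p := φ ζ with hp
  set q := deriv φ ζ with hq
  have hz4 : ε / ‖ζ‖ ^ 4 ≤ ε := div_le_self hε (one_le_pow₀ hζ)
  have hXp : 0 < ‖X‖ := norm_pos_iff.2 hX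
  have hyp : 0 < ‖y‖ := by linarith
  have hy0 : y ≠ 0 := norm_pos_iff.1 hyp
  have hyg : ‖y‖ / 2 ≤ ‖y + p‖ := by
    have := norm_sub_norm_le y (-p)
    rw [sub_neg_eq_add, norm_neg] at this
    linarith
  have hyg0 : y + p ≠ 0 := norm_pos_iff.1 (by linarith)
  have hXle : c * ‖X‖ ≤ 2 * ‖y‖ * ‖ζ‖ := by
    have e : X = ζ - y := by rw [hy]; ring
    have : ‖X‖ ≤ ‖ζ‖ + ‖y‖ := by rw [e]; exact norm_sub_le _ _
    nlinarith
  have key : dK φ ζ X = -p / (y * (y + p)) + q * (ζ + p) / (X * (y + p)) := by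
    have e1 : ζ + p - X = y + p := by rw [hy]; ring
    have e2 : ζ = y + X := by rw [hy]; ring
    rw [dK, ← hp, ← hq, e1, ← hy]
    nth_rw 1 [e2]
    field_simp
    ring
  have hg : ‖ζ + p‖ ≤ 2 * ‖ζ‖ := by
    have := norm_add_le ζ p
    linarith
  have b1 : ‖-p / (y * (y + p))‖ ≤ 8 * ε / c ^ 2 / ‖X‖ ^ 2 := by
    rw [norm_div, norm_neg, norm_mul, div_div]
    have d : (0 : ℝ) < c ^ 2 * ‖X‖ ^ 2 := by positivity
    have d2 : 0 < ‖y‖ * ‖y + p‖ := mul_pos hyp (by linarith)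
    rw [div_le_div_iff₀ d2 d]
    have t1 : (c * ‖X‖) ^ 2 ≤ (2 * ‖y‖ * ‖ζ‖) ^ 2 := by gcongr
    have t2 : ‖p‖ * ‖ζ‖ ^ 2 ≤ ε := by
      have : ‖p‖ * ‖ζ‖ ^ 4 ≤ ε := by
        rwa [le_div_iff₀ (by positivity)] at h0
      have h2 : ‖ζ‖ ^ 2 ≤ ‖ζ‖ ^ 4 := pow_le_pow_right₀ hζ (by norm_num)
      exact (mul_le_mul_of_nonneg_left h2 (norm_nonneg _)).trans this
    calc ‖p‖ * (c ^ 2 * ‖X‖ ^ 2) = ‖p‖ * (c * ‖X‖) ^ 2 := by ring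
      _ ≤ ‖p‖ * (2 * ‖y‖ * ‖ζ‖) ^ 2 := by gcongr
      _ = (‖p‖ * ‖ζ‖ ^ 2) * (4 * ‖y‖ ^ 2) := by ring
      _ ≤ ε * (4 * ‖y‖ ^ 2) := by gcongr
      _ ≤ 8 * ε * (‖y‖ * ‖y + p‖) := by
        have := mul_le_mul_of_nonneg_left hyg hyp.le
        nlinarith
  have b2 : ‖q * (ζ + p) / (X * (y + p))‖ ≤ 8 * ε / c ^ 2 / ‖X‖ ^ 2 := by
    rw [norm_div, norm_mul, norm_mul, div_div]
    have d : (0 : ℝ) < c ^ 2 * ‖X‖ ^ 2 := by positivity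
    have d2 : 0 < ‖X‖ * ‖y + p‖ := mul_pos hXp (by linarith)
    rw [div_le_div_iff₀ d2 d]
    have t2 : ‖q‖ * ‖ζ‖ ^ 2 ≤ ε := by
      have : ‖q‖ * ‖ζ‖ ^ 4 ≤ ε := by
        rwa [le_div_iff₀ (by positivity)] at h1
      have h2 : ‖ζ‖ ^ 2 ≤ ‖ζ‖ ^ 4 := pow_le_pow_right₀ hζ (by norm_num)
      exact (mul_le_mul_of_nonneg_left h2 (norm_nonneg _)).trans this
    calc ‖q‖ * ‖ζ + p‖ * (c ^ 2 * ‖X‖ ^ 2)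
        ≤ ‖q‖ * (2 * ‖ζ‖) * (c ^ 2 * ‖X‖ ^ 2) := by gcongr
      _ = ‖q‖ * (2 * ‖ζ‖) * ‖X‖ * c * (c * ‖X‖) := by ring
      _ ≤ ‖q‖ * (2 * ‖ζ‖) * ‖X‖ * 1 * (2 * ‖y‖ * ‖ζ‖) := by gcongr
      _ = (‖q‖ * ‖ζ‖ ^ 2) * (4 * ‖X‖ * ‖y‖) := by ring
      _ ≤ ε * (4 * ‖X‖ * ‖y‖) := by gcongr
      _ ≤ 8 * ε * (‖X‖ * ‖y + p‖) := by
        have := mul_le_mul_of_nonneg_left hyg (mul_nonneg hε hXp.le)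
        nlinarith
  rw [key]
  refine (norm_add_le _ _).trans ((add_le_add b1 b2).trans (le_of_eq ?_))
  ring

namespace SmallPert

variable {ε : ℝ} {φ : ℂ → ℂ}

theorem bound' (h : SmallPert ε φ) {z : ℂ} (hz : z ∈ bandW) : ‖φ z‖ ≤ ε :=
  (h.bound z hz).trans (div_le_self h.pos.le
    (one_le_pow₀ (by linarith [one_le_norm_of_bandW hz])))

theorem deriv_bound' (h : SmallPert ε φ) {z : ℂ} (hz : z ∈ bandW) : ‖deriv φ z‖ ≤ ε :=
  (h.deriv_bound z hz).trans (div_le_self h.pos.le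
    (one_le_pow₀ (by linarith [one_le_norm_of_bandW hz])))

theorem bound_sq (h : SmallPert ε φ) {z : ℂ} (hz : z ∈ bandW) : ‖φ z‖ ≤ ε / ‖z‖ ^ 2 := by
  have h1 : 1 ≤ ‖z‖ := by linarith [one_le_norm_of_bandW hz]
  refine (h.bound z hz).trans ?_
  have h2 : ‖z‖ ^ 2 ≤ ‖z‖ ^ 4 := pow_le_pow_right₀ h1 (by norm_num)
  have := h.pos.le
  gcongr

theorem lipschitz (h : SmallPert ε φ) {z w : ℂ} (hz : z ∈ bandW) (hw : w ∈ bandW) :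
    ‖φ z - φ w‖ ≤ ε * ‖z - w‖ := by
  have hre : Convex ℝ ({z : ℂ | -2 < z.re} ∩ {z | z.re < 2}) :=
    (convex_halfSpace_re_gt _).inter (convex_halfSpace_re_lt _)
  have ho : IsOpen ({z : ℂ | -2 < z.re} ∩ {z | z.re < 2}) :=
    (isOpen_lt continuous_const Complex.continuous_re).inter
      (isOpen_lt Complex.continuous_re continuous_const)
  have up : ({z : ℂ | -2 < z.re} ∩ {z | z.re < 2}) ∩ {z | 3 / 2 < z.im} ⊆ bandW :=
    fun z hz => ⟨hz.1, lt_of_lt_of_le hz.2 (le_abs_self _)⟩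
  have lo : ({z : ℂ | -2 < z.re} ∩ {z | z.re < 2}) ∩ {z | z.im < -3 / 2} ⊆ bandW :=
    fun z hz => ⟨hz.1, lt_of_lt_of_le (show 3 / 2 < -z.im by
      have := hz.2; simp only [mem_ofPred_eq] at this; linarith) (neg_le_abs _)⟩
  have opp : 3 ≤ |z.im - w.im| → ‖φ z - φ w‖ ≤ ε * ‖z - w‖ := fun h3 => by
    have h4 : 3 ≤ ‖z - w‖ := h3.trans (by simpa using Complex.abs_im_le_norm (z - w))
    have := norm_sub_le (φ z) (φ w)
    have := h.bound' hz
    have := h.bound' hw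
    nlinarith [h.pos]
  rcases lt_abs.1 hz.2 with hz1 | hz1 <;> rcases lt_abs.1 hw.2 with hw1 | hw1
  · exact lipschitz_of_deriv_le
      (ho.inter (isOpen_lt continuous_const Complex.continuous_im))
      (hre.inter (convex_halfSpace_im_gt _)) (h.diff.mono up)
      (fun v hv => h.deriv_bound' (up hv)) ⟨hz.1, hz1⟩ ⟨hw.1, hw1⟩
  · exact opp (le_trans (by linarith) (le_abs_self _))
  · exact opp (le_trans (by linarith) (neg_le_abs _))
  · exact lipschitz_of_deriv_le
      (ho.inter (isOpen_lt Complex.continuous_im continuous_const))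
      (hre.inter (convex_halfSpace_im_lt _)) (h.diff.mono lo)
      (fun v hv => h.deriv_bound' (lo hv))
      ⟨hz.1, by simp only [mem_ofPred_eq]; linarith⟩
      ⟨hw.1, by simp only [mem_ofPred_eq]; linarith⟩

theorem quad (h : SmallPert ε φ) {ζ Y : ℂ} (hζ : ζ ∈ bandO) (hY : ‖Y - ζ‖ < 1 / 4) :
    ‖φ Y - φ ζ - deriv φ ζ * (Y - ζ)‖ ≤ 64 * ε / ‖ζ‖ ^ 4 * ‖Y - ζ‖ ^ 2 := by
  have hζW := bandO_subset_bandW hζ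
  have hn := norm_of_bandO hζ
  have hsub := ball_subset_bandW hζ
  have hmem : ∀ w ∈ ball (0 : ℂ) (1 / 4), ζ + w ∈ bandW := fun w hw => hsub (by
    rw [mem_ball, dist_eq_norm]; simpa using hw)
  have hda : ∀ w ∈ ball (0 : ℂ) (1 / 4), HasDerivAt (fun w => φ (ζ + w) - φ ζ - deriv φ ζ * w)
      (deriv φ (ζ + w) - deriv φ ζ) w := fun w hw => by
    have e1 := (h.diff.differentiableAt (isOpen_bandW.mem_nhds (hmem w hw))).hasDerivAt
    have e2 := (e1.comp_const_add ζ w).sub_const (φ ζ)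
    have e3 := e2.sub ((hasDerivAt_id w).const_mul (deriv φ ζ))
    rw [mul_one] at e3
    exact e3
  have key := quad_bound (f := fun w => φ (ζ + w) - φ ζ - deriv φ ζ * w) (r := 1 / 4)
    (M := 4 * ε / ‖ζ‖ ^ 4)
    (fun w hw => (hda w hw).differentiableAt.differentiableWithinAt) ?_ (by simp)
    (by rw [(hda 0 (by simp)).deriv]; simp) (z := Y - ζ) (by simpa using hY)
  · simp only [add_sub_cancel] at key
    refine key.trans (le_of_eq ?_)
    ring
  · intro w hw
    have hw' : ‖w‖ < 1 / 4 := by simpa using hw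
    have n1 : 6 / 7 * ‖ζ‖ ≤ ‖ζ + w‖ := by
      have := norm_sub_norm_le ζ (-w)
      rw [sub_neg_eq_add, norm_neg] at this
      linarith
    have b1 : ‖φ (ζ + w)‖ ≤ 2 * (ε / ‖ζ‖ ^ 4) := by
      refine (h.bound _ (hmem w hw)).trans ?_
      have hpos := h.pos
      have n2 : ‖ζ‖ ^ 4 / 2 ≤ ‖ζ + w‖ ^ 4 := by
        have := pow_le_pow_left₀ (by positivity) n1 4
        rw [mul_pow] at this
        have h4 : 0 < ‖ζ‖ ^ 4 := by positivity
        norm_num at this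
        linarith
      have p1 : 0 < ‖ζ‖ := by linarith
      have p2 : 0 < ‖ζ + w‖ := by linarith
      rw [← mul_div_assoc, div_le_div_iff₀ (by positivity) (by positivity)]
      nlinarith
    have b2 := h.bound ζ hζW
    have b3 : ‖deriv φ ζ * w‖ ≤ ε / ‖ζ‖ ^ 4 := by
      rw [norm_mul]
      have := h.deriv_bound ζ hζW
      nlinarith [norm_nonneg (deriv φ ζ)]
    have := norm_sub_le (φ (ζ + w) - φ ζ) (deriv φ ζ * w)
    have := norm_sub_le (φ (ζ + w)) (φ ζ)
    have e : 4 * ε / ‖ζ‖ ^ 4 = 4 * (ε / ‖ζ‖ ^ 4) := by ring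
    rw [e]
    linarith

theorem norm_dslope_le (h : SmallPert ε φ) {ζ Y : ℂ} (hζ : ζ ∈ bandW) (hY : Y ∈ bandW) :
    ‖dslope φ ζ Y‖ ≤ ε := by
  by_cases hne : Y = ζ
  · rw [hne, dslope_same]; exact h.deriv_bound' hζ
  · rw [dslope_of_ne _ hne, slope_def_field, norm_div,
      div_le_iff₀ (norm_pos_iff.2 (sub_ne_zero.2 hne))]
    exact h.lipschitz hY hζ

theorem one_add_dslope (h : SmallPert ε φ) {ζ Y : ℂ} (hζ : ζ ∈ bandW) (hY : Y ∈ bandW) :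
    1 / 2 ≤ ‖1 + dslope φ ζ Y‖ := by
  have h1 := norm_sub_norm_le (1 : ℂ) (-dslope φ ζ Y)
  rw [sub_neg_eq_add, norm_neg, norm_one] at h1
  linarith [h.norm_dslope_le hζ hY, h.le]

theorem differentiableOn_sK (h : SmallPert ε φ) {ζ : ℂ} (hζ : ζ ∈ bandW) :
    DifferentiableOn ℂ (sK φ ζ) bandW := by
  have hn := isOpen_bandW.mem_nhds hζ
  have e1 := (Complex.differentiableOn_dslope hn).2 h.diff
  have e2 := (Complex.differentiableOn_dslope hn).2 e1
  refine e2.div ((differentiableOn_const 1).add e1) fun Y hY => ?_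
  have := h.one_add_dslope hζ hY
  exact norm_pos_iff.1 (by linarith)

theorem map_sub_ne (h : SmallPert ε φ) {ζ Y : ℂ} (hζ : ζ ∈ bandW) (hY : Y ∈ bandW)
    (hne : ζ ≠ Y) : ζ + φ ζ - (Y + φ Y) ≠ 0 := by
  intro h0
  have h1 : ζ - Y = -(φ ζ - φ Y) := by linear_combination h0
  have h2 := h.lipschitz hζ hY
  have h3 : 0 < ‖ζ - Y‖ := norm_pos_iff.2 (sub_ne_zero.2 hne)
  rw [← norm_neg, ← h1] at h2
  nlinarith [h.le]

theorem sK_eq (h : SmallPert ε φ) {ζ Y : ℂ} (hζ : ζ ∈ bandW) (hY : Y ∈ bandW) (hne : ζ ≠ Y) :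
    sK φ ζ Y = (1 + deriv φ ζ) / (ζ + φ ζ - (Y + φ Y)) - 1 / (ζ - Y) := by
  have h1 := h.map_sub_ne hζ hY hne
  have h2 : ζ - Y ≠ 0 := sub_ne_zero.2 hne
  have h2' : Y - ζ ≠ 0 := sub_ne_zero.2 hne.symm
  have h3 : 1 + dslope φ ζ Y ≠ 0 := by
    have := h.one_add_dslope hζ hY
    exact norm_pos_iff.1 (by linarith)
  have e1 : dslope φ ζ Y = (φ Y - φ ζ) / (Y - ζ) := by
    rw [dslope_of_ne _ hne.symm, slope_def_field]
  have e2 : ζ + φ ζ - (Y + φ Y) = (ζ - Y) * (1 + dslope φ ζ Y) := by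
    rw [e1]; field_simp; ring
  rw [sK, dslope_of_ne _ hne.symm, slope_def_field, dslope_same, e2]
  set D := dslope φ ζ Y
  field_simp
  ring

end SmallPert
end Kernels

section KernelBounds
open Metric Set Topology MeasureTheory

/-- The part of the half-bands to the left of the imaginary axis. -/
def bandL : Set ℂ := bandO ∩ {z | z.re < 0}

theorem isOpen_bandL : IsOpen bandL :=
  isOpen_bandO.inter (isOpen_lt Complex.continuous_re continuous_const)

theorem suppM_subset_bandL : suppM ⊆ bandL := fun z hz =>
  ⟨bandC_subset_bandO (suppM_subset_bandC hz), by
    have := hz.1; simp only [mem_ofPred_eq]; linarith⟩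

namespace SmallPert

variable {ε : ℝ} {φ : ℂ → ℂ}

theorem norm_map_ge (h : SmallPert ε φ) {Y : ℂ} (hY : Y ∈ bandW) : ‖Y‖ / 2 ≤ ‖Y + φ Y‖ := by
  have := norm_sub_norm_le Y (-φ Y)
  rw [sub_neg_eq_add, norm_neg] at this
  linarith [h.bound' hY, h.le, one_le_norm_of_bandW hY]

theorem abs_re_le (h : SmallPert ε φ) {Y : ℂ} (hY : Y ∈ bandW) : |(φ Y).re| ≤ 1 / 1000 :=
  (Complex.abs_re_le_norm _).trans ((h.bound' hY).trans h.le)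

theorem norm_sub_map_ge (h : SmallPert ε φ) {Y z : ℂ} (hY : Y ∈ bandW) :
    ‖z - Y‖ - ε ≤ ‖z - (Y + φ Y)‖ := by
  have h1 := norm_sub_norm_le (z - Y) (φ Y)
  rw [sub_sub] at h1
  linarith [h.bound' hY]

/-- The elementary estimate for a displaced simple pole. -/
theorem norm_inv_sub_inv_le (h : SmallPert ε φ) {Y y : ℂ} {c d : ℝ} (hc : 0 < c) (hd : 0 < d)
    (hY : Y ∈ bandW) (h1 : c ≤ ‖y‖) (h2 : d ≤ ‖y - φ Y‖) :
    ‖1 / y - 1 / (y - φ Y)‖ ≤ 1 / (c * d) * (ε / ‖Y‖ ^ 2) := by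
  have n1 : y ≠ 0 := norm_pos_iff.1 (by linarith)
  have n2 : y - φ Y ≠ 0 := norm_pos_iff.1 (by linarith)
  have e : 1 / y - 1 / (y - φ Y) = -φ Y / (y * (y - φ Y)) := by field_simp; ring
  rw [e, norm_div, norm_neg, norm_mul, div_eq_inv_mul, ← one_div]
  have := h.bound_sq hY
  gcongr

theorem re_shift (_ : SmallPert ε φ) {s : ℝ} (hs : 2 ≤ s) {Y ζ : ℂ} (hY : Y ∈ bandO)
    (hζ : ζ ∈ bandO) : 1 / 4 < (ζ + s - Y).re := by
  simp only [Complex.add_re, Complex.sub_re, Complex.ofReal_re]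
  linarith [hζ.1.1, hY.1.2]

theorem norm_KP_le (h : SmallPert ε φ) {s : ℝ} (hs : 2 ≤ s) {Y ζ : ℂ} (hY : Y ∈ bandO)
    (hζ : ζ ∈ bandO) : ‖KP s φ Y ζ‖ ≤ 32 * ε / ‖Y‖ ^ 2 := by
  have hYW := bandO_subset_bandW hY
  have h1 := (h.re_shift hs hY hζ).le.trans ((le_abs_self _).trans (Complex.abs_re_le_norm _))
  have h2 := h.norm_sub_map_ge (z := ζ + s) hYW
  have h3 : (1 / 8 : ℝ) ≤ ‖ζ + s - Y - φ Y‖ := by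
    rw [sub_sub]; linarith [h.le]
  have := h.norm_inv_sub_inv_le (by norm_num) (by norm_num) hYW h1 h3
  rw [sub_sub] at this
  rw [KP]
  refine this.trans (le_of_eq ?_)
  ring

theorem norm_sK_near (h : SmallPert ε φ) {Y ζ : ℂ} (hY : Y ∈ bandO) (hζ : ζ ∈ bandO)
    (hn : ‖Y - ζ‖ < 1 / 4) : ‖sK φ ζ Y‖ ≤ 128 * ε / ‖ζ‖ ^ 4 := by
  have hζW := bandO_subset_bandW hζ
  have hYW := bandO_subset_bandW hY
  have hQ : 0 ≤ 64 * ε / ‖ζ‖ ^ 4 := by have := h.pos; positivity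
  have hlip : ∀ w, ‖w - ζ‖ < 1 / 4 →
      ‖dslope φ ζ w - dslope φ ζ ζ‖ ≤ 64 * ε / ‖ζ‖ ^ 4 * ‖w - ζ‖ := fun w hw => by
    by_cases hne : w = ζ
    · simp [hne]
    have hp : 0 < ‖w - ζ‖ := norm_pos_iff.2 (sub_ne_zero.2 hne)
    have hq := h.quad hζ hw
    have e : dslope φ ζ w - dslope φ ζ ζ = (φ w - φ ζ - deriv φ ζ * (w - ζ)) / (w - ζ) := by
      have : w - ζ ≠ 0 := sub_ne_zero.2 hne
      rw [dslope_of_ne _ hne, slope_def_field, dslope_same]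
      field_simp
    rw [e, norm_div, div_le_iff₀ hp]
    refine hq.trans (le_of_eq ?_)
    ring
  have hD : ‖dslope (dslope φ ζ) ζ Y‖ ≤ 64 * ε / ‖ζ‖ ^ 4 := by
    by_cases hne : Y = ζ
    · rw [hne, dslope_same]
      have hd : DifferentiableAt ℂ (dslope φ ζ) ζ :=
        ((Complex.differentiableOn_dslope (isOpen_bandW.mem_nhds hζW)).2 h.diff).differentiableAt
          (isOpen_bandW.mem_nhds hζW)
      refine hd.hasDerivAt.le_of_lip' hQ ?_
      filter_upwards [ball_mem_nhds ζ (show (0 : ℝ) < 1 / 4 by norm_num)] with w hw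
      exact hlip w (by rwa [mem_ball, dist_eq_norm] at hw)
    · have hp : 0 < ‖Y - ζ‖ := norm_pos_iff.2 (sub_ne_zero.2 hne)
      rw [dslope_of_ne _ hne, slope_def_field, norm_div, div_le_iff₀ hp]
      exact hlip Y hn
  have h1 := h.one_add_dslope hζW hYW
  rw [sK, norm_div, div_le_iff₀ (by linarith)]
  have : 128 * ε / ‖ζ‖ ^ 4 = 2 * (64 * ε / ‖ζ‖ ^ 4) := by ring
  rw [this]
  nlinarith

theorem norm_singular_le (h : SmallPert ε φ) {Y ζ : ℂ} (hY : Y ∈ bandO) (hζ : ζ ∈ bandO) :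
    ‖sK φ ζ Y + deriv φ ζ / (Y + φ Y)‖ ≤ 70000 * ε / ‖Y‖ ^ 2 := by
  have hζW := bandO_subset_bandW hζ
  have hYW := bandO_subset_bandW hY
  have hpos := h.pos
  have nY := norm_of_bandO hY
  have nζ := norm_of_bandO hζ
  have hg := h.norm_map_ge hYW
  by_cases hn : ‖Y - ζ‖ < 1 / 16
  · have h1 := h.norm_sK_near hY hζ (by linarith)
    have nn : ‖Y‖ / 2 ≤ ‖ζ‖ := by
      have := norm_sub_norm_le Y ζ
      linarith
    have e4 : ε / ‖ζ‖ ^ 4 ≤ 16 * ε / ‖Y‖ ^ 2 := by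
      have p1 : (‖Y‖ / 2) ^ 4 ≤ ‖ζ‖ ^ 4 := by gcongr
      have p2 : ‖Y‖ ^ 2 ≤ ‖Y‖ ^ 4 := pow_le_pow_right₀ (by linarith) (by norm_num)
      rw [div_le_div_iff₀ (by positivity) (by positivity)]
      have : ‖Y‖ ^ 2 ≤ 16 * ‖ζ‖ ^ 4 := by
        rw [div_pow] at p1; linarith
      nlinarith
    have h2 : ‖deriv φ ζ / (Y + φ Y)‖ ≤ 32 * ε / ‖Y‖ ^ 2 := by
      have d := (h.deriv_bound ζ hζW).trans e4
      rw [norm_div, div_le_iff₀ (by linarith)]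
      have : 0 ≤ 16 * ε / ‖Y‖ ^ 2 := by positivity
      have e : 32 * ε / ‖Y‖ ^ 2 = 2 * (16 * ε / ‖Y‖ ^ 2) := by ring
      rw [e]
      nlinarith
    refine (norm_add_le _ _).trans ((add_le_add h1 h2).trans ?_)
    have e : 128 * ε / ‖ζ‖ ^ 4 = 128 * (ε / ‖ζ‖ ^ 4) := by ring
    have e2 : 70000 * ε / ‖Y‖ ^ 2 = 128 * (16 * ε / ‖Y‖ ^ 2) + 32 * ε / ‖Y‖ ^ 2
      + 67920 * (ε / ‖Y‖ ^ 2) := by ring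
    have : 0 ≤ ε / ‖Y‖ ^ 2 := by positivity
    rw [e, e2]
    linarith
  · push Not at hn
    rw [norm_sub_rev] at hn
    have hne : ζ ≠ Y := fun h0 => by rw [h0, sub_self, norm_zero] at hn; norm_num at hn
    have hc := h.norm_sub_map_ge (z := ζ) hYW
    have hc' : (1 / 32 : ℝ) ≤ ‖ζ - (Y + φ Y)‖ := by linarith [h.le]
    have d1 := norm_dK_le (φ := φ) (X := Y + φ Y) hpos.le (by norm_num : (0 : ℝ) < 1 / 32)
      (by norm_num) (by linarith [h.le]) (by linarith) (norm_pos_iff.1 (by linarith))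
      (h.bound ζ hζW) (h.deriv_bound ζ hζW) hc'
    have d2 := h.norm_inv_sub_inv_le (by norm_num : (0 : ℝ) < 1 / 16)
      (by norm_num : (0 : ℝ) < 1 / 32) hYW hn (by rw [sub_sub]; exact hc')
    rw [sub_sub] at d2
    have e : sK φ ζ Y + deriv φ ζ / (Y + φ Y)
        = dK φ ζ (Y + φ Y) - (1 / (ζ - Y) - 1 / (ζ - (Y + φ Y))) := by
      rw [h.sK_eq hζW hYW hne, dK]; ring
    have d3 : 16 * ε / (1 / 32) ^ 2 / ‖Y + φ Y‖ ^ 2 ≤ 65536 * ε / ‖Y‖ ^ 2 := by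
      have p1 : 0 < ‖Y + φ Y‖ := by linarith
      rw [div_le_div_iff₀ (by positivity) (by positivity)]
      have : ‖Y‖ ^ 2 ≤ 4 * ‖Y + φ Y‖ ^ 2 := by
        have : (‖Y‖ / 2) ^ 2 ≤ ‖Y + φ Y‖ ^ 2 := by gcongr
        rw [div_pow] at this
        linarith
      have := mul_le_mul_of_nonneg_left this hpos.le
      norm_num
      linarith
    rw [e]
    refine (norm_sub_le _ _).trans ((add_le_add (d1.trans d3) d2).trans ?_)
    have e2 : 70000 * ε / ‖Y‖ ^ 2 = 65536 * ε / ‖Y‖ ^ 2 + 4464 * (ε / ‖Y‖ ^ 2) := by ring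
    have : 0 ≤ ε / ‖Y‖ ^ 2 := by positivity
    rw [e2]
    linarith

theorem re_sub_bandL (_ : SmallPert ε φ) {Y ζ : ℂ} (hY : Y ∈ bandO) (hζ : ζ ∈ bandL) :
    -(7 / 4) < (ζ - Y).re ∧ (ζ - Y).re < 3 / 8 := by
  have := hζ.2
  simp only [mem_ofPred_eq] at this
  simp only [Complex.sub_re]
  constructor <;> linarith [hζ.1.1.1, hY.1.2, hY.1.1]

theorem re_sub_map_bandL (h : SmallPert ε φ) {Y ζ : ℂ} (hY : Y ∈ bandO) (hζ : ζ ∈ bandL) :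
    -(15 / 8) < (ζ - (Y + φ Y)).re ∧ (ζ - (Y + φ Y)).re < 1 / 2 := by
  have h1 := h.re_sub_bandL hY hζ
  have h2 := abs_le.1 (h.abs_re_le (bandO_subset_bandW hY))
  have e : (ζ - (Y + φ Y)).re = (ζ - Y).re - (φ Y).re := by
    simp only [Complex.sub_re, Complex.add_re]; ring
  rw [e]
  constructor <;> linarith [h1.1, h1.2, h2.1, h2.2]

theorem norm_le_norm_shift {Y : ℂ} (hY : Y ∈ bandO) {s : ℝ} (hs : 2 ≤ s) : ‖Y‖ ≤ ‖Y + s‖ := by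
  refine le_of_sq_le_sq ?_ (norm_nonneg _)
  rw [norm_sq_eq, norm_sq_eq]
  simp only [Complex.add_re, Complex.add_im, Complex.ofReal_re, Complex.ofReal_im]
  nlinarith [hY.1.1]

theorem one_le_norm_sub_shift {Y ζ : ℂ} (hY : Y ∈ bandO) (hζ : ζ ∈ bandL) {s : ℝ} (hs : 2 ≤ s) :
    13 / 8 ≤ ‖ζ - (Y + s)‖ := by
  refine le_trans ?_ ((neg_le_abs _).trans (Complex.abs_re_le_norm _))
  have := hζ.2
  simp only [mem_ofPred_eq] at this
  simp only [Complex.sub_re, Complex.add_re, Complex.ofReal_re]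
  linarith [hY.1.1]

theorem norm_KM_le (h : SmallPert ε φ) {s R : ℝ} (hs : 2 ≤ s) (hR : 0 ≤ R)
    (hreg : ∀ y w : ℂ, -(7 / 4 * s) < y.re → y.re < 3 / 4 * s → -(7 / 4 * s) < w.re →
      w.re < 3 / 4 * s → ‖regK s y - regK s w‖ ≤ R * ‖y - w‖)
    {Y ζ : ℂ} (hY : Y ∈ bandO) (hζ : ζ ∈ bandL) :
    ‖KM s φ Y ζ‖ ≤ (100000 + R) * ε / ‖Y‖ ^ 2 := by
  have hζW := bandO_subset_bandW hζ.1
  have hYW := bandO_subset_bandW hY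
  have hpos := h.pos
  have nY := norm_of_bandO hY
  have nζ := norm_of_bandO hζ.1
  have nYs := norm_le_norm_shift hY hs
  have d1 := norm_dK_le (φ := φ) (X := Y + s) hpos.le (by norm_num : (0 : ℝ) < 1)
    (by norm_num) (by linarith [h.le]) (by linarith) (norm_pos_iff.1 (by linarith))
    (h.bound ζ hζW) (h.deriv_bound ζ hζW) (by linarith [one_le_norm_sub_shift hY hζ hs])
  have d1' : 16 * ε / 1 ^ 2 / ‖Y + s‖ ^ 2 ≤ 16 * (ε / ‖Y‖ ^ 2) := by
    rw [one_pow, div_one, mul_div_assoc]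
    gcongr
  have r1 := h.re_sub_bandL hY hζ
  have r2 := h.re_sub_map_bandL hY hζ
  have d2 := hreg (ζ - Y) (ζ - (Y + φ Y)) (by linarith) (by linarith) (by linarith) (by linarith)
  have e2 : ζ - Y - (ζ - (Y + φ Y)) = φ Y := by ring
  rw [e2] at d2
  have d2' : R * ‖φ Y‖ ≤ R * (ε / ‖Y‖ ^ 2) := mul_le_mul_of_nonneg_left (h.bound_sq hYW) hR
  have d3 := h.norm_singular_le hY hζ.1
  rw [KM]
  refine (norm_sub_le _ _).trans ((add_le_add ((norm_add_le _ _).trans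
    (add_le_add (d1.trans d1') (d2.trans d2'))) d3).trans ?_)
  have e : (100000 + R) * ε / ‖Y‖ ^ 2 = (100000 + R) * (ε / ‖Y‖ ^ 2) := by ring
  have e' : 70000 * ε / ‖Y‖ ^ 2 = 70000 * (ε / ‖Y‖ ^ 2) := by ring
  have : 0 ≤ ε / ‖Y‖ ^ 2 := by positivity
  rw [e, e']
  linarith

theorem differentiableOn_KP (h : SmallPert ε φ) {s : ℝ} (hs : 2 ≤ s) {ζ : ℂ} (hζ : ζ ∈ bandO) :
    DifferentiableOn ℂ (fun Y => KP s φ Y ζ) bandO := by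
  have hφ := h.diff.mono bandO_subset_bandW
  refine ((differentiableOn_const 1).div (by fun_prop) fun Y hY => ?_).sub
    ((differentiableOn_const 1).div (by fun_prop) fun Y hY => ?_)
  · intro h0
    have := h.re_shift hs hY hζ
    rw [h0] at this; norm_num at this
  · have h1 := (h.re_shift hs hY hζ).le.trans ((le_abs_self _).trans (Complex.abs_re_le_norm _))
    have h2 := h.norm_sub_map_ge (z := ζ + s) (bandO_subset_bandW hY)
    exact norm_pos_iff.1 (by linarith [h.le])

theorem continuousOn_KP (h : SmallPert ε φ) {s : ℝ} (hs : 2 ≤ s) {Y : ℂ} (hY : Y ∈ bandO) :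
    ContinuousOn (KP s φ Y) bandO := by
  refine (continuousOn_const.div (by fun_prop) fun ζ hζ => ?_).sub
    (continuousOn_const.div (by fun_prop) fun ζ hζ => ?_)
  · intro h0
    have := h.re_shift hs hY hζ
    rw [h0] at this; norm_num at this
  · have h1 := (h.re_shift hs hY hζ).le.trans ((le_abs_self _).trans (Complex.abs_re_le_norm _))
    have h2 := h.norm_sub_map_ge (z := ζ + s) (bandO_subset_bandW hY)
    exact norm_pos_iff.1 (by linarith [h.le])

theorem map_sub_shift_ne (h : SmallPert ε φ) {Y ζ : ℂ} (hY : Y ∈ bandO) (hζ : ζ ∈ bandL) {s : ℝ}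
    (hs : 2 ≤ s) : ζ + φ ζ - (Y + s) ≠ 0 := by
  have h1 := one_le_norm_sub_shift hY hζ hs
  have h2 := norm_sub_norm_le (ζ - (Y + s)) (-φ ζ)
  rw [sub_neg_eq_add, norm_neg] at h2
  have e : ζ + φ ζ - (Y + s) = ζ - (Y + s) + φ ζ := by ring
  rw [e]
  exact norm_pos_iff.1 (by linarith [h.le, h.bound' (bandO_subset_bandW hζ.1)])

theorem continuousOn_deriv (h : SmallPert ε φ) : ContinuousOn (deriv φ) bandW :=
  (h.diff.deriv isOpen_bandW).continuousOn

theorem differentiableOn_KM (h : SmallPert ε φ) {s : ℝ} (hs : 2 ≤ s) {ζ : ℂ} (hζ : ζ ∈ bandL) :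
    DifferentiableOn ℂ (fun Y => KM s φ Y ζ) bandO := by
  have hφ := h.diff.mono bandO_subset_bandW
  have hr := differentiableOn_regK (show 0 < s by linarith)
  have hX : ∀ Y ∈ bandO, Y + (s : ℂ) ≠ 0 := fun Y hY => norm_pos_iff.1 (by
    linarith [norm_le_norm_shift hY hs, norm_of_bandO hY])
  have hG : ∀ Y ∈ bandO, Y + φ Y ≠ 0 := fun Y hY => norm_pos_iff.1 (by
    linarith [h.norm_map_ge (bandO_subset_bandW hY), norm_of_bandO hY])
  have hd : ∀ Y ∈ bandO, ζ - (Y + s) ≠ 0 := fun Y hY => norm_pos_iff.1 (by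
    linarith [one_le_norm_sub_shift hY hζ hs])
  refine DifferentiableOn.sub (DifferentiableOn.add ?_ (DifferentiableOn.sub ?_ ?_))
    (((h.differentiableOn_sK (bandO_subset_bandW hζ.1)).mono bandO_subset_bandW).add
      ((differentiableOn_const _).div (by fun_prop) hG))
  · unfold dK
    exact (((differentiableOn_const _).div (by fun_prop)
      fun Y hY => h.map_sub_shift_ne hY hζ hs).sub
      ((differentiableOn_const _).div (by fun_prop) hd)).add
      ((differentiableOn_const _).div (by fun_prop) hX)
  · refine hr.comp (by fun_prop) fun Y hY => ?_
    have := h.re_sub_bandL hY hζ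
    exact ⟨by linarith, by linarith⟩
  · refine hr.comp (by fun_prop) fun Y hY => ?_
    have := h.re_sub_map_bandL hY hζ
    exact ⟨by linarith, by linarith⟩

theorem continuousOn_KM (h : SmallPert ε φ) {s : ℝ} (hs : 2 ≤ s) {Y : ℂ} (hY : Y ∈ bandO) :
    ContinuousOn (KM s φ Y) (bandL ∩ {Y}ᶜ) := by
  have sub : bandL ∩ {Y}ᶜ ⊆ bandW := fun z hz => bandO_subset_bandW hz.1.1
  have hφ := h.diff.continuousOn.mono sub
  have hφ' := h.continuousOn_deriv.mono sub
  have hr := (differentiableOn_regK (show 0 < s by linarith)).continuousOn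
  have hYW := bandO_subset_bandW hY
  unfold KM dK
  refine ContinuousOn.sub (ContinuousOn.add ?_ (ContinuousOn.sub ?_ ?_)) (ContinuousOn.add ?_ ?_)
  · refine ((ContinuousOn.div (by fun_prop) (by fun_prop) fun ζ hζ =>
      h.map_sub_shift_ne hY hζ.1 hs).sub
      (ContinuousOn.div (by fun_prop) (by fun_prop) fun ζ hζ => ?_)).add (by fun_prop)
    exact norm_pos_iff.1 (by linarith [one_le_norm_sub_shift hY hζ.1 hs])
  · refine hr.comp (by fun_prop) fun ζ hζ => ?_
    have := h.re_sub_bandL hY hζ.1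
    exact ⟨by linarith, by linarith⟩
  · refine hr.comp (by fun_prop) fun ζ hζ => ?_
    have := h.re_sub_map_bandL hY hζ.1
    exact ⟨by linarith, by linarith⟩
  · refine ContinuousOn.congr (f := fun ζ => (1 + deriv φ ζ) / (ζ + φ ζ - (Y + φ Y)) - 1 / (ζ - Y))
      ?_ fun ζ hζ => h.sK_eq (sub hζ) hYW hζ.2
    exact (ContinuousOn.div (by fun_prop) (by fun_prop) fun ζ hζ =>
      h.map_sub_ne (sub hζ) hYW hζ.2).sub
      (ContinuousOn.div (by fun_prop) (by fun_prop) fun ζ hζ => sub_ne_zero.2 hζ.2)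
  · exact hφ'.div_const _

end SmallPert
end KernelBounds

section Neumann
open Metric Set Topology MeasureTheory

/-- Holomorphic functions on the half-bands with quadratic decay. -/
def BandFun (a : ℝ) (u : ℂ → ℂ) : Prop :=
  DifferentiableOn ℂ u bandO ∧ ∀ z ∈ bandO, ‖u z‖ ≤ a / ‖z‖ ^ 2

theorem BandFun.add {a b : ℝ} {u v : ℂ → ℂ} (hu : BandFun a u) (hv : BandFun b v) :
    BandFun (a + b) (u + v) :=
  ⟨hu.1.add hv.1, fun z hz => (norm_add_le _ _).trans
    ((add_le_add (hu.2 z hz) (hv.2 z hz)).trans (by rw [add_div]))⟩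

theorem BandFun.neg {a : ℝ} {u : ℂ → ℂ} (hu : BandFun a u) : BandFun a (-u) :=
  ⟨hu.1.neg, fun z hz => by rw [Pi.neg_apply, norm_neg]; exact hu.2 z hz⟩

theorem BandFun.mono {a b : ℝ} {u : ℂ → ℂ} (hu : BandFun a u) (h : a ≤ b) : BandFun b u :=
  ⟨hu.1, fun z hz => (hu.2 z hz).trans (by gcongr)⟩

theorem sq_pos_of_bandO {z : ℂ} (hz : z ∈ bandO) : 1 ≤ ‖z‖ ^ 2 :=
  one_le_pow₀ (by linarith [norm_of_bandO hz])

/-- The Neumann series on `BandFun`. -/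
theorem exists_bandFun_fixed {T : (ℂ → ℂ) → ℂ → ℂ} {ε : ℝ} (hε : 0 ≤ ε)
    (hT : ∀ a u, 0 ≤ a → BandFun a u → BandFun (a / 2) (T u))
    (hadd : ∀ a b u v, 0 ≤ a → 0 ≤ b → BandFun a u → BandFun b v →
      ∀ Y ∈ bandO, T (u + v) Y = T u Y + T v Y)
    {φ : ℂ → ℂ} (hφ : BandFun ε φ) :
    ∃ u, BandFun (2 * ε) u ∧ ∀ Y ∈ bandO, u Y + T u Y = φ Y := by
  let D : ℕ → ℂ → ℂ := fun n => (fun u => -T u)^[n] φ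
  have hD0 : D 0 = φ := rfl
  have hDs : ∀ n, D (n + 1) = -T (D n) := fun n => Function.iterate_succ_apply' _ _ _
  have hD : ∀ n, BandFun (ε * (1 / 2) ^ n) (D n) := fun n => by
    induction n with
    | zero => simpa [hD0] using hφ
    | succ n ih =>
      rw [hDs]
      have := (hT _ _ (by positivity) ih).neg
      refine this.mono (le_of_eq ?_)
      ring
  have hDn : ∀ n, ∀ z ∈ bandO, ‖D n z‖ ≤ ε * (1 / 2) ^ n := fun n z hz =>
    ((hD n).2 z hz).trans (div_le_self (by positivity) (sq_pos_of_bandO hz))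
  have hgeo : Summable fun n : ℕ => ε * (1 / 2 : ℝ) ^ n :=
    (summable_geometric_of_lt_one (by norm_num) (by norm_num)).mul_left _
  have hsum : ∀ z ∈ bandO, Summable fun n => D n z := fun z hz =>
    Summable.of_norm_bounded hgeo fun n => hDn n z hz
  let u : ℂ → ℂ := fun z => ∑' n, D n z
  have hud : DifferentiableOn ℂ u bandO :=
    Complex.differentiableOn_tsum_of_summable_norm hgeo (fun n => (hD n).1) isOpen_bandO hDn
  have htail : ∀ n, BandFun (2 * (ε * (1 / 2) ^ n)) (u - ∑ k ∈ Finset.range n, D k) := fun n => by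
    refine ⟨hud.sub (DifferentiableOn.sum fun k _ => (hD k).1), fun z hz => ?_⟩
    have e : (u - ∑ k ∈ Finset.range n, D k) z = ∑' k, D (k + n) z := by
      rw [Pi.sub_apply, Finset.sum_apply, sub_eq_iff_eq_add']
      exact ((hsum z hz).sum_add_tsum_nat_add n).symm
    rw [e]
    have hs2 : HasSum (fun k : ℕ => ε * (1 / 2 : ℝ) ^ n / ‖z‖ ^ 2 * (1 / 2) ^ k)
        (ε * (1 / 2 : ℝ) ^ n / ‖z‖ ^ 2 * 2) := hasSum_geometric_two.mul_left _
    refine (tsum_of_norm_bounded hs2 fun k => ?_).trans (le_of_eq (by ring))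
    refine ((hD (k + n)).2 z hz).trans (le_of_eq ?_)
    rw [pow_add]; ring
  have hu : BandFun (2 * ε) u := by simpa using htail 0
  have hpart : ∀ n, ∃ a, 0 ≤ a ∧ BandFun a (∑ k ∈ Finset.range n, D k) := fun n => by
    induction n with
    | zero => exact ⟨0, le_rfl, by simp [BandFun, Pi.zero_def]⟩
    | succ n ih =>
      obtain ⟨a, ha, hb⟩ := ih
      rw [Finset.sum_range_succ]
      exact ⟨_, by positivity, hb.add (hD n)⟩
  have hT0 : ∀ Y ∈ bandO, T 0 Y = 0 := fun Y hY => by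
    have h0 : BandFun 0 (0 : ℂ → ℂ) := by simp [BandFun, Pi.zero_def]
    simpa using (hT 0 0 le_rfl h0).2 Y hY
  have hTp : ∀ n, ∀ Y ∈ bandO, (∑ k ∈ Finset.range n, D k) Y + T (∑ k ∈ Finset.range n, D k) Y
      = φ Y - D n Y := fun n Y hY => by
    induction n with
    | zero => simp [hT0 Y hY, hD0]
    | succ n ih =>
      obtain ⟨a, ha, hb⟩ := hpart n
      rw [Finset.sum_range_succ, hadd _ _ _ _ ha (by positivity) hb (hD n) Y hY, hDs, Pi.add_apply,
        Pi.neg_apply]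
      linear_combination ih
  refine ⟨u, hu, fun Y hY => ?_⟩
  have hle : ∀ n : ℕ, ‖u Y + T u Y - φ Y‖ ≤ 4 * (ε * (1 / 2) ^ n) := fun n => by
    obtain ⟨a, ha, hb⟩ := hpart n
    have e1 : T u Y = T (∑ k ∈ Finset.range n, D k) Y + T (u - ∑ k ∈ Finset.range n, D k) Y := by
      rw [← hadd _ _ _ _ ha (by positivity) hb (htail n) Y hY, add_sub_cancel]
    have e2 : u Y + T u Y - φ Y = (u - ∑ k ∈ Finset.range n, D k) Y
        + T (u - ∑ k ∈ Finset.range n, D k) Y - D n Y := by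
      rw [Pi.sub_apply]
      linear_combination e1 + hTp n Y hY
    have b1 := ((htail n).2 Y hY).trans (div_le_self (by positivity) (sq_pos_of_bandO hY))
    have b2 := ((hT _ _ (by positivity) (htail n)).2 Y hY).trans
      (div_le_self (by positivity) (sq_pos_of_bandO hY))
    have b3 := hDn n Y hY
    rw [e2]
    refine (norm_sub_le _ _).trans ((add_le_add (norm_add_le _ _) le_rfl).trans ?_)
    linarith
  have hlim : Tendsto (fun n : ℕ => 4 * (ε * (1 / 2 : ℝ) ^ n)) atTop (𝓝 0) := by
    have := (tendsto_pow_atTop_nhds_zero_of_lt_one (r := (1 / 2 : ℝ)) (by norm_num)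
      (by norm_num)).const_mul ε |>.const_mul 4
    simpa using this
  have := ge_of_tendsto' hlim hle
  exact sub_eq_zero.1 (norm_le_zero_iff.1 this)

/-- A kernel with quadratic decay, admissible for integration along contours in `V`. -/
structure IsKernel (K : ℂ → ℂ → ℂ) (V : Set ℂ) (b : ℝ) : Prop where
  isOpen : IsOpen V
  sub : V ⊆ bandO
  nonneg : 0 ≤ b
  cont : ∀ Y ∈ bandO, ContinuousOn (K Y) (V ∩ {Y}ᶜ)
  bound : ∀ Y ∈ bandO, ∀ ζ ∈ V, ‖K Y ζ‖ ≤ b / ‖Y‖ ^ 2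
  diff : ∀ ζ ∈ V, DifferentiableOn ℂ (fun Y => K Y ζ) bandO

namespace IsKernel

variable {K : ℂ → ℂ → ℂ} {V S : Set ℂ} {a b : ℝ} {γ ω : ℝ → ℂ} {u v : ℂ → ℂ}

theorem integrable (h : IsKernel K V b) (hc : IsContour γ ω S) (hS : S ⊆ V) (ha : 0 ≤ a)
    (hu : BandFun a u) {Y : ℂ} (hY : Y ∈ bandO) :
    Integrable fun t => ω t * (u (γ t) * K Y (γ t)) := by
  refine hc.integrable (F := fun z => u z * K Y z) (Y := Y) (b := a * (b / ‖Y‖ ^ 2))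
    (h.isOpen.inter isOpen_compl_singleton)
    ((hu.1.continuousOn.mono (inter_subset_left.trans h.sub)).mul (h.cont Y hY))
    (fun z hz hne => ⟨hS hz, hne⟩) (mul_nonneg ha (div_nonneg h.nonneg (by positivity)))
    fun z hz _ => ?_
  rw [norm_mul]
  have b1 := hu.2 z (h.sub (hS hz))
  have b2 := h.bound Y hY z (hS hz)
  refine (mul_le_mul b1 b2 (norm_nonneg _) (by positivity)).trans (le_of_eq (by ring))

theorem norm_integral_le (h : IsKernel K V b) (hc : IsContour γ ω S) (hS : S ⊆ V) (ha : 0 ≤ a)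
    (hu : BandFun a u) {Y : ℂ} (hY : Y ∈ bandO) :
    ‖∫ t, ω t * (u (γ t) * K Y (γ t))‖ ≤ 4 * (a * b) / ‖Y‖ ^ 2 := by
  refine (hc.norm_integral_le (F := fun z => u z * K Y z) (Y := Y) (b := a * (b / ‖Y‖ ^ 2))
    (mul_nonneg ha (div_nonneg h.nonneg (by positivity))) fun z hz _ => ?_).trans
    (le_of_eq (by ring))
  rw [norm_mul]
  have b1 := hu.2 z (h.sub (hS hz))
  have b2 := h.bound Y hY z (hS hz)
  refine (mul_le_mul b1 b2 (norm_nonneg _) (by positivity)).trans (le_of_eq (by ring))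

theorem differentiableOn_integral (h : IsKernel K V b) (hc : IsContour γ ω S) (hS : S ⊆ V)
    (ha : 0 ≤ a) (hu : BandFun a u) :
    DifferentiableOn ℂ (fun Y => ∫ t, ω t * (u (γ t) * K Y (γ t))) bandO := by
  refine differentiableOn_integral_param (F := fun Y t => ω t * (u (γ t) * K Y (γ t))) isOpen_bandO
    (fun Y hY => (h.integrable hc hS ha hu hY).aestronglyMeasurable) (ae_of_all _ fun t => ?_)
    (IsContour.integrable_bound (a * b)) (ae_of_all _ fun t Y hY => ?_)
  · by_cases h0 : ω t = 0
    · simp only [h0, zero_mul]; exact differentiableOn_const 0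
    · exact ((h.diff _ (hS (hc.mem t h0))).const_mul _).const_mul _
  · refine hc.bound_pointwise (F := fun z => u z * K Y z) (mul_nonneg ha h.nonneg) fun h0 => ?_
    have hz := hS (hc.mem t h0)
    rw [norm_mul]
    have b1 := hu.2 _ (h.sub hz)
    have b2 := (h.bound Y hY _ hz).trans (div_le_self h.nonneg (sq_pos_of_bandO hY))
    refine (mul_le_mul b1 b2 (norm_nonneg _) (by positivity)).trans (le_of_eq (by ring))

theorem integral_add (h : IsKernel K V b) (hc : IsContour γ ω S) (hS : S ⊆ V) {a' : ℝ}
    (ha : 0 ≤ a) (ha' : 0 ≤ a') (hu : BandFun a u) (hv : BandFun a' v) {Y : ℂ} (hY : Y ∈ bandO) :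
    ∫ t, ω t * ((u + v) (γ t) * K Y (γ t)) = (∫ t, ω t * (u (γ t) * K Y (γ t)))
      + ∫ t, ω t * (v (γ t) * K Y (γ t)) := by
  rw [← MeasureTheory.integral_add (h.integrable hc hS ha hu hY) (h.integrable hc hS ha' hv hY)]
  refine integral_congr_ae (ae_of_all _ fun t => ?_)
  simp only [Pi.add_apply]
  ring

end IsKernel

theorem SmallPert.isKernel_KP {ε : ℝ} {φ : ℂ → ℂ} (h : SmallPert ε φ) {s : ℝ} (hs : 2 ≤ s) :
    IsKernel (KP s φ) bandO (32 * ε) where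
  isOpen := isOpen_bandO
  sub := Subset.rfl
  nonneg := by have := h.pos; positivity
  cont Y hY := (h.continuousOn_KP hs hY).mono inter_subset_left
  bound Y hY ζ hζ := h.norm_KP_le hs hY hζ
  diff ζ hζ := h.differentiableOn_KP hs hζ

theorem SmallPert.isKernel_KM {ε : ℝ} {φ : ℂ → ℂ} (h : SmallPert ε φ) {s R : ℝ} (hs : 2 ≤ s)
    (hR : 0 ≤ R) (hreg : ∀ y w : ℂ, -(7 / 4 * s) < y.re → y.re < 3 / 4 * s → -(7 / 4 * s) < w.re →
      w.re < 3 / 4 * s → ‖regK s y - regK s w‖ ≤ R * ‖y - w‖) :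
    IsKernel (KM s φ) bandL ((100000 + R) * ε) where
  isOpen := isOpen_bandL
  sub := inter_subset_left
  nonneg := by have := h.pos; positivity
  cont Y hY := h.continuousOn_KM hs hY
  bound Y hY ζ hζ := h.norm_KM_le hs hR hreg hY hζ
  diff ζ hζ := h.differentiableOn_KM hs hζ

theorem suppP_subset_bandO : suppP ⊆ bandO := suppP_subset_bandC.trans bandC_subset_bandO

/-- The density solving the linear integral equation of the gluing problem. -/
theorem SmallPert.exists_density {ε : ℝ} {φ : ℂ → ℂ} (h : SmallPert ε φ) {s R : ℝ} (hs : 2 ≤ s)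
    (hR : 0 ≤ R) (hεR : (200000 + R) * ε ≤ 1 / 2)
    (hreg : ∀ y w : ℂ, -(7 / 4 * s) < y.re → y.re < 3 / 4 * s → -(7 / 4 * s) < w.re →
      w.re < 3 / 4 * s → ‖regK s y - regK s w‖ ≤ R * ‖y - w‖) :
    ∃ u, BandFun (2 * ε) u ∧ ∀ Y ∈ bandO, u Y + 1 / (2 * π * Complex.I) *
      ((∫ t, omP t * (u (gamP t) * KP s φ Y (gamP t)))
        + ∫ t, omM t * (u (gamM t) * KM s φ Y (gamM t))) = φ Y := by
  have kP := h.isKernel_KP hs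
  have kM := h.isKernel_KM hs hR hreg
  have hpos := h.pos
  refine exists_bandFun_fixed (T := fun u Y => 1 / (2 * π * Complex.I) *
      ((∫ t, omP t * (u (gamP t) * KP s φ Y (gamP t)))
        + ∫ t, omM t * (u (gamM t) * KM s φ Y (gamM t)))) hpos.le (fun a u ha hu => ⟨?_, ?_⟩)
    (fun a b u v ha hb hu hv Y hY => ?_)
    ⟨h.diff.mono bandO_subset_bandW, fun z hz => h.bound_sq (bandO_subset_bandW hz)⟩
  · exact ((kP.differentiableOn_integral isContour_P suppP_subset_bandO ha hu).add
      (kM.differentiableOn_integral isContour_M suppM_subset_bandL ha hu)).const_mul _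
  · intro Y hY
    have b1 := kP.norm_integral_le isContour_P suppP_subset_bandO ha hu hY
    have b2 := kM.norm_integral_le isContour_M suppM_subset_bandL ha hu hY
    have hpi : ‖(1 / (2 * π * Complex.I) : ℂ)‖ ≤ 1 / 4 := by
      rw [norm_div, norm_mul, norm_mul, Complex.norm_I, Complex.norm_real, norm_one,
        Real.norm_of_nonneg Real.pi_pos.le]
      norm_num
      have := Real.pi_gt_three
      have : π⁻¹ ≤ 3⁻¹ := by gcongr
      linarith
    rw [norm_mul]
    have b3 := (norm_add_le _ _).trans (add_le_add b1 b2)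
    refine (mul_le_mul hpi b3 (norm_nonneg _) (by norm_num)).trans ?_
    have e : 1 / 4 * (4 * (a * (32 * ε)) / ‖Y‖ ^ 2 + 4 * (a * ((100000 + R) * ε)) / ‖Y‖ ^ 2)
      = a * ((100032 + R) * ε) / ‖Y‖ ^ 2 := by ring
    rw [e]
    have : a * ((100032 + R) * ε) ≤ a / 2 := by nlinarith
    gcongr
  · rw [kP.integral_add isContour_P suppP_subset_bandO ha hb hu hv hY,
      kM.integral_add isContour_M suppM_subset_bandL ha hb hu hv hY]
    ring

end Neumann

section Gluing
open Metric Set Topology MeasureTheory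

/-- The domain of the gluing map. -/
def glueO (s : ℝ) : Set ℂ :=
  {X | (-1 / 8 < X.re ∧ X.re < s + 9 / 8) ∧ 5 / 2 < ‖X‖ ∧ 5 / 2 < ‖X - s‖}

theorem isOpen_glueO (s : ℝ) : IsOpen (glueO s) :=
  ((isOpen_lt continuous_const Complex.continuous_re).inter
    (isOpen_lt Complex.continuous_re continuous_const)).inter
    ((isOpen_lt continuous_const continuous_norm).inter
      (isOpen_lt continuous_const (continuous_id.sub continuous_const).norm))

/-- A bounded family of kernels, holomorphic in the parameter. -/
structure IsBddKernel (N : ℂ → ℂ → ℂ) (U S : Set ℂ) (b : ℝ) : Prop where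
  isOpen : IsOpen U
  nonneg : 0 ≤ b
  cont : ∀ X ∈ U, ∃ V, IsOpen V ∧ S ⊆ V ∧ V ⊆ bandO ∧ ContinuousOn (N X) V
  bound : ∀ X ∈ U, ∀ ζ ∈ S, ‖N X ζ‖ ≤ b
  diff : ∀ ζ ∈ S, DifferentiableOn ℂ (fun X => N X ζ) U

namespace IsBddKernel

variable {N : ℂ → ℂ → ℂ} {U S : Set ℂ} {a b : ℝ} {γ ω : ℝ → ℂ} {u : ℂ → ℂ}

theorem subset_bandO (h : IsBddKernel N U S b) {X : ℂ} (hX : X ∈ U) : S ⊆ bandO := by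
  obtain ⟨V, _, h1, h2, _⟩ := h.cont X hX
  exact h1.trans h2

theorem norm_mul_le (h : IsBddKernel N U S b) (ha : 0 ≤ a)
    (hu : BandFun a u) {X : ℂ} (hX : X ∈ U) {ζ : ℂ} (hζ : ζ ∈ S) :
    ‖u ζ * N X ζ‖ ≤ a * b / ‖ζ‖ ^ 2 := by
  rw [norm_mul]
  have b1 := hu.2 ζ (h.subset_bandO hX hζ)
  exact (mul_le_mul b1 (h.bound X hX ζ hζ) (norm_nonneg _) (by positivity)).trans
    (le_of_eq (by ring))

theorem integrable (h : IsBddKernel N U S b) (hc : IsContour γ ω S) (ha : 0 ≤ a)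
    (hu : BandFun a u) {X : ℂ} (hX : X ∈ U) :
    Integrable fun t => ω t * (u (γ t) * N X (γ t)) := by
  obtain ⟨V, hV, h1, h2, h3⟩ := h.cont X hX
  exact hc.integrable (F := fun z => u z * N X z) (Y := 0) hV ((hu.1.continuousOn.mono h2).mul h3)
    (fun z hz _ => h1 hz) (mul_nonneg ha h.nonneg) fun z hz _ => h.norm_mul_le ha hu hX hz

theorem norm_integral_le (h : IsBddKernel N U S b) (hc : IsContour γ ω S) (ha : 0 ≤ a)
    (hu : BandFun a u) {X : ℂ} (hX : X ∈ U) :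
    ‖∫ t, ω t * (u (γ t) * N X (γ t))‖ ≤ 4 * (a * b) :=
  hc.norm_integral_le (F := fun z => u z * N X z) (Y := 0) (mul_nonneg ha h.nonneg)
    fun _ hz _ => h.norm_mul_le ha hu hX hz

theorem bound_pointwise (h : IsBddKernel N U S b) (hc : IsContour γ ω S) (ha : 0 ≤ a)
    (hu : BandFun a u) {X : ℂ} (hX : X ∈ U) (t : ℝ) :
    ‖ω t * (u (γ t) * N X (γ t))‖ ≤ 5 / 4 * (a * b) * (1 + t ^ 2)⁻¹ :=
  hc.bound_pointwise (F := fun z => u z * N X z) (mul_nonneg ha h.nonneg) fun h0 =>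
    h.norm_mul_le ha hu hX (hc.mem t h0)

theorem differentiableOn_integral (h : IsBddKernel N U S b) (hc : IsContour γ ω S)
    (ha : 0 ≤ a) (hu : BandFun a u) :
    DifferentiableOn ℂ (fun X => ∫ t, ω t * (u (γ t) * N X (γ t))) U := by
  refine differentiableOn_integral_param (F := fun X t => ω t * (u (γ t) * N X (γ t))) h.isOpen
    (fun X hX => (h.integrable hc ha hu hX).aestronglyMeasurable) (ae_of_all _ fun t => ?_)
    (IsContour.integrable_bound (a * b)) (ae_of_all _ fun t X hX =>
      h.bound_pointwise hc ha hu hX t)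
  by_cases h0 : ω t = 0
  · simp only [h0, zero_mul]; exact differentiableOn_const 0
  · exact ((h.diff _ (hc.mem t h0)).const_mul _).const_mul _

theorem tendsto_integral (h : IsBddKernel N U S b) (hc : IsContour γ ω S) (ha : 0 ≤ a)
    (hu : BandFun a u) {X : ℝ → ℂ} (hX : ∀ᶠ T in atTop, X T ∈ U) {l : ℂ}
    (hl : ∀ ζ ∈ S, Tendsto (fun T => N (X T) ζ) atTop (𝓝 l)) :
    Tendsto (fun T => ∫ t, ω t * (u (γ t) * N (X T) (γ t))) atTop
      (𝓝 (∫ t, ω t * (u (γ t) * l))) := by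
  refine tendsto_integral_filter_of_dominated_convergence
    (fun t => 5 / 4 * (a * b) * (1 + t ^ 2)⁻¹)
    (hX.mono fun T hT => (h.integrable hc ha hu hT).aestronglyMeasurable)
    (hX.mono fun T hT => ae_of_all _ (h.bound_pointwise hc ha hu hT))
    (IsContour.integrable_bound (a * b)) (ae_of_all _ fun t => ?_)
  by_cases h0 : ω t = 0
  · simp [h0]
  · exact ((hl _ (hc.mem t h0)).const_mul _).const_mul _

end IsBddKernel

/-- The kernel of the gluing map on the right contour. -/
noncomputable def NP (s : ℝ) (X ζ : ℂ) : ℂ := 1 / (ζ + s - X)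

/-- The kernel of the gluing map on the left contour. -/
noncomputable def NM (s : ℝ) (φ : ℂ → ℂ) (X ζ : ℂ) : ℂ :=
  (1 + deriv φ ζ) / (ζ + φ ζ - X) + deriv φ ζ / X + regK s (ζ - X)

theorem eighth_le_norm_NP {s : ℝ} {X ζ : ℂ} (hX : X ∈ glueO s) (hζ : ζ ∈ suppP) :
    1 / 8 ≤ ‖ζ + s - X‖ := by
  rcases hζ.2.2.2 with h | h
  · refine le_trans ?_ ((le_abs_self _).trans (Complex.abs_re_le_norm _))
    simp only [Complex.sub_re, Complex.add_re, Complex.ofReal_re]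
    linarith [hX.1.2]
  · have h1 : ‖ζ‖ ≤ 19 / 8 := by
      refine le_of_sq_le_sq ?_ (by norm_num)
      rw [norm_sq_eq, ← sq_abs ζ.im, h]
      nlinarith [hζ.1, hζ.2.1]
    have h2 := norm_sub_norm_le (X - s) ζ
    have e : X - s - ζ = -(ζ + s - X) := by ring
    rw [e, norm_neg] at h2
    linarith [hX.2.2]

theorem isBddKernel_NP {s : ℝ} : IsBddKernel (NP s) (glueO s) suppP 8 where
  isOpen := isOpen_glueO s
  nonneg := by norm_num
  cont X hX := by
    refine ⟨bandO ∩ {ζ | ζ + s - X ≠ 0}, isOpen_bandO.inter (isOpen_ne_fun (by fun_prop)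
      continuous_const), fun ζ hζ => ⟨suppP_subset_bandO hζ, ?_⟩, inter_subset_left, ?_⟩
    · exact norm_pos_iff.1 (by linarith [eighth_le_norm_NP hX hζ])
    · exact continuousOn_const.div (by fun_prop) fun ζ hζ => hζ.2
  bound X hX ζ hζ := by
    have := eighth_le_norm_NP hX hζ
    rw [NP, norm_div, norm_one, div_le_iff₀ (by linarith)]
    linarith
  diff ζ hζ := (differentiableOn_const 1).div (by fun_prop) fun X hX =>
    norm_pos_iff.1 (by linarith [eighth_le_norm_NP hX hζ])

namespace SmallPert

variable {ε : ℝ} {φ : ℂ → ℂ}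

theorem le_norm_NM (h : SmallPert ε φ) {s : ℝ} {X ζ : ℂ} (hX : X ∈ glueO s) (hζ : ζ ∈ bandO)
    (h5 : ζ.re < -1 / 5) : 1 / 14 ≤ ‖ζ + φ ζ - X‖ := by
  refine le_trans ?_ ((neg_le_abs _).trans (Complex.abs_re_le_norm _))
  have := abs_le.1 (h.abs_re_le (bandO_subset_bandW hζ))
  simp only [Complex.sub_re, Complex.add_re]
  linarith [hX.1.1, this.2]

theorem isBddKernel_NM (h : SmallPert ε φ) {s R : ℝ} (hs : 2 ≤ s) (hR : 0 ≤ R)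
    (hreg : ∀ y : ℂ, -(15 / 8 * s) ≤ y.re → y.re ≤ 7 / 8 * s → ‖regK s y‖ ≤ R) :
    IsBddKernel (NM s φ) (glueO s) suppM (30 + R) := by
  have hS : ∀ ζ ∈ suppM, ζ ∈ bandO ∧ ζ.re < -1 / 5 := fun ζ hζ =>
    ⟨bandC_subset_bandO (suppM_subset_bandC hζ), by rw [hζ.1]; norm_num⟩
  have hre : ∀ X ∈ glueO s, ∀ ζ : ℂ, ζ ∈ bandO → ζ.re < -1 / 5 →
      -(15 / 8 * s) ≤ (ζ - X).re ∧ (ζ - X).re ≤ 0 := fun X hX ζ h1 h2 => by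
    simp only [Complex.sub_re]
    constructor
    · linarith [hX.1.2, h1.1.1]
    · linarith [hX.1.1]
  have hX0 : ∀ X ∈ glueO s, X ≠ 0 := fun X hX => norm_pos_iff.1 (by linarith [hX.2.1])
  have hr := differentiableOn_regK (show 0 < s by linarith)
  refine ⟨isOpen_glueO s, by linarith, fun X hX => ?_, fun X hX ζ hζ => ?_, fun ζ hζ => ?_⟩
  · have sub : bandO ∩ {ζ | ζ.re < -1 / 5} ⊆ bandW := inter_subset_left.trans bandO_subset_bandW
    have hφ := h.diff.continuousOn.mono sub
    have hφ' := h.continuousOn_deriv.mono sub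
    refine ⟨bandO ∩ {ζ | ζ.re < -1 / 5},
      isOpen_bandO.inter (isOpen_lt Complex.continuous_re continuous_const), hS,
      inter_subset_left, ?_⟩
    unfold NM
    refine ((ContinuousOn.div (by fun_prop) (by fun_prop) fun ζ hζ => ?_).add
      (hφ'.div_const _)).add (hr.continuousOn.comp (by fun_prop) fun ζ hζ => ?_)
    · exact norm_pos_iff.1 (by linarith [h.le_norm_NM hX hζ.1 hζ.2])
    · have := hre X hX ζ hζ.1 hζ.2
      exact ⟨by linarith, by linarith⟩
  · obtain ⟨h1, h2⟩ := hS ζ hζ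
    have h3 := h.le_norm_NM hX h1 h2
    have h4 := hre X hX ζ h1 h2
    have h5 := hreg (ζ - X) h4.1 (by linarith)
    have h6 := h.deriv_bound' (bandO_subset_bandW h1)
    have h7 : ‖1 + deriv φ ζ‖ ≤ 2 := (norm_add_le _ _).trans (by
      rw [norm_one]; linarith [h.le])
    have b1 : ‖(1 + deriv φ ζ) / (ζ + φ ζ - X)‖ ≤ 28 := by
      rw [norm_div, div_le_iff₀ (by linarith)]; linarith
    have b2 : ‖deriv φ ζ / X‖ ≤ 2 := by
      rw [norm_div, div_le_iff₀ (by linarith [hX.2.1])]; linarith [h.le, hX.2.1]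
    rw [NM]
    refine (norm_add_le _ _).trans ((add_le_add (norm_add_le _ _) h5).trans ?_)
    linarith
  · obtain ⟨h1, h2⟩ := hS ζ hζ
    unfold NM
    refine (((differentiableOn_const _).div (by fun_prop) fun X hX => ?_).add
      ((differentiableOn_const _).div (by fun_prop) hX0)).add
      (hr.comp (by fun_prop) fun X hX => ?_)
    · exact norm_pos_iff.1 (by linarith [h.le_norm_NM hX h1 h2])
    · have := hre X hX ζ h1 h2
      exact ⟨by linarith, by linarith⟩

/-- The algebraic identity between the kernels of the gluing map and those of the integral
equation. -/
theorem NM_sub (h : SmallPert ε φ) {s : ℝ} (hs : 2 ≤ s) {Y ζ : ℂ} (hY : Y ∈ bandO)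
    (hζ : ζ ∈ bandO) (h1 : -s < (ζ - Y).re) (h2 : (ζ - Y).re < 0) :
    NM s φ (Y + s) ζ - NM s φ (Y + φ Y) ζ
      = KM s φ Y ζ - (1 / (ζ - Y) - 1 / (ζ + s - Y)) := by
  have hne : ζ ≠ Y := fun h0 => by rw [h0, sub_self] at h2; simp at h2
  have e1 := regK_sub (show 0 < s by linarith) h1 h2
  have e2 := h.sK_eq (bandO_subset_bandW hζ) (bandO_subset_bandW hY) hne
  have e3 : ζ - (Y + s) = ζ - Y - s := by ring
  have e4 : ζ + (s : ℂ) - Y = ζ - Y + s := by ring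
  rw [NM, NM, KM, dK, e2, e3, e4]
  linear_combination e1

end SmallPert

theorem tendsto_add_mul_I (x : ℝ) (ζ : ℂ) :
    Tendsto (fun T : ℝ => ζ - ((x : ℂ) + T * Complex.I)) atTop (comap Complex.im atBot) := by
  rw [tendsto_comap_iff]
  have e : (Complex.im ∘ fun T : ℝ => ζ - ((x : ℂ) + T * Complex.I)) = fun T => ζ.im - T := by
    ext T; simp
  rw [e]
  exact tendsto_atBot_add_const_left _ _ tendsto_neg_atTop_atBot

theorem tendsto_div_of_im {ζ c : ℂ} (x : ℝ) :
    Tendsto (fun T : ℝ => c / (ζ - ((x : ℂ) + T * Complex.I))) atTop (𝓝 0) := by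
  have h1 : Tendsto (fun T : ℝ => ‖ζ - ((x : ℂ) + T * Complex.I)‖) atTop atTop := by
    refine tendsto_atTop_mono (fun T => ?_) (tendsto_atTop_add_const_right _ (-ζ.im) tendsto_id)
    refine le_trans (le_of_eq ?_) ((neg_le_abs _).trans (Complex.abs_im_le_norm _))
    simp; ring
  have h2 := (tendsto_inv₀_cobounded (α := ℂ)).comp (tendsto_norm_atTop_iff_cobounded.1 h1)
  simpa [div_eq_mul_inv] using h2.const_mul c

theorem eventually_mem_glueO {s x : ℝ} (h0 : 0 < x) (h1 : x ≤ s + 1) :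
    ∀ᶠ T : ℝ in atTop, (x : ℂ) + T * Complex.I ∈ glueO s := by
  filter_upwards [eventually_gt_atTop (5 / 2)] with T hT
  have e1 : ((x : ℂ) + T * Complex.I).re = x := by simp
  have e2 : ((x : ℂ) + T * Complex.I).im = T := by simp
  have e3 : ((x : ℂ) + T * Complex.I - s).im = T := by simp
  refine ⟨⟨by rw [e1]; linarith, by rw [e1]; linarith⟩, ?_, ?_⟩
  · refine hT.trans_le ((le_abs_self _).trans ?_)
    have := Complex.abs_im_le_norm ((x : ℂ) + T * Complex.I)
    rwa [e2] at this
  · refine hT.trans_le ((le_abs_self _).trans ?_)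
    have := Complex.abs_im_le_norm ((x : ℂ) + T * Complex.I - s)
    rwa [e3] at this

/-- The gluing map for a small perturbation. -/
theorem SmallPert.exists_glue {ε : ℝ} {φ : ℂ → ℂ} (h : SmallPert ε φ) {s R : ℝ} (hs : 2 ≤ s)
    (hR : 0 ≤ R) (hεR : (200000 + R) * ε ≤ 1 / 2000)
    (hreg0 : ∀ y : ℂ, -(15 / 8 * s) ≤ y.re → y.re ≤ 7 / 8 * s → ‖regK s y‖ ≤ R)
    (hreg : ∀ y w : ℂ, -(7 / 4 * s) < y.re → y.re < 3 / 4 * s → -(7 / 4 * s) < w.re →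
      w.re < 3 / 4 * s → ‖regK s y - regK s w‖ ≤ R * ‖y - w‖) :
    ∃ m : ℂ → ℂ, DifferentiableOn ℂ m (glueO s) ∧ (∀ X ∈ glueO s, ‖m X‖ ≤ 1 / 1000) ∧
      (∀ Y : ℂ, -1 / 12 < Y.re → Y.re < 13 / 12 → 3 < |Y.im| →
        m (Y + s) - m (Y + φ Y) = φ Y) ∧
      ∃ L, ∀ x : ℝ, 0 < x → x ≤ s + 1 →
        Tendsto (fun T : ℝ => m ((x : ℂ) + T * Complex.I)) atTop (𝓝 L) := by
  have hpos := h.pos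
  obtain ⟨u, hu, hfix⟩ := h.exists_density hs hR (by linarith) hreg
  have ha : 0 ≤ 2 * ε := by linarith
  have kP := isBddKernel_NP (s := s)
  have kM := h.isBddKernel_NM hs hR hreg0
  have KPk := h.isKernel_KP hs
  have KMk := h.isKernel_KM hs hR hreg
  have h2pi : (2 * π * Complex.I : ℂ) ≠ 0 := Complex.two_pi_I_ne_zero
  refine ⟨fun X => 1 / (2 * π * Complex.I) * ((∫ t, omP t * (u (gamP t) * NP s X (gamP t)))
    + ∫ t, omM t * (u (gamM t) * NM s φ X (gamM t))),
    ((kP.differentiableOn_integral isContour_P ha hu).add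
      (kM.differentiableOn_integral isContour_M ha hu)).const_mul _, fun X hX => ?_,
    fun Y h1 h2 h3 => ?_, 1 / (2 * π * Complex.I) * ((∫ t, omP t * (u (gamP t) * 0))
    + ∫ t, omM t * (u (gamM t) * (((π / s : ℝ) : ℂ) * Complex.I))), fun x hx0 hx1 => ?_⟩
  · have b1 := kP.norm_integral_le isContour_P ha hu hX
    have b2 := kM.norm_integral_le isContour_M ha hu hX
    have hpi : ‖(1 / (2 * π * Complex.I) : ℂ)‖ ≤ 1 / 4 := by
      rw [norm_div, norm_mul, norm_mul, Complex.norm_I, Complex.norm_real, norm_one,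
        Real.norm_of_nonneg Real.pi_pos.le]
      norm_num
      have := Real.pi_gt_three
      have : π⁻¹ ≤ 3⁻¹ := by gcongr
      linarith
    rw [norm_mul]
    refine (mul_le_mul hpi ((norm_add_le _ _).trans (add_le_add b1 b2)) (norm_nonneg _)
      (by norm_num)).trans ?_
    nlinarith
  · have hYO : Y ∈ bandO := ⟨⟨by linarith, by linarith⟩, by linarith⟩
    have hYW := bandO_subset_bandW hYO
    have hφ1 := abs_le.1 (h.abs_re_le hYW)
    have hφn := (h.bound' hYW).trans h.le
    have hX1 : Y + (s : ℂ) ∈ glueO s := by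
      refine ⟨⟨?_, ?_⟩, ?_, ?_⟩
      · simp only [Complex.add_re, Complex.ofReal_re]; linarith
      · simp only [Complex.add_re, Complex.ofReal_re]; linarith
      · have := Complex.abs_im_le_norm (Y + s)
        simp only [Complex.add_im, Complex.ofReal_im, add_zero] at this
        linarith
      · rw [add_sub_cancel_right]
        linarith [Complex.abs_im_le_norm Y]
    have him : 5 / 2 < |(Y + φ Y).im| := by
      have i1 := (Complex.abs_im_le_norm (φ Y)).trans hφn
      have i2 := abs_sub_abs_le_abs_sub Y.im (-(φ Y).im)
      rw [sub_neg_eq_add, abs_neg] at i2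
      rw [Complex.add_im]; linarith
    have hX2 : Y + φ Y ∈ glueO s := by
      refine ⟨⟨?_, ?_⟩, him.trans_le (Complex.abs_im_le_norm _), ?_⟩
      · simp only [Complex.add_re]; linarith [hφ1.1]
      · simp only [Complex.add_re]; linarith [hφ1.2]
      · have := Complex.abs_im_le_norm (Y + φ Y - s)
        simp only [Complex.sub_im, Complex.ofReal_im, sub_zero] at this
        exact him.trans_le this
    have cauchy := band_cauchy (Y := Y) hu.1 ha hu.2 hs (by linarith) (by linarith) (by linarith)
    obtain ⟨cP, cM⟩ : Integrable (fun t => omP t * (u (gamP t) *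
        (1 / (gamP t - Y) - 1 / (gamP t + s - Y)))) ∧ Integrable (fun t => omM t * (u (gamM t) *
        (1 / (gamM t - Y) - 1 / (gamM t + s - Y)))) :=
      ⟨band_cauchy_integrable (Y := Y) hu.1 ha hu.2 hs (by linarith) (by linarith) (by linarith)
        isContour_P subset_union_left,
       band_cauchy_integrable (Y := Y) hu.1 ha hu.2 hs (by linarith) (by linarith) (by linarith)
        isContour_M subset_union_right⟩
    have iP : (∫ t, omP t * (u (gamP t) * NP s (Y + s) (gamP t)))
        - (∫ t, omP t * (u (gamP t) * NP s (Y + φ Y) (gamP t)))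
        = (∫ t, omP t * (u (gamP t) * (1 / (gamP t - Y) - 1 / (gamP t + s - Y))))
          + ∫ t, omP t * (u (gamP t) * KP s φ Y (gamP t)) := by
      rw [← integral_sub (kP.integrable isContour_P ha hu hX1)
        (kP.integrable isContour_P ha hu hX2), ← integral_add cP
        (KPk.integrable isContour_P suppP_subset_bandO ha hu hYO)]
      refine integral_congr_ae (ae_of_all _ fun t => ?_)
      simp only [NP, KP]
      rw [show gamP t + (s : ℂ) - (Y + s) = gamP t - Y by ring]
      ring
    have iM : (∫ t, omM t * (u (gamM t) * NM s φ (Y + s) (gamM t)))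
        - (∫ t, omM t * (u (gamM t) * NM s φ (Y + φ Y) (gamM t)))
        = (∫ t, omM t * (u (gamM t) * KM s φ Y (gamM t)))
          - ∫ t, omM t * (u (gamM t) * (1 / (gamM t - Y) - 1 / (gamM t + s - Y))) := by
      rw [← integral_sub (kM.integrable isContour_M ha hu hX1)
        (kM.integrable isContour_M ha hu hX2), ← integral_sub
        (KMk.integrable isContour_M suppM_subset_bandL ha hu hYO) cM]
      refine integral_congr_ae (ae_of_all _ fun t => ?_)
      by_cases h0 : omM t = 0
      · simp [h0]
      · have hS := isContour_M.mem t h0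
        have hre : (gamM t - Y).re = -1 / 4 - Y.re := by rw [Complex.sub_re, hS.1]
        have := h.NM_sub hs hYO (suppM_subset_bandL hS).1 (by rw [hre]; linarith)
          (by rw [hre]; linarith)
        simp only
        linear_combination (omM t * u (gamM t)) * this
    have hf := hfix Y hYO
    have e : ∀ A B C D : ℂ, 1 / (2 * π * Complex.I) * (A + B) - 1 / (2 * π * Complex.I) * (C + D)
      = 1 / (2 * π * Complex.I) * ((A - C) + (B - D)) := fun A B C D => by ring
    simp only
    rw [e, iP, iM]
    rw [← hf]
    have e2 : u Y = 1 / (2 * π * Complex.I) * (2 * π * Complex.I * u Y) := by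
      field_simp
    rw [e2, ← cauchy]
    ring
  · have hX := eventually_mem_glueO hx0 hx1
    refine ((kP.tendsto_integral isContour_P ha hu hX fun ζ hζ => ?_).add
      (kM.tendsto_integral isContour_M ha hu hX fun ζ hζ => ?_)).const_mul _
    · exact tendsto_div_of_im x
    · have t1 := tendsto_div_of_im (ζ := ζ + φ ζ) (c := 1 + deriv φ ζ) x
      have t2 := tendsto_div_of_im (ζ := 0) (c := -deriv φ ζ) x
      have t3 := (tendsto_regK (show 0 < s by linarith)).comp (tendsto_add_mul_I x ζ)
      have t4 := (t1.add t2).add t3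
      rw [add_zero, zero_add] at t4
      refine t4.congr fun T => ?_
      simp only [NM, zero_sub, neg_div_neg_eq, Function.comp_apply]

/-- The gluing lemma with a uniform constant. -/
theorem exists_glue : ∃ ε > 0, ε ≤ 1 / 1000 ∧ ∀ s : ℝ, 2 ≤ s → ∀ φ : ℂ → ℂ,
    DifferentiableOn ℂ φ {X | 1 < |X.im|} →
    (∀ X : ℂ, 1 < |X.im| → |X.re| ≤ 3 → ‖φ X‖ ≤ ε / ‖X‖ ^ 4) →
    ∃ m : ℂ → ℂ, DifferentiableOn ℂ m (glueO s) ∧ (∀ X ∈ glueO s, ‖m X‖ ≤ 1 / 1000) ∧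
      (∀ Y : ℂ, -1 / 12 < Y.re → Y.re < 13 / 12 → 3 < |Y.im| →
        m (Y + s) - m (Y + φ Y) = φ Y) ∧
      ∃ L, ∀ x : ℝ, 0 < x → x ≤ s + 1 →
        Tendsto (fun T : ℝ => m ((x : ℂ) + T * Complex.I)) atTop (𝓝 L) := by
  obtain ⟨R, hR, hreg⟩ := exists_regK_bounds
  set ε₀ : ℝ := 1 / (2000 * (200000 + R)) with hε₀
  have hε₀p : 0 < ε₀ := by positivity
  have hε₀m : (200000 + R) * ε₀ = 1 / 2000 := by rw [hε₀]; field_simp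
  have hε₀l : ε₀ ≤ 1 / 1000 := by nlinarith
  refine ⟨ε₀ / 11, by positivity, by linarith, fun s hs φ hφ hb => ?_⟩
  have hWU : bandW ⊆ {X : ℂ | 1 < |X.im|} := fun z hz => by
    simp only [mem_ofPred_eq]; linarith [hz.2]
  have hWb : ∀ z ∈ bandW, ∀ w ∈ ball z (1 / 2), 1 < |w.im| ∧ |w.re| ≤ 3 := fun z hz w hw => by
    rw [mem_ball, dist_eq_norm] at hw
    have h1 := (Complex.abs_re_le_norm (w - z)).trans_lt hw
    have h2 := ((abs_sub_abs_le_abs_sub z.im w.im).trans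
      (by rw [abs_sub_comm, ← Complex.sub_im]; exact Complex.abs_im_le_norm (w - z))).trans_lt hw
    rw [Complex.sub_re, abs_lt] at h1
    exact ⟨by linarith [hz.2], abs_le.2 ⟨by linarith [hz.1.1, h1.1], by linarith [hz.1.2, h1.2]⟩⟩
  have hsp : SmallPert ε₀ φ := by
    refine ⟨hε₀p, hε₀l, hφ.mono hWU, fun z hz => ?_, fun z hz => ?_⟩
    · obtain ⟨h1, h2⟩ := hWb z hz z (mem_ball_self (by norm_num))
      refine (hb z h1 h2).trans ?_
      gcongr
      linarith
    · have hn := one_le_norm_of_bandW hz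
      have hzp : 0 < ‖z‖ := by linarith
      have key := norm_deriv_le_of_ball (f := φ) (c := z) (R := 1 / 2)
        (C := 81 / 16 * (ε₀ / 11) / ‖z‖ ^ 4) (by norm_num)
        (hφ.mono fun w hw => (hWb z hz w hw).1) fun w hw => ?_
      · refine key.trans ?_
        have e : 81 / 16 * (ε₀ / 11) / ‖z‖ ^ 4 / (1 / 2) = 81 / 88 * (ε₀ / ‖z‖ ^ 4) := by ring
        have : 0 ≤ ε₀ / ‖z‖ ^ 4 := by positivity
        rw [e]; linarith
      · obtain ⟨h1, h2⟩ := hWb z hz w hw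
        rw [mem_ball, dist_eq_norm] at hw
        have h3 : 2 / 3 * ‖z‖ ≤ ‖w‖ := by
          have := norm_sub_norm_le z w
          rw [norm_sub_rev] at this
          linarith
        have h4 : 16 / 81 * ‖z‖ ^ 4 ≤ ‖w‖ ^ 4 := by
          have := pow_le_pow_left₀ (by positivity) h3 4
          rw [mul_pow] at this
          norm_num at this
          exact this
        have hwp : 0 < ‖w‖ := by linarith
        refine (hb w h1 h2).trans ?_
        rw [div_le_div_iff₀ (by positivity) (by positivity)]
        nlinarith
  obtain ⟨r1, r2⟩ := hreg s hs
  exact hsp.exists_glue hs hR.le hε₀m.le r1 fun y w a1 a2 a3 a4 => r2 y w a1 a2 a3 a4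

end Gluing

section Displacement
open Metric Set Topology MeasureTheory

/-- The data produced by the gluing lemma, for a periodic perturbation. -/
structure GlueData (s : ℝ) (φ m : ℂ → ℂ) (L : ℂ) : Prop where
  two_le : 2 ≤ s
  periodic : ∀ X, φ (X + 1) = φ X
  small : ∀ X, 1 < |X.im| → ‖φ X‖ ≤ 1 / 1000
  diff : DifferentiableOn ℂ m (glueO s)
  bound : ∀ X ∈ glueO s, ‖m X‖ ≤ 1 / 1000
  rel : ∀ Y : ℂ, -1 / 12 < Y.re → Y.re < 13 / 12 → 3 < |Y.im| → m (Y + s) - m (Y + φ Y) = φ Y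
  lim : ∀ x : ℝ, 0 < x → x ≤ s + 1 →
    Tendsto (fun T : ℝ => m ((x : ℂ) + T * Complex.I)) atTop (𝓝 L)

/-- The domain on which the translation by one is transported by the gluing map. -/
def glueI (s : ℝ) : Set ℂ :=
  {X | (-1 / 16 < X.re ∧ X.re < s + 1 / 16) ∧ 5 < ‖X‖ ∧ 5 < ‖X - s‖}

theorem ball_subset_glueO {s : ℝ} {W : ℂ} (hW : W ∈ glueI s) : ball W (1 / 16) ⊆ glueO s := by
  intro X hX
  rw [mem_ball, dist_eq_norm] at hX
  have h1 := (Complex.abs_re_le_norm (X - W)).trans_lt hX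
  rw [Complex.sub_re, abs_lt] at h1
  have h2 := norm_sub_norm_le W X
  have h3 := norm_sub_norm_le (W - s) (X - s)
  rw [sub_sub_sub_cancel_right] at h3
  rw [norm_sub_rev W X] at h2 h3
  exact ⟨⟨by linarith [hW.1.1], by linarith [hW.1.2]⟩, by linarith [hW.2.1], by linarith [hW.2.2]⟩

theorem mem_glueO_of_mem_glueI {s : ℝ} {W : ℂ} (hW : W ∈ glueI s) : W ∈ glueO s :=
  ball_subset_glueO hW (mem_ball_self (by norm_num))

theorem add_one_mem_glueO {s : ℝ} {W : ℂ} (hW : W ∈ glueI s) : W + 1 ∈ glueO s := by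
  have h2 := norm_sub_norm_le W (-1)
  have h3 := norm_sub_norm_le (W - s) (-1)
  have e : W - s - -1 = W + 1 - s := by ring
  rw [sub_neg_eq_add, norm_neg, norm_one] at h2
  rw [e, norm_neg, norm_one] at h3
  refine ⟨⟨?_, ?_⟩, by linarith [hW.2.1], by linarith [hW.2.2]⟩
  · simp only [Complex.add_re, Complex.one_re]; linarith [hW.1.1]
  · simp only [Complex.add_re, Complex.one_re]; linarith [hW.1.2]

namespace GlueData

variable {s : ℝ} {φ m : ℂ → ℂ} {L : ℂ}

theorem lipschitz (h : GlueData s φ m L) {W : ℂ} (hW : W ∈ glueI s) {x y : ℂ}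
    (hx : x ∈ ball W (1 / 32)) (hy : y ∈ ball W (1 / 32)) : ‖m x - m y‖ ≤ 1 / 2 * ‖x - y‖ := by
  have hsub := ball_subset_glueO hW
  refine lipschitz_of_deriv_le isOpen_ball (convex_ball W (1 / 32))
    (h.diff.mono ((ball_subset_ball (by norm_num)).trans hsub)) (fun z hz => ?_) hx hy
  refine (norm_deriv_le_of_ball_subset (R := 1 / 32) (by norm_num) h.diff h.bound
    (Subset.trans ?_ hsub)).trans (by norm_num)
  intro v hv
  rw [mem_ball] at *
  have := dist_triangle v z W
  linarith

theorem eq_of_map_eq (h : GlueData s φ m L) {W W' : ℂ} (hW : W ∈ glueI s) (hW' : W' ∈ glueO s)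
    (he : W + m W = W' + m W') : W = W' := by
  have e : W' - W = m W - m W' := by linear_combination -he
  have b1 := h.bound W (mem_glueO_of_mem_glueI hW)
  have b2 := h.bound W' hW'
  have b3 : ‖W' - W‖ ≤ 2 / 1000 := by
    rw [e]; exact (norm_sub_le _ _).trans (by linarith)
  have b4 := h.lipschitz hW (mem_ball_self (by norm_num) : W ∈ ball W (1 / 32))
    (show W' ∈ ball W (1 / 32) by rw [mem_ball, dist_eq_norm]; linarith)
  rw [← e, norm_sub_rev W W'] at b4
  have : ‖W' - W‖ = 0 := le_antisymm (by linarith) (norm_nonneg _)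
  exact (sub_eq_zero.1 (norm_eq_zero.1 this)).symm

theorem map_add (h : GlueData s φ m L) {Y : ℂ} (h1 : -1 / 12 < Y.re) (h2 : Y.re < 13 / 12)
    (h3 : 3 < |Y.im|) : Y + s + m (Y + s) = Y + φ Y + m (Y + φ Y) + s := by
  linear_combination h.rel Y h1 h2 h3

/-- The displacement is the same for two preimages in adjacent sheets. -/
theorem displacement_eq_of_shift (h : GlueData s φ m L) {W W' : ℂ} (hW : W ∈ glueI s)
    (hW' : W' ∈ glueI s) (he : W + m W = W' + m W' + s) :
    m (W + 1) - m W = m (W' + 1) - m W' := by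
  have b1 := h.bound W (mem_glueO_of_mem_glueI hW)
  have b2 := h.bound W' (mem_glueO_of_mem_glueI hW')
  have hs := h.two_le
  set Y : ℂ := W - s with hY
  have hWY : W = Y + s := by rw [hY]; ring
  have e : Y - W' = m W' - m W := by rw [hY]; linear_combination he
  have b3 : ‖Y - W'‖ ≤ 2 / 1000 := by
    rw [e]; exact (norm_sub_le _ _).trans (by linarith)
  have b4 := abs_le.1 ((Complex.abs_re_le_norm _).trans b3)
  rw [Complex.sub_re] at b4
  have hYre : Y.re = W.re - s := by rw [hY, Complex.sub_re, Complex.ofReal_re]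
  have r1 : -1 / 12 < Y.re := by linarith [hW'.1.1]
  have r2 : Y.re < 1 / 16 := by linarith [hW.1.2]
  have r3 : 3 < |Y.im| := by
    have := hW.2.2
    rw [← hY] at this
    have h2 := Complex.norm_le_abs_re_add_abs_im Y
    have h3 : |Y.re| ≤ 1 := abs_le.2 ⟨by linarith, by linarith⟩
    linarith
  have m1 := h.map_add r1 (by linarith) r3
  have hg : ‖φ Y‖ ≤ 1 / 1000 := h.small Y (by linarith)
  have hmem : Y + φ Y ∈ glueO s := by
    refine ball_subset_glueO hW' ?_
    rw [mem_ball, dist_eq_norm]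
    have e2 : Y + φ Y - W' = (Y - W') + φ Y := by ring
    rw [e2]
    exact (norm_add_le _ _).trans_lt (by linarith)
  have hW'g : W' = Y + φ Y := by
    refine h.eq_of_map_eq hW' hmem ?_
    rw [← hWY] at m1
    linear_combination m1 - he
  have q1 := h.rel Y r1 (by linarith) r3
  have q2 := h.rel (Y + 1) (by rw [Complex.add_re, Complex.one_re]; linarith)
    (by rw [Complex.add_re, Complex.one_re]; linarith)
    (by rwa [Complex.add_im, Complex.one_im, add_zero])
  rw [h.periodic, show Y + 1 + (s : ℂ) = W + 1 by rw [hWY]; ring,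
    show Y + 1 + φ Y = W' + 1 by rw [hW'g]; ring] at q2
  rw [← hWY, ← hW'g] at q1
  linear_combination q2 - q1

theorem displacement_unique (h : GlueData s φ m L) {W W' : ℂ} (hW : W ∈ glueI s)
    (hW' : W' ∈ glueI s) {j : ℤ} (he : W + m W = W' + m W' + j * s) :
    m (W + 1) - m W = m (W' + 1) - m W' := by
  have b1 := h.bound W (mem_glueO_of_mem_glueI hW)
  have b2 := h.bound W' (mem_glueO_of_mem_glueI hW')
  have hs := h.two_le
  have c1 := abs_le.1 ((Complex.abs_re_le_norm _).trans b1)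
  have c2 := abs_le.1 ((Complex.abs_re_le_norm _).trans b2)
  have hre := congrArg Complex.re he
  simp only [Complex.add_re, Complex.mul_re, Complex.intCast_re, Complex.ofReal_re,
    Complex.intCast_im, zero_mul, sub_zero] at hre
  have j1 : (j : ℝ) < 2 := by
    by_contra hj; push Not at hj
    nlinarith [hW.1.2, hW'.1.1]
  have j2 : (-2 : ℝ) < j := by
    by_contra hj; push Not at hj
    nlinarith [hW.1.1, hW'.1.2]
  have j1' : j < 2 := by exact_mod_cast j1
  have j2' : -2 < j := by exact_mod_cast j2
  have : j = -1 ∨ j = 0 ∨ j = 1 := by omega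
  rcases this with rfl | rfl | rfl
  · refine (h.displacement_eq_of_shift hW' hW ?_).symm
    push_cast at he
    linear_combination -he
  · have := h.eq_of_map_eq hW (mem_glueO_of_mem_glueI hW') (by simpa using he)
    rw [this]
  · exact h.displacement_eq_of_shift hW hW' (by simpa using he)

theorem exists_local_inverse (h : GlueData s φ m L) {V : ℂ} (hV : ∀ j : ℤ, 6 < ‖V + j * s‖) :
    ∃ (j : ℤ) (u : ℂ → ℂ), DifferentiableOn ℂ u (ball (V + j * s) (1 / 64)) ∧
      ∀ y ∈ ball (V + j * s) (1 / 64), u y ∈ glueI s ∧ u y + m (u y) = y := by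
  have hs := h.two_le
  have hs0 : 0 < s := by linarith
  set j : ℤ := -⌊V.re / s⌋ with hj
  set V₀ : ℂ := V + j * s with hV₀
  have hre : V₀.re = V.re + j * s := by simp [hV₀]
  have r1 : 0 ≤ V₀.re := by
    have := Int.floor_le (V.re / s)
    rw [le_div_iff₀ hs0] at this
    rw [hre, hj]; push_cast; linarith
  have r2 : V₀.re < s := by
    have := Int.lt_floor_add_one (V.re / s)
    rw [div_lt_iff₀ hs0] at this
    rw [hre, hj]; push_cast; linarith
  have n1 : 6 < ‖V₀‖ := hV j
  have n2 : 6 < ‖V₀ - s‖ := by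
    have := hV (j - 1)
    have e : V + ((j - 1 : ℤ) : ℂ) * s = V₀ - s := by rw [hV₀]; push_cast; ring
    rwa [e] at this
  have hsub : ball V₀ (1 / 32) ⊆ glueI s := fun X hX => by
    rw [mem_ball, dist_eq_norm] at hX
    have h1 := (Complex.abs_re_le_norm (X - V₀)).trans_lt hX
    rw [Complex.sub_re, abs_lt] at h1
    have h2 := norm_sub_norm_le V₀ X
    have h3 := norm_sub_norm_le (V₀ - s) (X - s)
    rw [sub_sub_sub_cancel_right] at h3
    rw [norm_sub_rev V₀ X] at h2 h3
    exact ⟨⟨by linarith, by linarith⟩, by linarith, by linarith⟩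
  have hV₀I := hsub (mem_ball_self (by norm_num))
  obtain ⟨u, hu, hu2⟩ := exists_inverse_near_id (c := V₀) (h := m) (a := 1 / 64) (b := 1 / 32)
    (ε := 1 / 1000) (by norm_num)
    (h.diff.mono fun X hX => mem_glueO_of_mem_glueI (hsub hX))
    (fun x hx y hy => h.lipschitz hV₀I hx hy)
    (fun x hx => h.bound x (mem_glueO_of_mem_glueI (hsub hx))) (by norm_num)
  exact ⟨j, u, hu, fun y hy => ⟨hsub (hu2 y hy).1, (hu2 y hy).2⟩⟩

/-- The displacement of the unit translation, read through the gluing map. -/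
theorem exists_displacement (h : GlueData s φ m L) : ∃ δ : ℂ → ℂ,
    (∀ W ∈ glueI s, ∀ j : ℤ, δ (W + m W + j * s) = m (W + 1) - m W) ∧
    ∀ V : ℂ, (∀ j : ℤ, 6 < ‖V + j * s‖) → DifferentiableAt ℂ δ V ∧ ‖δ V‖ ≤ 2 / 1000 ∧
      ∀ j : ℤ, δ (V + j * s) = δ V := by
  classical
  let δ : ℂ → ℂ := fun V => if hV : ∃ W ∈ glueI s, ∃ j : ℤ, V = W + m W + j * s
    then m (hV.choose + 1) - m hV.choose else 0
  have hδ : ∀ W ∈ glueI s, ∀ j : ℤ, δ (W + m W + j * s) = m (W + 1) - m W := fun W hW j => by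
    have hV : ∃ W' ∈ glueI s, ∃ j' : ℤ, W + m W + j * s = W' + m W' + j' * s := ⟨W, hW, j, rfl⟩
    obtain ⟨h1, j', h2⟩ := hV.choose_spec
    have e : δ (W + m W + j * s) = m (hV.choose + 1) - m hV.choose := dif_pos hV
    rw [e]
    refine h.displacement_unique h1 hW (j := j - j') ?_
    push_cast
    linear_combination -h2
  refine ⟨δ, hδ, fun V hV => ?_⟩
  obtain ⟨j, u, hu, hu2⟩ := h.exists_local_inverse hV
  have hval : ∀ (y : ℂ) (i : ℤ), y ∈ ball (V + j * s) (1 / 64) →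
      δ (y + i * s) = m (u y + 1) - m (u y) := fun y i hy => by
    have := hδ (u y) (hu2 y hy).1 i
    rwa [(hu2 y hy).2] at this
  have h0 : V + j * s ∈ ball (V + j * s) (1 / 64) := mem_ball_self (by norm_num)
  have hVv : ∀ i : ℤ, δ (V + i * s) = m (u (V + j * s) + 1) - m (u (V + j * s)) := fun i => by
    have := hval _ (i - j) h0
    rw [← this]
    congr 1
    push_cast; ring
  have hV0 := hVv 0
  rw [Int.cast_zero, zero_mul, add_zero] at hV0
  refine ⟨?_, ?_, fun i => by rw [hVv, hV0]⟩
  · have hev : δ =ᶠ[𝓝 V] fun v => m (u (v + j * s) + 1) - m (u (v + j * s)) := by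
      filter_upwards [ball_mem_nhds V (show (0 : ℝ) < 1 / 64 by norm_num)] with v hv
      have hv' : v + j * s ∈ ball (V + j * s) (1 / 64) := by
        rwa [mem_ball, dist_add_right]
      have := hval _ (-j) hv'
      rw [← this]
      congr 1
      push_cast; ring
    refine DifferentiableAt.congr_of_eventuallyEq ?_ hev
    have du : DifferentiableAt ℂ (fun v : ℂ => u (v + j * s)) V := by
      refine DifferentiableAt.comp V (f := fun v : ℂ => v + j * s) ?_ (by fun_prop)
      exact hu.differentiableAt (isOpen_ball.mem_nhds h0)
    have hI := (hu2 _ h0).1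
    have d1 : DifferentiableAt ℂ m (u (V + j * s) + 1) :=
      h.diff.differentiableAt ((isOpen_glueO s).mem_nhds (add_one_mem_glueO hI))
    have d2 : DifferentiableAt ℂ m (u (V + j * s)) :=
      h.diff.differentiableAt ((isOpen_glueO s).mem_nhds (mem_glueO_of_mem_glueI hI))
    exact (DifferentiableAt.comp V (f := fun v : ℂ => u (v + j * s) + 1) d1 (du.add_const 1)).sub
      (DifferentiableAt.comp V (f := fun v : ℂ => u (v + j * s)) d2 du)
  · have hI := (hu2 _ h0).1
    rw [hV0]
    refine (norm_sub_le _ _).trans ?_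
    linarith [h.bound _ (add_one_mem_glueO hI), h.bound _ (mem_glueO_of_mem_glueI hI)]

end GlueData
end Displacement

section Coordinate
open Metric Set Topology MeasureTheory

/-- The scale of the renormalized coordinate. -/
noncomputable def kap : ℝ := Real.exp (-(12 * π)) / 100000

theorem kap_pos : 0 < kap := by unfold kap; positivity

/-- The renormalized coordinate. -/
noncomputable def zc (s : ℝ) (V : ℂ) : ℂ :=
  eTwoPi (V / s) / ((1 - eTwoPi (V / s)) * (kap * s))

theorem norm_one_sub_exp_le (w : ℂ) : ‖1 - Complex.exp w‖ ≤ ‖w‖ * Real.exp ‖w‖ := by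
  have := Complex.norm_exp_sub_sum_le_norm_mul_exp w 1
  simpa [norm_sub_rev] using this

theorem exp_neg_norm_le_norm_exp (w : ℂ) : Real.exp (-‖w‖) ≤ ‖Complex.exp w‖ := by
  rw [Complex.norm_exp]
  exact Real.exp_le_exp.2 (abs_le.1 (Complex.abs_re_le_norm w)).1

theorem eTwoPi_ne_zero (x : ℂ) : eTwoPi x ≠ 0 := Complex.exp_ne_zero _

theorem far_of_norm_lt {s : ℝ} (hs : 2 ≤ s) {V : ℂ}
    (h : ‖eTwoPi (V / s)‖ < kap * s * ‖1 - eTwoPi (V / s)‖) (j : ℤ) : 6 < ‖V + j * s‖ := by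
  by_contra hc
  push Not at hc
  have hs0 : (s : ℂ) ≠ 0 := by exact_mod_cast (by linarith : s ≠ 0)
  set w : ℂ := 2 * π * Complex.I * ((V + j * s) / s) with hw
  have hx : eTwoPi (V / s) = Complex.exp w := by
    rw [← eTwoPi_add_int (V / s) j]
    unfold eTwoPi
    rw [hw]
    congr 2
    field_simp
  have hpi := Real.pi_pos
  have hwn : ‖w‖ * s ≤ 12 * π := by
    have : ‖w‖ * s = 2 * π * ‖V + j * s‖ := by
      rw [hw]
      simp only [norm_mul, norm_div, Complex.norm_I, Complex.norm_real, Complex.norm_ofNat,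
        Real.norm_eq_abs, abs_of_pos hpi, abs_of_pos (show 0 < s by linarith)]
      field_simp
    rw [this]; nlinarith
  have hw6 : ‖w‖ ≤ 6 * π := by nlinarith [norm_nonneg w]
  have h1 := norm_one_sub_exp_le w
  have h2 := exp_neg_norm_le_norm_exp w
  rw [hx] at h
  have h3 : kap * s * ‖1 - Complex.exp w‖ ≤ kap * (12 * π * Real.exp (6 * π)) := by
    have : s * ‖1 - Complex.exp w‖ ≤ 12 * π * Real.exp (6 * π) := by
      calc s * ‖1 - Complex.exp w‖ ≤ s * (‖w‖ * Real.exp ‖w‖) := by gcongr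
        _ = (‖w‖ * s) * Real.exp ‖w‖ := by ring
        _ ≤ _ := by gcongr
    have := mul_le_mul_of_nonneg_left this kap_pos.le
    linarith
  have h4 : kap * (12 * π * Real.exp (6 * π)) ≤ Real.exp (-(6 * π)) := by
    unfold kap
    have e : Real.exp (-(12 * π)) = Real.exp (-(6 * π)) * Real.exp (-(6 * π)) := by
      rw [← Real.exp_add]; ring_nf
    have e2 : Real.exp (-(6 * π)) * Real.exp (6 * π) = 1 := by rw [← Real.exp_add]; simp
    have : Real.exp (-(12 * π)) / 100000 * (12 * π * Real.exp (6 * π))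
        = Real.exp (-(6 * π)) * (12 * π / 100000) := by
      rw [e]; linear_combination (Real.exp (-(6 * π)) * (12 * π / 100000)) * e2
    rw [this]
    have := Real.pi_lt_four
    exact mul_le_of_le_one_right (Real.exp_pos _).le (by linarith)
  have h5 : Real.exp (-(6 * π)) ≤ Real.exp (-‖w‖) := Real.exp_le_exp.2 (by linarith)
  linarith

theorem norm_eTwoPi_mul_le {s : ℝ} (_hs : 0 < s) {V : ℂ} :
    ‖eTwoPi (V / s)‖ * (2 * π * V.im / s) ≤ ‖1 - eTwoPi (V / s)‖ := by
  have h0 : ‖eTwoPi (V / s)‖ = Real.exp (-(2 * π * V.im / s)) := by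
    rw [norm_eTwoPi, Complex.div_ofReal_im]; congr 1; ring
  have h1 := norm_sub_norm_le 1 (eTwoPi (V / s))
  rw [norm_one, h0] at h1
  rw [h0]
  set t := 2 * π * V.im / s
  have h2 := Real.add_one_le_exp t
  have h3 : Real.exp (-t) * Real.exp t = 1 := by rw [← Real.exp_add]; simp
  nlinarith [Real.exp_pos (-t)]

theorem one_sub_eTwoPi_ne_zero {s : ℝ} (hs : 0 < s) {V : ℂ} (hV : 0 < V.im) :
    1 - eTwoPi (V / s) ≠ 0 := by
  have h1 := norm_eTwoPi_mul_le hs (V := V)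
  have h2 : 0 < ‖eTwoPi (V / s)‖ := norm_pos_iff.2 (eTwoPi_ne_zero _)
  have h3 : 0 < 2 * π * V.im / s := by have := Real.pi_pos; positivity
  exact norm_pos_iff.1 ((mul_pos h2 h3).trans_le h1)

theorem norm_zc {s : ℝ} (hs : 0 < s) (V : ℂ) :
    ‖zc s V‖ = ‖eTwoPi (V / s)‖ / (‖1 - eTwoPi (V / s)‖ * (kap * s)) := by
  unfold zc
  rw [norm_div, norm_mul, norm_mul, Complex.norm_real, Complex.norm_real, Real.norm_of_nonneg hs.le,
    Real.norm_of_nonneg kap_pos.le]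

theorem norm_zc_le {s : ℝ} (hs : 0 < s) {V : ℂ} (hV : 0 < V.im) :
    ‖zc s V‖ ≤ 1 / (2 * π * kap * V.im) := by
  have h1 := norm_eTwoPi_mul_le hs (V := V)
  have h2 := norm_pos_iff.2 (one_sub_eTwoPi_ne_zero hs hV)
  have hk := kap_pos
  have hpi := Real.pi_pos
  rw [norm_zc hs, div_le_div_iff₀ (by positivity) (by positivity)]
  have e : ‖eTwoPi (V / s)‖ * (2 * π * kap * V.im)
    = ‖eTwoPi (V / s)‖ * (2 * π * V.im / s) * (kap * s) := by field_simp
  rw [e, one_mul]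
  gcongr

theorem norm_zc_lt_one {s : ℝ} (hs : 0 < s) {V : ℂ} (hV : 1 / (2 * π * kap) < V.im) :
    ‖zc s V‖ < 1 := by
  have hk := kap_pos
  have hpi := Real.pi_pos
  have h0 : 0 < V.im := lt_trans (by positivity) hV
  refine (norm_zc_le hs h0).trans_lt ?_
  rw [div_lt_one (by positivity)]
  rw [div_lt_iff₀ (by positivity)] at hV
  linarith

theorem zc_add_int_mul {s : ℝ} (hs : 0 < s) (V : ℂ) (j : ℤ) : zc s (V + j * s) = zc s V := by
  have hs0 : (s : ℂ) ≠ 0 := by exact_mod_cast hs.ne'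
  unfold zc
  rw [show (V + j * s) / s = V / s + j by field_simp, eTwoPi_add_int]

theorem exists_removable {U : Set ℂ} (hU : IsOpen U) {c : ℂ} {f : ℂ → ℂ}
    (hf : DifferentiableOn ℂ f (U \ {c})) {B : ℝ} (hB : ∀ z ∈ U \ {c}, ‖f z‖ ≤ B) :
    ∃ G : ℂ → ℂ, DifferentiableOn ℂ G U ∧ (∀ z ∈ U \ {c}, G z = f z) ∧ ∀ z ∈ U, ‖G z‖ ≤ B := by
  by_cases hc : c ∈ U
  · have hcU := hU.mem_nhds hc
    have hd := Complex.differentiableOn_update_limUnder_of_bddAbove hcU hf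
      ⟨B, by rintro _ ⟨z, hz, rfl⟩; exact hB z hz⟩
    refine ⟨_, hd, fun z hz => Function.update_of_ne hz.2 _ _, fun z hz => ?_⟩
    set G := Function.update f c (limUnder (𝓝[≠] c) f) with hG
    by_cases hzc : z = c
    · rw [hzc]
      have hcont : Tendsto (fun z => ‖G z‖) (𝓝[≠] c) (𝓝 ‖G c‖) :=
        ((hd.differentiableAt hcU).continuousAt.norm).tendsto.mono_left nhdsWithin_le_nhds
      refine le_of_tendsto hcont ?_
      filter_upwards [self_mem_nhdsWithin, mem_nhdsWithin_of_mem_nhds hcU] with y h1 h2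
      rw [hG, Function.update_of_ne h1]
      exact hB y ⟨h2, h1⟩
    · rw [hG, Function.update_of_ne hzc]
      exact hB z ⟨hz, hzc⟩
  · rw [sdiff_singleton_eq_self hc] at hf hB
    exact ⟨f, hf, fun _ _ => rfl, hB⟩

namespace GlueData

variable {s : ℝ} {φ m : ℂ → ℂ} {L : ℂ}

/-- A function of `V` which is `s`-periodic descends to a function of `eTwoPi (V / s)`. -/
theorem descend {s : ℝ} (hs : 2 ≤ s) {δ : ℂ → ℂ} {η : ℝ}
    (hδ : ∀ V : ℂ, (∀ j : ℤ, 6 < ‖V + j * s‖) → DifferentiableAt ℂ δ V ∧ ‖δ V‖ ≤ η ∧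
      ∀ j : ℤ, δ (V + j * s) = δ V) :
    ∃ D : ℂ → ℂ, (∀ x, x ≠ 0 → ‖x‖ < kap * s * ‖1 - x‖ → DifferentiableAt ℂ D x ∧ ‖D x‖ ≤ η) ∧
      ∀ V : ℂ, ‖eTwoPi (V / s)‖ < kap * s * ‖1 - eTwoPi (V / s)‖ → D (eTwoPi (V / s)) = δ V := by
  have hs0 : (s : ℂ) ≠ 0 := by exact_mod_cast (by linarith : s ≠ 0)
  have hI : (2 * π * Complex.I : ℂ) ≠ 0 := Complex.two_pi_I_ne_zero
  set c : ℂ := s / (2 * π * Complex.I) with hc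
  have hexp : ∀ l : ℂ, eTwoPi (c * l / s) = Complex.exp l := fun l => by
    unfold eTwoPi
    rw [hc]; congr 1; field_simp
  have hper : ∀ V : ℂ, ‖eTwoPi (V / s)‖ < kap * s * ‖1 - eTwoPi (V / s)‖ →
      δ (c * Complex.log (eTwoPi (V / s))) = δ V := fun V hV => by
    have h1 : Complex.exp (Complex.log (eTwoPi (V / s)))
        = Complex.exp (2 * π * Complex.I * (V / s)) := by
      rw [Complex.exp_log (eTwoPi_ne_zero _)]; rfl
    obtain ⟨n, hn⟩ := Complex.exp_eq_exp_iff_exists_int.1 h1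
    rw [hn, ← (hδ V (far_of_norm_lt hs hV)).2.2 n]
    congr 1
    rw [hc]; field_simp
  refine ⟨fun x => δ (c * Complex.log x), fun x hx hg => ?_, hper⟩
  have hx' : eTwoPi (c * Complex.log x / s) = x := by rw [hexp, Complex.exp_log hx]
  have hfar := hδ (c * Complex.log x) (far_of_norm_lt hs (by rwa [hx']))
  refine ⟨?_, hfar.2.1⟩
  have hev : (fun y => δ (c * Complex.log y)) =ᶠ[𝓝 x]
      fun y => δ (c * (Complex.log (y / x) + Complex.log x)) := by
    have o1 : ∀ᶠ y in 𝓝 x, ‖y‖ < kap * s * ‖1 - y‖ :=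
      (continuous_norm.tendsto x).eventually_lt
        ((continuous_const.mul (continuous_const.sub continuous_id).norm).tendsto x) hg
    filter_upwards [o1, eventually_ne_nhds hx] with y hy hy0
    have e : eTwoPi (c * (Complex.log (y / x) + Complex.log x) / s) = y := by
      rw [hexp, Complex.exp_add, Complex.exp_log (div_ne_zero hy0 hx), Complex.exp_log hx]
      field_simp
    have := hper (c * (Complex.log (y / x) + Complex.log x)) (by rwa [e])
    rwa [e] at this
  refine DifferentiableAt.congr_of_eventuallyEq ?_ hev
  have hx1 : c * (Complex.log (x / x) + Complex.log x) = c * Complex.log x := by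
    rw [div_self hx, Complex.log_one, zero_add]
  refine DifferentiableAt.comp x (f := fun y : ℂ => c * (Complex.log (y / x) + Complex.log x)) ?_ ?_
  · rw [hx1]; exact hfar.1
  · refine ((DifferentiableAt.clog (by fun_prop) ?_).add_const _).const_mul _
    rw [div_self hx]; exact Complex.one_mem_slitPlane

end GlueData
end Coordinate

section RenormalizedMap
open Metric Set Topology MeasureTheory

namespace GlueData

variable {s : ℝ} {φ m : ℂ → ℂ} {L : ℂ}

theorem exists_bounded_displacement {s : ℝ} (hs : 2 ≤ s) {δ : ℂ → ℂ} {η : ℝ}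
    (hδ : ∀ V : ℂ, (∀ j : ℤ, 6 < ‖V + j * s‖) → DifferentiableAt ℂ δ V ∧ ‖δ V‖ ≤ η ∧
      ∀ j : ℤ, δ (V + j * s) = δ V) :
    ∃ Δ : ℂ → ℂ, DifferentiableOn ℂ Δ (ball 0 1) ∧ (∀ z ∈ ball (0 : ℂ) 1, ‖Δ z‖ ≤ η) ∧
      ∀ V : ℂ, 1 / (2 * π * kap) < V.im → Δ (zc s V) = δ V := by
  obtain ⟨D, hD1, hD2⟩ := descend hs hδ
  have hs0 : 0 < s := by linarith
  have hk := kap_pos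
  have hks : ((kap : ℂ) * s) ≠ 0 := by
    exact_mod_cast (mul_pos hk hs0).ne'
  set k : ℂ := kap * s with hkdef
  have hkn : ‖k‖ = kap * s := by
    rw [hkdef, norm_mul, Complex.norm_real, Complex.norm_real, Real.norm_of_nonneg hs0.le,
      Real.norm_of_nonneg hk.le]
  have hgood : ∀ z ∈ (ball (0 : ℂ) 1 \ {-1 / k}) \ {0}, 1 + k * z ≠ 0 ∧
      k * z / (1 + k * z) ≠ 0 ∧ ‖k * z / (1 + k * z)‖ < kap * s * ‖1 - k * z / (1 + k * z)‖ := by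
    rintro z ⟨⟨hz1, hz2⟩, hz3⟩
    have h1 : 1 + k * z ≠ 0 := fun h => hz2 (by
      rw [mem_singleton_iff]; field_simp; linear_combination h)
    have hz0 : z ≠ 0 := hz3
    refine ⟨h1, div_ne_zero (mul_ne_zero hks hz0) h1, ?_⟩
    have e : 1 - k * z / (1 + k * z) = 1 / (1 + k * z) := by field_simp; ring
    rw [e, norm_div, norm_div, norm_mul, hkn, norm_one]
    rw [mem_ball_zero_iff] at hz1
    have := norm_pos_iff.2 h1
    rw [mul_one_div]
    refine div_lt_div_of_pos_right ?_ this
    have := mul_pos hk hs0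
    nlinarith
  have hGd : DifferentiableOn ℂ (fun z => D (k * z / (1 + k * z)))
      ((ball (0 : ℂ) 1 \ {-1 / k}) \ {0}) := fun z hz => by
    obtain ⟨g1, g2, g3⟩ := hgood z hz
    refine DifferentiableAt.differentiableWithinAt ?_
    refine DifferentiableAt.comp z (f := fun z : ℂ => k * z / (1 + k * z)) (hD1 _ g2 g3).1 ?_
    exact DifferentiableAt.div (by fun_prop) (by fun_prop) g1
  obtain ⟨G1, a1, a2, a3⟩ := exists_removable (isOpen_ball.sdiff isClosed_singleton) hGd
    (fun z hz => (hD1 _ (hgood z hz).2.1 (hgood z hz).2.2).2)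
  obtain ⟨Δ, b1, b2, b3⟩ := exists_removable isOpen_ball a1 a3
  refine ⟨Δ, b1, b3, fun V hV => ?_⟩
  have hV0 : 0 < V.im := lt_trans (by have := Real.pi_pos; positivity) hV
  have hx1 := one_sub_eTwoPi_ne_zero hs0 hV0
  set x := eTwoPi (V / s) with hx
  have hx0 : x ≠ 0 := eTwoPi_ne_zero _
  have hz : zc s V = x / ((1 - x) * k) := rfl
  have hz0 : zc s V ≠ 0 := by rw [hz]; exact div_ne_zero hx0 (mul_ne_zero hx1 hks)
  have hzk : 1 + k * zc s V = 1 / (1 - x) := by rw [hz]; field_simp; ring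
  have hzx : k * zc s V / (1 + k * zc s V) = x := by
    rw [hzk, hz]; field_simp
  have hzp : zc s V ∉ ({-1 / k} : Set ℂ) := fun h => by
    rw [mem_singleton_iff] at h
    rw [h] at hzk
    have : (0 : ℂ) = 1 / (1 - x) := by rw [← hzk]; field_simp; ring
    exact one_div_ne_zero hx1 this.symm
  have hzb : zc s V ∈ ball (0 : ℂ) 1 := by rw [mem_ball_zero_iff]; exact norm_zc_lt_one hs0 hV
  rw [b2 _ ⟨hzb, hzp⟩, a2 _ ⟨⟨hzb, hzp⟩, hz0⟩, hzx]
  refine hD2 V ?_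
  have := (hgood _ ⟨⟨hzb, hzp⟩, hz0⟩).2.2
  rwa [hzx] at this

theorem exists_renormalized_displacement (h : GlueData s φ m L) :
    ∃ Δ : ℂ → ℂ, DifferentiableOn ℂ Δ (ball 0 1) ∧
      (∀ z ∈ ball (0 : ℂ) 1, ‖Δ z‖ ≤ 3 / 1000 * ‖z‖) ∧
      ∀ W ∈ glueI s, 1 / (2 * π * kap) < (W + m W).im → Δ (zc s (W + m W)) = m (W + 1) - m W := by
  obtain ⟨δ, hδ1, hδ2⟩ := h.exists_displacement
  obtain ⟨Δ, d1, d2, d3⟩ := exists_bounded_displacement h.two_le hδ2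
  have hs2 := h.two_le
  have hs0 : 0 < s := by linarith
  have hconj : ∀ W ∈ glueI s, 1 / (2 * π * kap) < (W + m W).im →
      Δ (zc s (W + m W)) = m (W + 1) - m W := fun W hW hW2 => by
    rw [d3 _ hW2]
    have := hδ1 W hW 0
    rwa [Int.cast_zero, zero_mul, add_zero] at this
  set w : ℝ → ℂ := fun T => ((s / 2 : ℝ) : ℂ) + T * Complex.I with hw
  have hwI : ∀ T : ℝ, 5 < T → w T ∈ glueI s := fun T hT => by
    have hre : (w T).re = s / 2 := by simp [hw]
    have him : (w T).im = T := by simp [hw]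
    have h1 := Complex.abs_im_le_norm (w T)
    have h2 := Complex.abs_im_le_norm (w T - s)
    rw [Complex.sub_im, Complex.ofReal_im, sub_zero, him] at h2
    rw [him] at h1
    have h3 := le_abs_self T
    exact ⟨⟨by rw [hre]; linarith, by rw [hre]; linarith⟩, by linarith, by linarith⟩
  have him : ∀ T : ℝ, 5 < T → T - 1 ≤ (w T + m (w T)).im := fun T hT => by
    have b := (Complex.abs_im_le_norm _).trans (h.bound _ (mem_glueO_of_mem_glueI (hwI T hT)))
    have him : (w T).im = T := by simp [hw]
    rw [Complex.add_im, him]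
    linarith [(abs_le.1 b).1]
  have hlimz : Tendsto (fun T => zc s (w T + m (w T))) atTop (𝓝 0) := by
    have hk := kap_pos
    have hpi := Real.pi_pos
    have hb : Tendsto (fun T : ℝ => 1 / (2 * π * kap) * (T - 1)⁻¹) atTop (𝓝 0) := by
      have := (tendsto_inv_atTop_zero.comp
        (tendsto_atTop_add_const_right atTop (-1 : ℝ) tendsto_id)).const_mul (1 / (2 * π * kap))
      simpa [Function.comp_def, sub_eq_add_neg] using this
    refine squeeze_zero_norm' ?_ hb
    filter_upwards [eventually_gt_atTop (5 : ℝ)] with T hT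
    have h1 := him T hT
    refine (norm_zc_le hs0 (by linarith)).trans ?_
    have h2 : 0 < T - 1 := by linarith
    rw [one_div, one_div, mul_inv (2 * π * kap)]
    gcongr
  have hΔ0 : Δ 0 = 0 := by
    have h1 : Tendsto (fun T => Δ (zc s (w T + m (w T)))) atTop (𝓝 (Δ 0)) :=
      (d1.differentiableAt (isOpen_ball.mem_nhds (mem_ball_self one_pos))).continuousAt.tendsto.comp
        hlimz
    have l1 := h.lim (s / 2) (by linarith) (by linarith)
    have l2 := h.lim (s / 2 + 1) (by linarith) (by linarith)
    have h2 : Tendsto (fun T => m (w T + 1) - m (w T)) atTop (𝓝 0) := by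
      have := l2.sub l1
      rw [sub_self] at this
      refine this.congr fun T => ?_
      rw [hw]
      congr 2
      push_cast; ring
    refine tendsto_nhds_unique h1 (h2.congr' ?_)
    filter_upwards [eventually_gt_atTop (5 : ℝ), eventually_gt_atTop (1 / (2 * π * kap) + 1)]
      with T hT hT2
    exact (hconj _ (hwI T hT) (by linarith [him T hT])).symm
  refine ⟨Δ, d1, fun z hz => ?_, hconj⟩
  have := Complex.dist_le_div_mul_dist_of_mapsTo_ball (R₂ := 3 / 1000) d1
    (fun z hz => by
      rw [hΔ0]; have := d2 z hz
      rw [mem_closedBall_zero_iff]; linarith) hz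
  rw [hΔ0, dist_zero_right, dist_zero_right] at this
  linarith

end GlueData
end RenormalizedMap

section RenormalizedGerm
open Metric Set Topology MeasureTheory

theorem norm_one_sub_eTwoPi_div_le {s : ℝ} (hs : 0 < s) (v : ℂ) :
    ‖1 - eTwoPi (v / s)‖ ≤ 2 * π * ‖v‖ / s * Real.exp (2 * π * ‖v‖ / s) := by
  have h := norm_one_sub_exp_le (2 * π * Complex.I * (v / s))
  have hpi := Real.pi_pos
  have e : ‖2 * π * Complex.I * (v / s)‖ = 2 * π * ‖v‖ / s := by
    simp only [norm_mul, norm_div, Complex.norm_I, Complex.norm_real, Complex.norm_ofNat,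
        Real.norm_eq_abs, abs_of_pos hpi, abs_of_pos hs]
    ring
  rwa [e] at h

theorem kap_mul_exp_le : kap * (8 * Real.exp 4) ≤ 1 / 100 := by
  unfold kap
  have e : Real.exp (-(12 * π)) * Real.exp 4 ≤ 1 := by
    rw [← Real.exp_add]
    exact Real.exp_le_one_iff.2 (by have := Real.pi_gt_three; linarith)
  nlinarith

/-- The renormalized germ determined by a displacement function. -/
noncomputable def renormGerm (s : ℝ) (Δ : ℂ → ℂ) (z : ℂ) : ℂ :=
  z / (eTwoPi (-(1 + Δ z) / s) + (eTwoPi (-(1 + Δ z) / s) - 1) * (kap * s) * z)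

theorem renormGerm_estimates {s : ℝ} (hs : 2 ≤ s) {Δ : ℂ → ℂ} {z : ℂ} (hz : z ∈ ball (0 : ℂ) 1)
    (hΔ : ‖Δ z‖ ≤ 3 / 1000 * ‖z‖) :
    ‖1 - eTwoPi (1 / s) * eTwoPi (-(1 + Δ z) / s)‖ ≤ 2 / 100 * ‖z‖ ∧
    ‖(eTwoPi (-(1 + Δ z) / s) - 1) * (kap * s)‖ ≤ 1 / 100 ∧
    9 / 10 ≤ ‖eTwoPi (-(1 + Δ z) / s)
      + (eTwoPi (-(1 + Δ z) / s) - 1) * (kap * s) * z‖ := by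
  have hs0 : 0 < s := by linarith
  have hpi := Real.pi_pos
  have hpi4 := Real.pi_lt_d2
  have hk := kap_pos
  rw [mem_ball_zero_iff] at hz
  have hzn := norm_nonneg z
  have k1 : ‖1 - eTwoPi (1 / s) * eTwoPi (-(1 + Δ z) / s)‖ ≤ 2 / 100 * ‖z‖ := by
    have e : eTwoPi (1 / s) * eTwoPi (-(1 + Δ z) / s) = eTwoPi (-Δ z / s) := by
      rw [← eTwoPi_add]; congr 1; ring
    rw [e]
    refine (norm_one_sub_eTwoPi_div_le hs0 _).trans ?_
    rw [norm_neg]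
    have h1 : 2 * π * ‖Δ z‖ / s ≤ 0.00945 * ‖z‖ := by
      rw [div_le_iff₀ hs0]
      calc 2 * π * ‖Δ z‖ ≤ 2 * 3.15 * (3 / 1000 * ‖z‖) := by gcongr
        _ = 0.00945 * ‖z‖ * 2 := by ring
        _ ≤ _ := by gcongr
    have h2 : Real.exp (2 * π * ‖Δ z‖ / s) ≤ 2 := by
      have h3 : Real.exp (2 * π * ‖Δ z‖ / s) ≤ Real.exp (1 / 2) := by
        apply Real.exp_le_exp.2; nlinarith
      refine h3.trans ?_
      have h4 := Real.exp_one_lt_d9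
      have h5 : Real.exp (1 / 2) * Real.exp (1 / 2) = Real.exp 1 := by
        rw [← Real.exp_add]; norm_num
      nlinarith [Real.exp_pos (1 / 2)]
    calc _ ≤ 0.00945 * ‖z‖ * 2 := by gcongr
      _ ≤ _ := by nlinarith
  have k2 : ‖(eTwoPi (-(1 + Δ z) / s) - 1) * (kap * s)‖ ≤ 1 / 100 := by
    rw [norm_mul, norm_sub_rev, norm_mul, Complex.norm_real, Complex.norm_real,
      Real.norm_of_nonneg hk.le, Real.norm_of_nonneg hs0.le]
    have h0 : ‖-(1 + Δ z)‖ ≤ 1.003 := by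
      rw [norm_neg]
      refine (norm_add_le _ _).trans ?_
      rw [norm_one]; nlinarith
    have h1 : 2 * π * ‖-(1 + Δ z)‖ ≤ 8 := by
      calc 2 * π * ‖-(1 + Δ z)‖ ≤ 2 * 3.15 * 1.003 := by gcongr
        _ ≤ _ := by norm_num
    have h2 : 2 * π * ‖-(1 + Δ z)‖ / s ≤ 4 := by
      rw [div_le_iff₀ hs0]; linarith
    have h3 := norm_one_sub_eTwoPi_div_le hs0 (-(1 + Δ z))
    have h4 : s * ‖1 - eTwoPi (-(1 + Δ z) / s)‖ ≤ 8 * Real.exp 4 := by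
      calc s * ‖1 - eTwoPi (-(1 + Δ z) / s)‖
          ≤ s * (2 * π * ‖-(1 + Δ z)‖ / s * Real.exp (2 * π * ‖-(1 + Δ z)‖ / s)) := by gcongr
        _ = 2 * π * ‖-(1 + Δ z)‖ * Real.exp (2 * π * ‖-(1 + Δ z)‖ / s) := by field_simp
        _ ≤ _ := by gcongr
    have := mul_le_mul_of_nonneg_left h4 hk.le
    linarith [kap_mul_exp_le]
  refine ⟨k1, k2, ?_⟩
  set q := eTwoPi (-(1 + Δ z) / s) with hq
  have hlam : ‖eTwoPi (1 / s)‖ = 1 := by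
    rw [norm_eTwoPi]
    have : ((1 : ℂ) / s).im = 0 := by rw [Complex.div_ofReal_im]; simp
    rw [this]; simp
  have q1 : 98 / 100 ≤ ‖q‖ := by
    have := norm_sub_norm_le 1 (eTwoPi (1 / s) * q)
    rw [norm_one, norm_mul, hlam, one_mul] at this
    nlinarith
  have h1 := norm_sub_norm_le q (-((q - 1) * (kap * s) * z))
  rw [norm_neg, norm_mul, sub_neg_eq_add] at h1
  have h2 : ‖(q - 1) * (kap * s)‖ * ‖z‖ ≤ 1 / 100 * 1 := by gcongr
  linarith

theorem inG_renormGerm {s : ℝ} (hs : 2 ≤ s) {Δ : ℂ → ℂ} (hd : DifferentiableOn ℂ Δ (ball 0 1))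
    (hΔ : ∀ z ∈ ball (0 : ℂ) 1, ‖Δ z‖ ≤ 3 / 1000 * ‖z‖) :
    InG (eTwoPi (1 / s)) (renormGerm s Δ) := by
  have hs0 : 0 < s := by linarith
  have hq : DifferentiableOn ℂ (fun z => eTwoPi (-(1 + Δ z) / s)) (ball 0 1) := by
    unfold eTwoPi
    exact ((((hd.const_add 1).neg).div_const _).const_mul _).cexp
  refine ⟨?_, fun z hz => ?_⟩
  · refine DifferentiableOn.div differentiableOn_id
      (hq.add (((hq.sub_const 1).mul_const _).mul differentiableOn_id)) fun z hz h0 => ?_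
    have := (renormGerm_estimates hs hz (hΔ z hz)).2.2
    exact absurd (this.trans_eq ((congrArg norm h0).trans norm_zero)) (by norm_num)
  · obtain ⟨k1, k2, k3⟩ := renormGerm_estimates hs hz (hΔ z hz)
    have hlam : ‖eTwoPi (1 / s)‖ = 1 := by
      rw [norm_eTwoPi]
      have : ((1 : ℂ) / s).im = 0 := by rw [Complex.div_ofReal_im]; simp
      rw [this]; simp
    unfold renormGerm
    set q := eTwoPi (-(1 + Δ z) / s)
    set lam := eTwoPi (1 / s)
    set d := q + (q - 1) * (kap * s) * z with hd'
    have hd0 : d ≠ 0 := fun h => by rw [h, norm_zero] at k3; norm_num at k3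
    have e : z / d - lam * z = z * ((1 - lam * q) - lam * ((q - 1) * (kap * s)) * z) / d := by
      rw [eq_div_iff hd0, sub_mul, div_mul_cancel₀ _ hd0, hd']; ring
    rw [e, norm_div, div_le_iff₀ (by linarith), norm_mul]
    have h1 : ‖(1 - lam * q) - lam * ((q - 1) * (kap * s)) * z‖ ≤ 3 / 100 * ‖z‖ := by
      refine (norm_sub_le _ _).trans ?_
      rw [norm_mul _ z, norm_mul lam, hlam, one_mul]
      have := mul_le_mul_of_nonneg_right k2 (norm_nonneg z)
      linarith
    have h2 := mul_le_mul_of_nonneg_left h1 (norm_nonneg z)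
    have h3 := mul_le_mul_of_nonneg_left k3 (sq_nonneg ‖z‖)
    nlinarith [sq_nonneg ‖z‖]

theorem renormGerm_zc {s : ℝ} (hs : 0 < s) {Δ : ℂ → ℂ} {V : ℂ} (hV : 0 < V.im) :
    renormGerm s Δ (zc s V) = zc s (V + 1 + Δ (zc s V)) := by
  have hx1 := one_sub_eTwoPi_ne_zero hs hV
  have hks : ((kap : ℂ) * s) ≠ 0 := by exact_mod_cast (mul_pos kap_pos hs).ne'
  unfold renormGerm
  set Dl := Δ (zc s V)
  have hq0 : eTwoPi (-(1 + Dl) / s) ≠ 0 := eTwoPi_ne_zero _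
  have hx' : eTwoPi ((V + 1 + Dl) / s) = eTwoPi (V / s) / eTwoPi (-(1 + Dl) / s) := by
    rw [eq_div_iff hq0, ← eTwoPi_add]; congr 1; ring
  unfold zc
  rw [hx']
  set x := eTwoPi (V / s)
  set q := eTwoPi (-(1 + Dl) / s)
  set k : ℂ := kap * s
  have e1 : q + (q - 1) * k * (x / ((1 - x) * k)) = (q - x) / (1 - x) := by field_simp; ring
  have e2 : 1 - x / q = (q - x) / q := by field_simp
  rw [e1, e2]
  by_cases hqx : q - x = 0
  · rw [hqx]; simp
  · field_simp

namespace GlueData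

variable {s : ℝ} {φ m : ℂ → ℂ} {L : ℂ}

theorem exists_renormalized (h : GlueData s φ m L) :
    ∃ F : ℂ → ℂ, InG (eTwoPi (1 / s)) F ∧
      ∀ W ∈ glueI s, 1 / (2 * π * kap) < (W + m W).im →
        F (zc s (W + m W)) = zc s (W + 1 + m (W + 1)) := by
  obtain ⟨Δ, d1, d2, d3⟩ := h.exists_renormalized_displacement
  have hs := h.two_le
  refine ⟨renormGerm s Δ, inG_renormGerm hs d1 d2, fun W hW hV => ?_⟩
  have hV0 : 0 < (W + m W).im := lt_trans
    (by have := Real.pi_pos; have := kap_pos; positivity) hV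
  rw [renormGerm_zc (by linarith) hV0, d3 W hW hV]
  congr 1; ring

end GlueData
end RenormalizedGerm

section Lift
open Metric Set Topology MeasureTheory

theorem norm_eTwoPi_add_mul_I (X : ℂ) (h : ℝ) :
    ‖eTwoPi (X + h * Complex.I)‖ = Real.exp (-(2 * π * (X.im + h))) := by
  rw [norm_eTwoPi]; simp

theorem exists_lift {s h : ℝ} (hh : 0 ≤ h) {f : ℂ → ℂ} (hf : InG (eTwoPi (-(s : ℂ))) f) :
    ∃ φ : ℂ → ℂ, DifferentiableOn ℂ φ {X | 1 < |X.im|} ∧ (∀ X, φ (X + 1) = φ X) ∧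
      (∀ X, X.im ≤ 0 → φ X = 0) ∧
      (∀ X, 0 < X.im → ‖φ X‖ ≤ Real.exp (-(2 * π * (X.im + h)))) ∧
      ∀ X, 0 < X.im → f (eTwoPi (X + h * Complex.I)) = eTwoPi (X + φ X - s + h * Complex.I) := by
  have hpi := Real.pi_pos
  have hI : (2 * π * Complex.I : ℂ) ≠ 0 := Complex.two_pi_I_ne_zero
  set lam := eTwoPi (-(s : ℂ)) with hlam
  have hlam0 : lam ≠ 0 := Complex.exp_ne_zero _
  have hlam1 : ‖lam‖ = 1 := by rw [hlam, norm_eTwoPi]; simp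
  set E : ℂ → ℂ := fun X => f (eTwoPi (X + h * Complex.I)) / (lam * eTwoPi (X + h * Complex.I))
    with hE
  have hx0 : ∀ X, eTwoPi (X + h * Complex.I) ≠ 0 := fun X => Complex.exp_ne_zero _
  have hx1 : ∀ X : ℂ, 0 < X.im → eTwoPi (X + h * Complex.I) ∈ ball (0 : ℂ) 1 := fun X hX => by
    rw [mem_ball_zero_iff, norm_eTwoPi_add_mul_I]
    refine Real.exp_lt_one_iff.2 ?_
    have : 0 < 2 * π * (X.im + h) := by positivity
    linarith
  have hE1 : ∀ X : ℂ, 0 < X.im → ‖E X - 1‖ ≤ Real.exp (-(2 * π * (X.im + h))) / 2 := by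
    intro X hX
    have h1 := hf.2 _ (hx1 X hX)
    have e : E X - 1 = (f (eTwoPi (X + h * Complex.I)) - lam * eTwoPi (X + h * Complex.I))
        / (lam * eTwoPi (X + h * Complex.I)) := by
      rw [hE, sub_div, div_self (mul_ne_zero hlam0 (hx0 X))]
    rw [e, norm_div, norm_mul, hlam1, one_mul, div_le_iff₀ (norm_pos_iff.2 (hx0 X)),
      ← norm_eTwoPi_add_mul_I]
    linarith
  have hE2 : ∀ X : ℂ, 0 < X.im → ‖E X - 1‖ ≤ 1 / 2 := fun X hX => by
    have h1 := hx1 X hX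
    rw [mem_ball_zero_iff, norm_eTwoPi_add_mul_I] at h1
    linarith [hE1 X hX]
  have hEd : ∀ X : ℂ, 0 < X.im → DifferentiableAt ℂ E X := fun X hX => by
    have hx : DifferentiableAt ℂ (fun X : ℂ => eTwoPi (X + h * Complex.I)) X := by
      unfold eTwoPi; fun_prop
    refine DifferentiableAt.div ?_ (hx.const_mul lam) (mul_ne_zero hlam0 (hx0 X))
    exact DifferentiableAt.comp X (f := fun X : ℂ => eTwoPi (X + h * Complex.I))
      (hf.1.differentiableAt (isOpen_ball.mem_nhds (hx1 X hX))) hx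
  have hEs : ∀ X : ℂ, 0 < X.im → E X ∈ Complex.slitPlane := fun X hX => by
    have h1 := Complex.abs_re_le_norm (E X - 1)
    rw [Complex.sub_re, Complex.one_re] at h1
    have := abs_le.1 (h1.trans (hE2 X hX))
    exact Or.inl (by linarith)
  let φ : ℂ → ℂ := fun X => if 0 < X.im then Complex.log (E X) / (2 * π * Complex.I) else 0
  have hφ : ∀ X : ℂ, 0 < X.im → φ X = Complex.log (E X) / (2 * π * Complex.I) :=
    fun X hX => if_pos hX
  have hφ' : ∀ X : ℂ, X.im ≤ 0 → φ X = 0 := fun X hX => if_neg (not_lt.2 hX)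
  refine ⟨φ, fun X hX => ?_, fun X => ?_, hφ', fun X hX => ?_, fun X hX => ?_⟩
  · refine DifferentiableAt.differentiableWithinAt ?_
    rcases le_or_gt X.im 0 with h0 | h0
    · have h1 : X.im < 0 := lt_of_le_of_ne h0 fun h => by
        rw [mem_ofPred_eq, h, abs_zero] at hX; linarith
      refine (differentiableAt_const (0 : ℂ)).congr_of_eventuallyEq ?_
      filter_upwards [Complex.continuous_im.continuousAt.eventually_lt continuousAt_const h1]
        with Y hY using hφ' Y hY.le
    · refine DifferentiableAt.congr_of_eventuallyEq
        (((hEd X h0).clog (hEs X h0)).div_const (2 * π * Complex.I)) ?_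
      filter_upwards [continuousAt_const.eventually_lt Complex.continuous_im.continuousAt h0]
        with Y hY using hφ Y hY
  · have hp : E (X + 1) = E X := by
      have : eTwoPi (X + 1 + h * Complex.I) = eTwoPi (X + h * Complex.I) := by
        rw [← eTwoPi_add_one (X + h * Complex.I)]; congr 1; ring
      simp only [hE, this]
    simp only [φ, hp, Complex.add_im, Complex.one_im, add_zero]
  · rw [hφ X hX, norm_div]
    have h1 := Complex.norm_log_one_add_half_le_self (hE2 X hX)
    rw [add_sub_cancel] at h1
    have h2 := hE1 X hX
    have h3 : ‖(2 * π * Complex.I : ℂ)‖ = 2 * π := by simp [abs_of_pos hpi]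
    rw [h3, div_le_iff₀ (by positivity)]
    have h4 := Real.exp_pos (-(2 * π * (X.im + h)))
    have h5 := Real.pi_gt_three
    nlinarith
  · have e : eTwoPi (X + φ X - s + h * Complex.I)
        = eTwoPi (X + h * Complex.I) * (lam * eTwoPi (φ X)) := by
      rw [hlam, ← eTwoPi_add, ← eTwoPi_add]; congr 1; ring
    have e2 : eTwoPi (φ X) = E X := by
      rw [hφ X hX]; unfold eTwoPi
      rw [mul_div_cancel₀ _ hI, Complex.exp_log (Complex.slitPlane_ne_zero (hEs X hX))]
    rw [e, e2]
    have := hx0 X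
    simp only [hE]
    field_simp

theorem norm_pow_four_le_exp {X : ℂ} (h1 : 1 < X.im) (h2 : |X.re| ≤ 3) :
    ‖X‖ ^ 4 ≤ 6144 * Real.exp X.im := by
  have h3 := Complex.norm_le_abs_re_add_abs_im X
  rw [abs_of_pos (show 0 < X.im by linarith)] at h3
  have h4 : ‖X‖ ≤ 4 * X.im := by linarith
  have h5 := Real.pow_div_factorial_le_exp X.im (by linarith) 4
  have h6 : ((4).factorial : ℝ) = 24 := by norm_num [Nat.factorial]
  rw [h6, div_le_iff₀ (by norm_num)] at h5
  calc ‖X‖ ^ 4 ≤ (4 * X.im) ^ 4 := by gcongr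
    _ = 256 * X.im ^ 4 := by ring
    _ ≤ _ := by linarith

theorem exists_glueData : ∃ c > 0, c ≤ 1 / 1000 ∧ ∀ h : ℝ, Real.exp (-(2 * π * h)) ≤ c →
    ∀ s : ℝ, 2 ≤ s → ∀ f, InG (eTwoPi (-(s : ℂ))) f → ∃ φ m L, GlueData s φ m L ∧
      (∀ X : ℂ, 0 < X.im → f (eTwoPi (X + h * Complex.I))
        = eTwoPi (X + φ X - s + h * Complex.I)) := by
  obtain ⟨ε, hε0, hε1, hε⟩ := exists_glue
  refine ⟨ε / 6144, by positivity, by linarith, fun h hh s hs f hf => ?_⟩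
  have hpi := Real.pi_gt_three
  have hh0 : 0 ≤ h := by
    by_contra hc
    push Not at hc
    have := Real.one_le_exp (show 0 ≤ -(2 * π * h) by nlinarith)
    linarith
  obtain ⟨φ, p1, p2, p3, p4, p5⟩ := exists_lift hh0 hf
  have key : ∀ X : ℂ, 1 < X.im →
      ‖φ X‖ * (6144 * Real.exp X.im) ≤ ε := fun X hX => by
    have h1 := p4 X (by linarith)
    have e : Real.exp (-(2 * π * (X.im + h)))
        = Real.exp (-(2 * π * h)) * Real.exp (-(2 * π * X.im)) := by
      rw [← Real.exp_add]; congr 1; ring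
    have h2 : Real.exp (-(2 * π * X.im)) * Real.exp X.im ≤ 1 := by
      rw [← Real.exp_add]
      exact Real.exp_le_one_iff.2 (by nlinarith)
    have h3 := Real.exp_pos X.im
    have h4 := Real.exp_pos (-(2 * π * h))
    calc ‖φ X‖ * (6144 * Real.exp X.im)
        ≤ Real.exp (-(2 * π * h)) * Real.exp (-(2 * π * X.im)) * (6144 * Real.exp X.im) := by
          rw [← e]; gcongr
      _ = 6144 * Real.exp (-(2 * π * h)) * (Real.exp (-(2 * π * X.im)) * Real.exp X.im) := by ring
      _ ≤ 6144 * Real.exp (-(2 * π * h)) * 1 := by gcongr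
      _ ≤ ε := by linarith
  obtain ⟨m, m1, m2, m3, L, m4⟩ := hε s hs φ p1 (fun X hX hX2 => by
    rcases le_or_gt X.im 0 with h0 | h0
    · rw [p3 X h0, norm_zero]; positivity
    · rw [abs_of_pos h0] at hX
      have hn : 0 < ‖X‖ := by
        have := Complex.abs_im_le_norm X
        rw [abs_of_pos h0] at this; linarith
      rw [le_div_iff₀ (by positivity)]
      exact (mul_le_mul_of_nonneg_left (norm_pow_four_le_exp hX hX2) (norm_nonneg _)).trans
        (key X hX))
  refine ⟨φ, m, L, ⟨hs, p2, fun X hX => ?_, m1, m2, m3, m4⟩, p5⟩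
  rcases le_or_gt X.im 0 with h0 | h0
  · rw [p3 X h0, norm_zero]; norm_num
  · rw [abs_of_pos h0] at hX
    have h1 := key X hX
    have h2 := Real.one_le_exp h0.le
    have h3 := norm_nonneg (φ X)
    nlinarith

end Lift

section Transport
open Metric Set Topology MeasureTheory

/-- `w` lies on the forward orbit of `z`, which stays in the unit disc up to `w`. -/
def Reach (F : ℂ → ℂ) (z w : ℂ) : Prop := ∃ n, (∀ i ≤ n, ‖F^[i] z‖ < 1) ∧ F^[n] z = w

theorem Reach.trans {F : ℂ → ℂ} {x y z : ℂ} (h1 : Reach F x y) (h2 : Reach F y z) :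
    Reach F x z := by
  obtain ⟨n, a1, a2⟩ := h1
  obtain ⟨k, b1, b2⟩ := h2
  refine ⟨k + n, fun i hi => ?_, by rw [Function.iterate_add_apply, a2, b2]⟩
  rcases le_total i n with h | h
  · exact a1 i h
  · obtain ⟨j, rfl⟩ := Nat.exists_eq_add_of_le' h
    rw [Function.iterate_add_apply, a2]
    exact b1 j (by omega)

/-- The height above which orbits are transported to the renormalized coordinate. -/
noncomputable def topHeight : ℝ := 1 / (2 * π * kap) + 10

theorem ten_le_topHeight : 10 ≤ topHeight := by
  have := Real.pi_pos
  have := kap_pos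
  have : 0 ≤ 1 / (2 * π * kap) := by positivity
  unfold topHeight; linarith

theorem mem_glueI_of_im {s : ℝ} {X : ℂ} (h1 : -1 / 16 < X.re) (h2 : X.re < s + 1 / 16)
    (h3 : 5 < X.im) : X ∈ glueI s := by
  have h4 := (le_abs_self X.im).trans (Complex.abs_im_le_norm X)
  have h5 := (le_abs_self (X - s).im).trans (Complex.abs_im_le_norm (X - s))
  rw [Complex.sub_im, Complex.ofReal_im, sub_zero] at h5
  exact ⟨⟨h1, h2⟩, by linarith, by linarith⟩

theorem mem_glueO_of_im {s : ℝ} {X : ℂ} (h1 : -1 / 8 < X.re) (h2 : X.re < s + 9 / 8)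
    (h3 : 5 / 2 < X.im) : X ∈ glueO s := by
  have h4 := (le_abs_self X.im).trans (Complex.abs_im_le_norm X)
  have h5 := (le_abs_self (X - s).im).trans (Complex.abs_im_le_norm (X - s))
  rw [Complex.sub_im, Complex.ofReal_im, sub_zero] at h5
  exact ⟨⟨h1, h2⟩, by linarith, by linarith⟩

theorem iterate_zc {s : ℝ} {m F : ℂ → ℂ}
    (hF : ∀ W ∈ glueI s, 1 / (2 * π * kap) < (W + m W).im →
        F (zc s (W + m W)) = zc s (W + 1 + m (W + 1))) {W : ℂ} {k : ℕ}
    (hW : ∀ i < k, W + (i : ℕ) ∈ glueI s)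
    (hV : ∀ i ≤ k, 1 / (2 * π * kap) < (W + (i : ℕ) + m (W + (i : ℕ))).im) :
    ∀ i ≤ k, F^[i] (zc s (W + m W)) = zc s (W + (i : ℕ) + m (W + (i : ℕ))) := by
  intro i
  induction i with
  | zero => intro _; simp
  | succ i ih =>
    intro hi
    rw [Function.iterate_succ_apply', ih (by omega), hF _ (hW i (by omega)) (hV i (by omega))]
    push_cast
    rw [add_assoc W]

namespace GlueData

variable {s : ℝ} {φ m : ℂ → ℂ} {L : ℂ}

theorem im_map_ge (h : GlueData s φ m L) {X : ℂ} (hX : X ∈ glueO s) :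
    X.im - 1 / 1000 ≤ (X + m X).im := by
  have := (abs_le.1 ((Complex.abs_im_le_norm _).trans (h.bound X hX))).1
  rw [Complex.add_im]; linarith

theorem small_bounds (h : GlueData s φ m L) {Y : ℂ} (hY : 1 < Y.im) :
    |(φ Y).re| ≤ 1 / 1000 ∧ |(φ Y).im| ≤ 1 / 1000 := by
  have := h.small Y (hY.trans_le (le_abs_self _))
  exact ⟨(Complex.abs_re_le_norm _).trans this, (Complex.abs_im_le_norm _).trans this⟩

theorem reach_step (h : GlueData s φ m L) {F : ℂ → ℂ}
    (hF : ∀ W ∈ glueI s, 1 / (2 * π * kap) < (W + m W).im →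
        F (zc s (W + m W)) = zc s (W + 1 + m (W + 1)))
    {Y Y' : ℂ} (hY0 : 0 ≤ Y.re) (hY1 : Y.re < 1) (hY : topHeight - 1 ≤ Y.im)
    (hY0' : 0 ≤ Y'.re) (hY1' : Y'.re < 1) {k : ℤ} (hk : Y' = Y + φ Y - s + k)
    {j : ℕ} (hj : (j : ℝ) ≤ s - 11 / 10) :
    Reach F (zc s (Y + φ Y + j + m (Y + φ Y + j))) (zc s (Y' + s + m (Y' + s))) := by
  have hs := h.two_le
  have ht := ten_le_topHeight
  obtain ⟨f1, f2⟩ := h.small_bounds (Y := Y) (by linarith)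
  rw [abs_le] at f1 f2
  have hre : Y'.re = Y.re + (φ Y).re - s + k := by rw [hk]; simp
  have hjk : (j : ℤ) < k := by
    have : (j : ℝ) < k := by linarith
    exact_mod_cast this
  obtain ⟨n, hn⟩ := Int.eq_ofNat_of_zero_le (show 0 ≤ k - j by omega)
  have hn' : (k : ℝ) - j = n := by exact_mod_cast hn
  set W : ℂ := Y + φ Y + j with hW
  have hWre : ∀ i : ℕ, (W + i).re = Y.re + (φ Y).re + j + i := fun i => by simp [hW]
  have hWim : ∀ i : ℕ, (W + i).im = Y.im + (φ Y).im := fun i => by simp [hW]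
  have i1 : ∀ i < n, W + (i : ℕ) ∈ glueI s := fun i hi => by
    have hi' : (i : ℝ) + 1 ≤ n := by exact_mod_cast hi
    have h1 : (0 : ℝ) ≤ i := by positivity
    have h2 : (0 : ℝ) ≤ j := by positivity
    refine mem_glueI_of_im ?_ ?_ ?_
    · rw [hWre]; linarith
    · rw [hWre]; linarith
    · rw [hWim]; linarith
  have i2 : ∀ i ≤ n, 1 / (2 * π * kap) < (W + (i : ℕ) + m (W + (i : ℕ))).im := fun i hi => by
    have hi' : (i : ℝ) ≤ n := by exact_mod_cast hi
    have h1 : (0 : ℝ) ≤ i := by positivity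
    have h2 : (0 : ℝ) ≤ j := by positivity
    have h3 : W + (i : ℕ) ∈ glueO s := by
      refine mem_glueO_of_im ?_ ?_ ?_
      · rw [hWre]; linarith
      · rw [hWre]; linarith
      · rw [hWim]; linarith
    have h4 := h.im_map_ge h3
    rw [hWim] at h4
    have h5 : 1 / (2 * π * kap) = topHeight - 10 := by unfold topHeight; ring
    linarith
  have i3 := iterate_zc hF i1 i2
  refine ⟨n, fun i hi => ?_, ?_⟩
  · rw [i3 i hi]
    exact norm_zc_lt_one (by linarith) (i2 i hi)
  · rw [i3 n le_rfl]
    have e : W + (n : ℕ) = Y' + s := by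
      have hn2 : (k : ℂ) - j = n := by exact_mod_cast hn
      rw [hk, hW]; linear_combination -hn2
    rw [e]

theorem zc_entry (h : GlueData s φ m L) {Y : ℂ} (hY0 : 0 ≤ Y.re) (hY1 : Y.re < 1)
    (hY : 3 < Y.im) :
    zc s (Y + s + m (Y + s)) = zc s (Y + φ Y + m (Y + φ Y)) := by
  rw [h.map_add (by linarith) (by linarith) (hY.trans_le (le_abs_self _))]
  have := zc_add_int_mul (by linarith [h.two_le]) (Y + φ Y + m (Y + φ Y)) 1 (s := s)
  rwa [Int.cast_one, one_mul] at this

end GlueData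

theorem exists_eTwoPi_eq (b : ℝ) {x : ℂ} (hx : x ≠ 0) :
    ∃ Y : ℂ, 0 ≤ Y.re ∧ Y.re < 1 ∧ eTwoPi (Y + b * Complex.I) = x := by
  have hI : (2 * π * Complex.I : ℂ) ≠ 0 := Complex.two_pi_I_ne_zero
  set X : ℂ := Complex.log x / (2 * π * Complex.I) - b * Complex.I with hX
  have h1 : eTwoPi (X + b * Complex.I) = x := by
    unfold eTwoPi
    rw [hX, sub_add_cancel, mul_div_cancel₀ _ hI, Complex.exp_log hx]
  refine ⟨X + ((-⌊X.re⌋ : ℤ) : ℂ), ?_, ?_, ?_⟩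
  · have := Int.floor_le X.re
    rw [Complex.add_re, Complex.intCast_re, Int.cast_neg]; linarith
  · have := Int.lt_floor_add_one X.re
    rw [Complex.add_re, Complex.intCast_re, Int.cast_neg]; linarith
  · rw [add_right_comm, eTwoPi_add_int, h1]

theorem exists_int_of_eTwoPi_eq {a b : ℂ} (h : eTwoPi a = eTwoPi b) : ∃ n : ℤ, a = b + n := by
  obtain ⟨n, hn⟩ := Complex.exp_eq_exp_iff_exists_int.1 h
  refine ⟨n, mul_left_cancel₀ Complex.two_pi_I_ne_zero ?_⟩
  rw [hn]; ring

namespace GlueData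

variable {s : ℝ} {φ m : ℂ → ℂ} {L : ℂ}

theorem reach_iterate (h : GlueData s φ m L) {F f : ℂ → ℂ} {b : ℝ}
    (hF : ∀ W ∈ glueI s, 1 / (2 * π * kap) < (W + m W).im →
        F (zc s (W + m W)) = zc s (W + 1 + m (W + 1)))
    (hf : ∀ X : ℂ, 0 < X.im → f (eTwoPi (X + b * Complex.I))
        = eTwoPi (X + φ X - s + b * Complex.I)) (n : ℕ) :
    ∀ Y Y' : ℂ, 0 ≤ Y.re → Y.re < 1 → topHeight - 1 ≤ Y.im → 0 ≤ Y'.re → Y'.re < 1 →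
      (∀ i < n, ‖f^[i] (eTwoPi (Y + b * Complex.I))‖ ≤ Real.exp (-(2 * π * (topHeight + b)))) →
      f^[n] (eTwoPi (Y + b * Complex.I)) = eTwoPi (Y' + b * Complex.I) →
      topHeight - 1 ≤ Y'.im ∧
        Reach F (zc s (Y + s + m (Y + s))) (zc s (Y' + s + m (Y' + s))) := by
  have hs := h.two_le
  have ht := ten_le_topHeight
  have hpi := Real.pi_pos
  induction n with
  | zero =>
    intro Y Y' r0 r1 r2 r0' r1' _ he
    obtain ⟨k, hk⟩ := exists_int_of_eTwoPi_eq he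
    have hk2 : Y = Y' + k := by linear_combination hk
    have hre : Y.re = Y'.re + k := by rw [hk2]; simp
    have k1 : (k : ℝ) < 1 := by linarith
    have k2 : (-1 : ℝ) < k := by linarith
    have k1' : k < 1 := by exact_mod_cast k1
    have k2' : -1 < k := by exact_mod_cast k2
    have k0 : k = 0 := by omega
    rw [k0, Int.cast_zero, add_zero] at hk2
    subst hk2
    refine ⟨r2, 0, fun i hi => ?_, rfl⟩
    rw [Nat.le_zero.1 hi]
    have hm : Y + s ∈ glueO s := by
      refine mem_glueO_of_im ?_ ?_ ?_
      · rw [Complex.add_re, Complex.ofReal_re]; linarith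
      · rw [Complex.add_re, Complex.ofReal_re]; linarith
      · rw [Complex.add_im, Complex.ofReal_im]; linarith
    have h4 := h.im_map_ge hm
    have e : (Y + (s : ℂ)).im = Y.im := by simp
    rw [e] at h4
    have h5 : 1 / (2 * π * kap) = topHeight - 10 := by unfold topHeight; ring
    exact norm_zc_lt_one (by linarith) (by linarith)
  | succ n ih =>
    intro Y Y' r0 r1 r2 r0' r1' hi he
    have hYim : topHeight ≤ Y.im := by
      have h1 := hi 0 (by omega)
      rw [Function.iterate_zero_apply, norm_eTwoPi_add_mul_I, Real.exp_le_exp] at h1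
      nlinarith
    have hfx := hf Y (by linarith)
    obtain ⟨Y1, a1, a2, a3⟩ := exists_eTwoPi_eq b
      (eTwoPi_ne_zero (Y + φ Y - s + b * Complex.I))
    obtain ⟨k, hk⟩ := exists_int_of_eTwoPi_eq a3
    have hk2 : Y1 = Y + φ Y - s + k := by linear_combination hk
    have f2 := abs_le.1 (h.small_bounds (Y := Y) (by linarith)).2
    have hY1im : topHeight - 1 ≤ Y1.im := by
      have : Y1.im = Y.im + (φ Y).im := by rw [hk2]; simp
      linarith
    have st := h.reach_step hF r0 r1 r2 a1 a2 hk2 (j := 0) (by push_cast; linarith)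
    rw [Nat.cast_zero, add_zero, ← h.zc_entry r0 r1 (by linarith)] at st
    obtain ⟨c1, c2⟩ := ih Y1 Y' a1 a2 hY1im r0' r1'
      (fun i hi2 => by
        have := hi (i + 1) (by omega)
        rwa [Function.iterate_succ_apply, hfx, ← a3] at this)
      (by rw [a3, ← hfx, ← Function.iterate_succ_apply, he])
    exact ⟨c1, st.trans c2⟩

end GlueData
end Transport

section Renormalization
open Metric Set Topology MeasureTheory

/-- The size of the renormalized coordinate at the exit of the chain. -/
noncomputable def exitSize : ℝ :=
  Real.exp (-(π * (topHeight + 2))) / (2 * π * (topHeight + 4) * Real.exp (π * (topHeight + 4)) * kap)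

theorem exitSize_pos : 0 < exitSize := by
  have := Real.pi_pos
  have := kap_pos
  have := ten_le_topHeight
  unfold exitSize
  positivity

theorem exitSize_le_norm_zc {s : ℝ} (hs : 2 ≤ s) {v : ℂ} (h0 : 0 < v.im)
    (h1 : v.im ≤ topHeight + 2) (h2 : ‖v‖ ≤ topHeight + 4) :
    exitSize ≤ ‖zc s (v + s)‖ := by
  have hs0 : 0 < s := by linarith
  have hpi := Real.pi_pos
  have hk := kap_pos
  have ht := ten_le_topHeight
  have e := zc_add_int_mul hs0 v 1
  rw [Int.cast_one, one_mul] at e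
  rw [e, norm_zc hs0]
  have hx1 := norm_pos_iff.2 (one_sub_eTwoPi_ne_zero hs0 h0)
  have a1 : Real.exp (-(π * (topHeight + 2))) ≤ ‖eTwoPi (v / s)‖ := by
    rw [norm_eTwoPi, Complex.div_ofReal_im, Real.exp_le_exp, neg_le_neg_iff]
    have : v.im / s ≤ (topHeight + 2) / 2 := by gcongr
    nlinarith
  have a2 : ‖1 - eTwoPi (v / s)‖ * s ≤ 2 * π * (topHeight + 4) * Real.exp (π * (topHeight + 4)) := by
    have b1 := norm_one_sub_eTwoPi_div_le hs0 v
    have b2 : 2 * π * ‖v‖ / s ≤ π * (topHeight + 4) := by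
      rw [div_le_iff₀ hs0]
      have : ‖v‖ * 2 ≤ (topHeight + 4) * s := by gcongr
      nlinarith
    calc ‖1 - eTwoPi (v / s)‖ * s
        ≤ (2 * π * ‖v‖ / s * Real.exp (2 * π * ‖v‖ / s)) * s := by gcongr
      _ = 2 * π * ‖v‖ * Real.exp (2 * π * ‖v‖ / s) := by field_simp
      _ ≤ _ := by gcongr
  unfold exitSize
  have a3 : ‖1 - eTwoPi (v / s)‖ * (kap * s)
      ≤ 2 * π * (topHeight + 4) * Real.exp (π * (topHeight + 4)) * kap := by nlinarith
  gcongr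

theorem half_le_norm_one_sub_of_re {s : ℝ} (hs : 0 < s) {V : ℂ} (h1 : s / 4 ≤ V.re)
    (h2 : V.re ≤ 3 * s / 4) : 1 / 2 ≤ ‖1 - eTwoPi (V / s)‖ := by
  have hre : (eTwoPi (V / s)).re ≤ 0 := by
    have hpi := Real.pi_pos
    have e1 : (2 * π * Complex.I * (V / s)).im = 2 * π * (V.re / s) := by
      rw [show 2 * π * Complex.I * (V / s) = ((2 * π : ℝ) : ℂ) * ((V / s) * Complex.I) by
        push_cast; ring, Complex.im_ofReal_mul, Complex.mul_I_im,
        Complex.div_ofReal_re]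
    unfold eTwoPi
    rw [Complex.exp_re, e1]
    refine mul_nonpos_of_nonneg_of_nonpos (Real.exp_pos _).le ?_
    have b1 : 1 / 4 ≤ V.re / s := by rw [le_div_iff₀ hs]; linarith
    have b2 : V.re / s ≤ 3 / 4 := by rw [div_le_iff₀ hs]; linarith
    refine Real.cos_nonpos_of_pi_div_two_le_of_le ?_ ?_ <;> nlinarith
  have := (le_abs_self _).trans (Complex.abs_re_le_norm (1 - eTwoPi (V / s)))
  rw [Complex.sub_re, Complex.one_re] at this
  linarith

theorem half_le_norm_one_sub_of_im {s : ℝ} (hs : 0 < s) (hs8 : s < 8) {V : ℂ} (h1 : 9 ≤ V.im) :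
    1 / 2 ≤ ‖1 - eTwoPi (V / s)‖ := by
  have h0 : ‖eTwoPi (V / s)‖ ≤ 1 / 2 := by
    rw [norm_eTwoPi, Complex.div_ofReal_im]
    have hpi := Real.pi_gt_three
    have h2 : 9 / 8 ≤ V.im / s := by gcongr
    have h3 : Real.exp (-(2 * π * (V.im / s))) ≤ Real.exp (-1) := by
      rw [Real.exp_le_exp]; nlinarith
    have h4 := Real.exp_neg_one_lt_d9
    linarith
  have := norm_sub_norm_le 1 (eTwoPi (V / s))
  rw [norm_one] at this
  linarith

theorem norm_zc_le_of_half {s : ℝ} (hs : 0 < s) {V : ℂ} (h : 1 / 2 ≤ ‖1 - eTwoPi (V / s)‖) :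
    ‖zc s V‖ ≤ 2 / (kap * s) * Real.exp (-(2 * π * V.im / s)) := by
  have hk := kap_pos
  have e : ‖eTwoPi (V / s)‖ = Real.exp (-(2 * π * V.im / s)) := by
    rw [norm_eTwoPi, Complex.div_ofReal_im]; congr 1; ring
  rw [norm_zc hs, e, div_le_iff₀ (by positivity)]
  have h2 := Real.exp_pos (-(2 * π * V.im / s))
  have e2 : 2 / (kap * s) * Real.exp (-(2 * π * V.im / s)) * (‖1 - eTwoPi (V / s)‖ * (kap * s))
      = 2 * Real.exp (-(2 * π * V.im / s)) * ‖1 - eTwoPi (V / s)‖ := by field_simp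
  rw [e2]
  nlinarith

namespace GlueData

variable {s : ℝ} {φ m : ℂ → ℂ} {L : ℂ}

/-- A starting point of the transported orbit at controlled distance from the origin. -/
theorem exists_start (h : GlueData s φ m L) {Y : ℂ} (hY0 : 0 ≤ Y.re) (hY1 : Y.re < 1)
    (hY : topHeight - 1 / 2 ≤ Y.im) : ∃ j : ℕ, (j : ℝ) ≤ s - 11 / 10 ∧
      ‖zc s (Y + φ Y + j + m (Y + φ Y + j))‖
        ≤ 2 / (kap * s) * Real.exp (-(2 * π * (Y.im - 2 / 1000) / s)) := by
  have hs := h.two_le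
  have hs0 : 0 < s := by linarith
  have ht := ten_le_topHeight
  have hk := kap_pos
  have hpi := Real.pi_pos
  obtain ⟨f1, f2⟩ := h.small_bounds (Y := Y) (by linarith)
  rw [abs_le] at f1 f2
  have key : ∀ j : ℕ, (j : ℝ) ≤ s - 11 / 10 →
      Y.im - 2 / 1000 ≤ (Y + φ Y + j + m (Y + φ Y + j)).im ∧
      Y.re + j - 2 / 1000 ≤ (Y + φ Y + j + m (Y + φ Y + j)).re ∧
      (Y + φ Y + j + m (Y + φ Y + j)).re ≤ Y.re + j + 2 / 1000 := fun j hj => by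
    have hj0 : (0 : ℝ) ≤ j := by positivity
    have hre : (Y + φ Y + j).re = Y.re + (φ Y).re + j := by simp
    have him : (Y + φ Y + j).im = Y.im + (φ Y).im := by simp
    have hm : Y + φ Y + j ∈ glueO s := by
      refine mem_glueO_of_im ?_ ?_ ?_
      · rw [hre]; linarith
      · rw [hre]; linarith
      · rw [him]; linarith
    have b1 := abs_le.1 ((Complex.abs_im_le_norm _).trans (h.bound _ hm))
    have b2 := abs_le.1 ((Complex.abs_re_le_norm _).trans (h.bound _ hm))
    rw [Complex.add_im, Complex.add_re (Y + φ Y + j), hre, him]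
    exact ⟨by linarith, by linarith, by linarith⟩
  have fin : ∀ j : ℕ, (j : ℝ) ≤ s - 11 / 10 →
      1 / 2 ≤ ‖1 - eTwoPi ((Y + φ Y + j + m (Y + φ Y + j)) / s)‖ →
      ‖zc s (Y + φ Y + j + m (Y + φ Y + j))‖
        ≤ 2 / (kap * s) * Real.exp (-(2 * π * (Y.im - 2 / 1000) / s)) := fun j hj hh => by
    refine (norm_zc_le_of_half hs0 hh).trans ?_
    have := (key j hj).1
    gcongr
  rcases lt_or_ge s 8 with h8 | h8
  · have hj : ((0 : ℕ) : ℝ) ≤ s - 11 / 10 := by push_cast; linarith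
    refine ⟨0, hj, fin 0 hj (half_le_norm_one_sub_of_im hs0 h8 ?_)⟩
    exact le_trans (by linarith) (key 0 hj).1
  · have e1 := Nat.floor_le (show 0 ≤ s / 2 by linarith)
    have e2 := Nat.lt_floor_add_one (s / 2)
    have hj : ((⌊s / 2⌋₊ : ℕ) : ℝ) ≤ s - 11 / 10 := by linarith
    obtain ⟨k1, k2, k3⟩ := key _ hj
    exact ⟨_, hj, fin _ hj (half_le_norm_one_sub_of_re hs0 (by linarith) (by linarith))⟩

theorem escP_of_chain (h : GlueData s φ m L) {f : ℂ → ℂ} {b : ℝ}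
    (hf : ∀ X : ℂ, 0 < X.im → f (eTwoPi (X + b * Complex.I))
        = eTwoPi (X + φ X - s + b * Complex.I))
    (hb : Real.exp (-(2 * π * (topHeight + b))) ≤ exitSize) {Y₀ : ℝ} {x : ℂ} (hx : x ≠ 0)
    (hxY : ‖x‖ ≤ Real.exp (-Y₀)) {N : ℕ}
    (hN : ∀ i < N + 1, ‖f^[i] x‖ ≤ Real.exp (-(2 * π * (topHeight + b))))
    (hN2 : Real.exp (-(2 * π * (topHeight + 1 + b))) ≤ ‖f^[N + 1] x‖) :
    EscP (Real.exp (-(2 * π * (topHeight + b)))) (eTwoPi (1 / s))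
      (Y₀ / s + Real.log s - (Real.log (2 / kap) + π * |b| + 1)) := by
  have hs := h.two_le
  have hs0 : 0 < s := by linarith
  have ht := ten_le_topHeight
  have hk := kap_pos
  have hpi := Real.pi_pos
  obtain ⟨F, hFG, hF⟩ := h.exists_renormalized
  obtain ⟨Y, r0, r1, r2⟩ := exists_eTwoPi_eq b hx
  have hYim : topHeight ≤ Y.im := by
    have h1 := hN 0 (by omega)
    rw [Function.iterate_zero_apply, ← r2, norm_eTwoPi_add_mul_I, Real.exp_le_exp] at h1
    nlinarith
  have hfx := hf Y (by linarith)
  rw [r2] at hfx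
  obtain ⟨Y1, a0, a1, a2⟩ := exists_eTwoPi_eq b
    (eTwoPi_ne_zero (Y + φ Y - s + b * Complex.I))
  obtain ⟨k, hk1⟩ := exists_int_of_eTwoPi_eq a2
  have hk2 : Y1 = Y + φ Y - s + k := by linear_combination hk1
  have f2 := abs_le.1 (h.small_bounds (Y := Y) (by linarith)).2
  have hY1im : topHeight - 1 ≤ Y1.im := by
    have : Y1.im = Y.im + (φ Y).im := by rw [hk2]; simp
    linarith
  have hend0 : f^[N + 1] x ≠ 0 := norm_pos_iff.1 ((Real.exp_pos _).trans_le hN2)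
  obtain ⟨Y', c0, c1, c2⟩ := exists_eTwoPi_eq b hend0
  have hY'im : Y'.im ≤ topHeight + 1 := by
    rw [← c2, norm_eTwoPi_add_mul_I, Real.exp_le_exp] at hN2
    nlinarith
  rw [← hfx] at a2
  obtain ⟨d1, d2⟩ := h.reach_iterate hF hf N Y1 Y' a0 a1 hY1im c0 c1
    (fun i hi => by
      have := hN (i + 1) (by omega)
      rwa [Function.iterate_succ_apply, ← a2] at this)
    (by rw [a2, c2, Function.iterate_succ_apply])
  obtain ⟨j, hj, hj2⟩ := h.exists_start r0 r1 (by linarith)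
  have hreach := (h.reach_step hF r0 r1 (by linarith) a0 a1 hk2 hj).trans d2
  obtain ⟨n, n1, n2⟩ := hreach
  refine ⟨F, hFG, _, hj2.trans ?_, n, n1, ?_⟩
  · have hx2 : Y₀ ≤ 2 * π * (Y.im + b) := by
      rw [← r2, norm_eTwoPi_add_mul_I, Real.exp_le_exp] at hxY
      linarith
    have e1 : 2 / (kap * s) = Real.exp (Real.log (2 / kap) - Real.log s) := by
      rw [Real.exp_sub, Real.exp_log (by positivity), Real.exp_log hs0]; field_simp
    rw [e1, ← Real.exp_add, Real.exp_le_exp]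
    have g1 : Y₀ / s ≤ 2 * π * (Y.im - 2 / 1000) / s + (2 * π * |b| + 1) / s := by
      rw [← add_div]
      have := le_abs_self b
      have := Real.pi_lt_four
      gcongr
      nlinarith
    have g2 : (2 * π * |b| + 1) / s ≤ π * |b| + 1 := by
      rw [div_le_iff₀ hs0]
      have : 0 ≤ π * |b| := by positivity
      nlinarith
    linarith
  · rw [n2]
    refine hb.trans ?_
    have hm : Y' + s ∈ glueO s := by
      refine mem_glueO_of_im ?_ ?_ ?_
      · rw [Complex.add_re, Complex.ofReal_re]; linarith
      · rw [Complex.add_re, Complex.ofReal_re]; linarith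
      · rw [Complex.add_im, Complex.ofReal_im]; linarith
    have b1 := abs_le.1 ((Complex.abs_im_le_norm _).trans (h.bound _ hm))
    have b2 := abs_le.1 ((Complex.abs_re_le_norm _).trans (h.bound _ hm))
    rw [show Y' + s + m (Y' + s) = (Y' + m (Y' + s)) + s by ring]
    have v1 : (Y' + m (Y' + s)).im = Y'.im + (m (Y' + s)).im := Complex.add_im _ _
    have v2 : (Y' + m (Y' + s)).re = Y'.re + (m (Y' + s)).re := Complex.add_re _ _
    refine exitSize_le_norm_zc hs (by linarith) (by linarith) ?_
    refine (Complex.norm_le_abs_re_add_abs_im _).trans ?_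
    have v3 : |(Y' + m (Y' + s)).re| ≤ 2 := abs_le.2 ⟨by linarith, by linarith⟩
    have v4 : |(Y' + m (Y' + s)).im| ≤ topHeight + 2 := abs_le.2 ⟨by linarith, by linarith⟩
    linarith

end GlueData

theorem InG.map_zero {lam : ℂ} {f : ℂ → ℂ} (h : InG lam f) : f 0 = 0 := by
  have := h.2 0 (mem_ball_self one_pos)
  simpa using this

/-- The renormalization step. -/
theorem exists_renormalization_step : ∃ s₀ : ℝ, 0 < s₀ ∧ s₀ < 1 ∧ ∃ C : ℝ,
    ∀ α : ℝ, 0 < α → α ≤ 1 / 2 → ∀ Y : ℝ, 0 ≤ Y → EscP s₀ (eTwoPi (-(1 / α : ℝ))) Y →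
      EscP s₀ (eTwoPi α) (α * Y + Real.log (1 / α) - C) := by
  obtain ⟨c, hc0, hc1, hc⟩ := exists_glueData
  have ht := ten_le_topHeight
  have hpi := Real.pi_gt_three
  obtain ⟨b, hb0, hb1, hb2⟩ : ∃ b : ℝ, 0 < b ∧ Real.exp (-(2 * π * b)) ≤ c ∧
      Real.exp (-(2 * π * (topHeight + b))) ≤ exitSize := by
    have hlim : Tendsto (fun b : ℝ => Real.exp (-b)) atTop (𝓝 0) :=
      Real.tendsto_exp_neg_atTop_nhds_zero
    obtain ⟨b, h1, h2, h3⟩ := ((hlim.eventually_lt_const hc0).and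
      ((hlim.eventually_lt_const exitSize_pos).and (eventually_gt_atTop 0))).exists
    refine ⟨b, h3, le_trans ?_ h1.le, le_trans ?_ h2.le⟩
    · rw [Real.exp_le_exp]; nlinarith
    · rw [Real.exp_le_exp]; nlinarith
  refine ⟨Real.exp (-(2 * π * (topHeight + b))), Real.exp_pos _,
    Real.exp_lt_one_iff.2 (by nlinarith), Real.log (2 / kap) + π * |b| + 1,
    fun α hα hα2 Y hY hE => ?_⟩
  set s : ℝ := 1 / α with hs
  have hs2 : 2 ≤ s := by rw [hs, le_div_iff₀ hα]; linarith
  obtain ⟨f, hf, z, hz, n, hn1, hn2⟩ := hE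
  have hf' : InG (eTwoPi (-(s : ℂ))) f := by simpa using hf
  obtain ⟨φ, m, L, hG, hconj⟩ := hc b hb1 s hs2 f hf'
  have e1 : eTwoPi α = eTwoPi (1 / s) := by
    congr 1; rw [hs]; push_cast; field_simp
  have e2 : α * Y = Y / s := by rw [hs]; field_simp
  rw [e1, e2]
  set s₀ := Real.exp (-(2 * π * (topHeight + b))) with hs₀
  have hs₀p : 0 < s₀ := Real.exp_pos _
  have hmono : Real.exp (-(2 * π * (topHeight + 1 + b))) ≤ s₀ / 2 := by
    have : Real.exp (-(2 * π * (topHeight + 1 + b))) = s₀ * Real.exp (-(2 * π)) := by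
      rw [hs₀, ← Real.exp_add]; congr 1; ring
    rw [this]
    have h3 : Real.exp (-(2 * π)) ≤ Real.exp (-1) := by rw [Real.exp_le_exp]; linarith
    have h4 := Real.exp_neg_one_lt_d9
    nlinarith
  classical
  have hex : ∃ N, s₀ ≤ ‖f^[N] z‖ := ⟨n, hn2⟩
  set N := Nat.find hex with hNdef
  have hN : s₀ ≤ ‖f^[N] z‖ := Nat.find_spec hex
  have hNmin : ∀ i < N, ‖f^[i] z‖ < s₀ := fun i hi => not_le.1 (Nat.find_min hex hi)
  have hz0 : z ≠ 0 := fun h => by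
    have : f^[N] z = 0 := by rw [h]; exact Function.iterate_fixed hf.map_zero N
    rw [this, norm_zero] at hN
    linarith
  rcases Nat.eq_zero_or_eq_succ_pred N with h0 | h0
  · rw [h0, Function.iterate_zero_apply] at hN
    have hs₀n : ‖(s₀ : ℂ)‖ = s₀ := by rw [Complex.norm_real, Real.norm_of_nonneg hs₀p.le]
    have hs₀1 : s₀ < 1 := Real.exp_lt_one_iff.2 (by nlinarith)
    refine hG.escP_of_chain hconj hb2 (x := (s₀ : ℂ)) (N := 0)
      (by exact_mod_cast hs₀p.ne') (by rw [hs₀n]; exact hN.trans hz) (fun i hi => ?_) ?_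
    · have : i = 0 := by omega
      rw [this, Function.iterate_zero_apply, hs₀n]
    · refine hmono.trans ?_
      rw [zero_add, Function.iterate_one]
      have h1 := hf'.2 (s₀ : ℂ) (by rw [mem_ball_zero_iff, hs₀n]; exact hs₀1)
      have h2 := norm_sub_norm_le (eTwoPi (-(s : ℂ)) * s₀) (eTwoPi (-(s : ℂ)) * s₀ - f s₀)
      have h3 : ‖eTwoPi (-(s : ℂ))‖ = 1 := by rw [norm_eTwoPi]; simp
      rw [sub_sub_cancel, norm_sub_rev _ (f s₀), norm_mul, h3, hs₀n, one_mul] at h2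
      rw [hs₀n] at h1
      nlinarith
  · refine hG.escP_of_chain hconj hb2 hz0 hz (N := N.pred) (fun i hi => ?_) ?_
    · exact (hNmin i (by omega)).le
    · have h1 : N.pred + 1 = N := h0.symm
      rw [h1]
      linarith

end Renormalization

/-- Yoccoz's theorem: if the quadratic polynomial `P_θ(z) = z² + e^{2πiθ}z` is linearizable
at its fixed point `0`, then `θ` is a Brjuno number: `Σ_n log(q_{n+1})/q_n < ∞`. -/
theorem yoccoz_brjuno_condition
    (θ : ℝ) (a : ℕ → ℕ) (hθ : HasCF θ a)
    (hlin : ∃ r : ℝ, 0 < r ∧ ∃ ψ : ℂ → ℂ,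
      DifferentiableOn ℂ ψ (Metric.ball 0 r) ∧ Set.InjOn ψ (Metric.ball 0 r) ∧
      ψ 0 = 0 ∧ deriv ψ 0 = 1 ∧
      ∀ z ∈ Metric.ball (0 : ℂ) r,
        (ψ z) ^ 2 + Complex.exp (2 * Real.pi * Complex.I * θ) * ψ z
          = ψ (Complex.exp (2 * Real.pi * Complex.I * θ) * z)) :
    (∑' k : ℕ, ENNReal.ofReal (Real.log (qden a (k + 1)) / qden a k)) < ⊤ := by
  obtain ⟨r, hr, ψ, hψ, -, h0, h1, heq⟩ := hlin
  obtain ⟨s₀, hs0, hs1, C, hstep⟩ := exists_renormalization_step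
  have hnorm : ‖eTwoPi θ‖ = 1 := by rw [norm_eTwoPi]; simp
  obtain ⟨Y, hY⟩ := not_escP_of_linearizable hnorm hr hψ h0 h1 heq hs0
  exact brjuno_of_step hs0.le hs1 hstep hθ hY
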